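/- Let H satisfy the Hurst hypotheses with 0 < H(x) < 1 and Leb(D) = 0, and let μ be a centered Gaussian measure on the real Hilbert space L²(0,1) with covariance kernel G(x,y) = C_*(H(x))·C_*(H(y)) · ∫_ℝ Re[(e^{ixξ} − 1)(e^{−iyξ} − 1)] · |ξ|^{−(H(x)+H(y)+1)} dξ. Then lim_{ε→0⁺} ε^{1/H_min} · ((log(1/ε))^σ / φ(log(1/ε)))^{(2H_min+1)/(2H_min)} · log μ({f : ‖f‖_{L²(0,1)} ≤ ε}) = − H_min · ( (Γ(2H_min+1)·sin(πH_min))^{1/(2H_min+1)} · Γ(σ+1) · (H_min·(H_min+1/2))^σ / ((2H_min+1)·sin(π/(2H_min+1))) )^{(2H_min+1)/(2H_min)}. -/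

import Mathlib

open MeasureTheory Set Filter Metric
open scoped ENNReal NNReal Real

noncomputable section

/-- `C_*(H) = (Γ(2H+1) sin(πH) / (2π))^{1/2}`. -/
def Cstar (H : ℝ) : ℝ :=
  Real.sqrt (Real.Gamma (2 * H + 1) * Real.sin (Real.pi * H) / (2 * Real.pi))

/-- Covariance kernel of the multifractional Brownian motion with functional Hurst
parameter `H`. -/
def GmBM (H : ℝ → ℝ) (x y : ℝ) : ℝ :=
  Cstar (H x) * Cstar (H y) *
    ∫ ξ : ℝ, ((Complex.exp (Complex.I * x * ξ) - 1) *
      (Complex.exp (-Complex.I * y * ξ) - 1)).re * |ξ| ^ (-(H x + H y + 1))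

/-- Hölder continuity of exponent `r` on a set. -/
def HolderOn (f : ℝ → ℝ) (r : ℝ) (s : Set ℝ) : Prop :=
  ∃ C : ℝ, ∀ x ∈ s, ∀ y ∈ s, |f x - f y| ≤ C * |x - y| ^ r

section aux
open Real
open Finset (sum_congr mul_sum sum_mul sum_comm sum_le_sum sum_nonneg sum_add_distrib sum_sub_distrib sum_const card_univ)

section n0
notation "I₁" => Icc (0:ℝ) 1
notation "ip" => @inner ℝ _ _
notation "ps" => (by positivity)
end n0

section linalg
variable {n : Type*} [Fintype n] [DecidableEq n]

def ld (M : Matrix n n ℝ) : ℝ := log (1 + M).det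

lemma psd_spectral {M : Matrix n n ℝ} (hM : M.PosSemidef) :
    ∃ (ev : n → ℝ) (u : n → n → ℝ), (∀ i, 0 ≤ ev i) ∧
      (∀ i j, ∑ k, u i k * u j k = if i = j then 1 else 0) ∧
      (∀ k l, ∑ i, u i k * u i l = if k = l then 1 else 0) ∧
      (∀ k l, M k l = ∑ i, ev i * (u i k * u i l)) ∧
      (1 + M).det = ∏ i, (1 + ev i) ∧ (M.trace = ∑ i, ev i) ∧
      (M.rank = Fintype.card {i // ev i ≠ 0}) := by
  classical
  set U : Matrix n n ℝ := (hM.1.eigenvectorUnitary : Matrix n n ℝ) with hU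
  have ho : U * U.transpose = 1 := by
    have := Unitary.mul_star_self_of_mem hM.1.eigenvectorUnitary.2
    simpa [Matrix.star_eq_conjTranspose, Matrix.conjTranspose_eq_transpose_of_trivial] using this
  have hO : U.transpose * U = 1 := by
    have := Unitary.star_mul_self_of_mem hM.1.eigenvectorUnitary.2
    simpa [Matrix.star_eq_conjTranspose, Matrix.conjTranspose_eq_transpose_of_trivial] using this
  have h3 : M = U * Matrix.diagonal hM.1.eigenvalues * U.transpose := by
    have := hM.1.spectral_theorem
    rw [Unitary.conjStarAlgAut_apply] at this
    simpa [Matrix.star_eq_conjTranspose, Matrix.conjTranspose_eq_transpose_of_trivial,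
      Function.comp_def] using this
  refine ⟨hM.1.eigenvalues, fun i k => U k i, hM.eigenvalues_nonneg, ?_, ?_, ?_, ?_, ?_, ?_⟩
  · intro i j
    have := congrFun (congrFun hO i) j
    simpa [Matrix.mul_apply, Matrix.one_apply] using this
  · intro i j
    have := congrFun (congrFun ho i) j
    simpa [Matrix.mul_apply, Matrix.one_apply] using this
  · intro k l
    have := congrFun (congrFun h3 k) l
    rw [this, Matrix.mul_apply]
    refine sum_congr rfl fun i _ => ?_
    rw [Matrix.mul_diagonal, Matrix.transpose_apply]; ring
  · have h4 : 1 + M = U * Matrix.diagonal (fun i => 1 + hM.1.eigenvalues i) * U.transpose := by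
      have : Matrix.diagonal (fun i => 1 + hM.1.eigenvalues i) =
          1 + Matrix.diagonal hM.1.eigenvalues := by
        rw [← Matrix.diagonal_one, Matrix.diagonal_add]
      rw [this, mul_add, add_mul, mul_one, ho, ← h3]
    rw [h4, Matrix.det_mul, Matrix.det_mul, mul_right_comm, ← Matrix.det_mul, ho,
      Matrix.det_one, one_mul, Matrix.det_diagonal]
  · have := hM.1.trace_eq_sum_eigenvalues
    simpa using this
  · exact hM.1.rank_eq_card_non_zero_eigs

lemma ld_eq_sum {ev : n → ℝ} {M : Matrix n n ℝ} (h0 : ∀ i, 0 ≤ ev i)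
    (h : (1 + M).det = ∏ i, (1 + ev i)) : ld M = ∑ i, log (1 + ev i) := by
  rw [ld, h, log_prod]
  intro i _; have := h0 i; positivity

lemma ld_hadamard {M : Matrix n n ℝ} (hM : M.PosSemidef) (v : n → n → ℝ)
    (hvo : ∀ i j, ∑ k, v i k * v j k = if i = j then 1 else 0)
    (hvz : ∀ k l, ∑ i, v i k * v i l = if k = l then 1 else 0) :
    ld M ≤ ∑ i, log (1 + ∑ k, ∑ l, v i k * M k l * v i l) := by
  obtain ⟨ev, u, h0, huo, huz, hM', hdet, -, -⟩ := psd_spectral hM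
  rw [ld_eq_sum h0 hdet]
  set p : n → n → ℝ := fun i j => (∑ k, u i k * v j k) ^ 2 with hp
  have hpo : ∀ i j, 0 ≤ p i j := fun i j => sq_nonneg _
  have hsum : ∀ (u v : n → n → ℝ) (_ : ∀ k l, ∑ i, v i k * v i l = if k = l then (1:ℝ) else 0)
      (_ : ∀ i j, ∑ k, u i k * u j k = if i = j then (1:ℝ) else 0) i,
      ∑ j, (∑ k, u i k * v j k) ^ 2 = 1 := by
    intro u v hv hu i
    calc ∑ j, (∑ k, u i k * v j k) ^ 2 = ∑ j, ∑ k, ∑ l, (u i k * u i l) * (v j k * v j l) := by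
          refine sum_congr rfl fun j _ => ?_
          rw [sq, Finset.sum_mul_sum]
          refine sum_congr rfl fun k _ => sum_congr rfl fun l _ => ?_
          ring
      _ = ∑ k, ∑ l, (u i k * u i l) * ∑ j, (v j k * v j l) := by
          rw [sum_comm]
          refine sum_congr rfl fun k _ => ?_
          rw [sum_comm]
          simp [mul_sum]
      _ = 1 := by
          simp only [hv]
          simp only [mul_ite, mul_one, mul_zero, Finset.sum_ite_eq, Finset.mem_univ, if_true]
          simpa using hu i i
  have sz : ∀ i, ∑ j, p i j = 1 := hsum u v hvz huo
  have sa : ∀ j, ∑ i, p i j = 1 := by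
    intro j
    have := hsum v u huz hvo j
    rw [← this]
    refine sum_congr rfl fun i _ => ?_
    simp only [hp]
    congr 1
    exact sum_congr rfl fun k _ => mul_comm _ _
  calc ∑ i, log (1 + ev i) = ∑ i, ∑ j, p i j * log (1 + ev i) := by
        refine sum_congr rfl fun i _ => ?_
        rw [← sum_mul, sz, one_mul]
    _ = ∑ j, ∑ i, p i j * log (1 + ev i) := sum_comm
    _ ≤ ∑ j, log (∑ i, p i j * (1 + ev i)) := by
        refine sum_le_sum fun j _ => ?_
        have := strictConcaveOn_log_Ioi.concaveOn.le_map_sum (t := Finset.univ)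
          (w := fun i => p i j) (p := fun i => 1 + ev i) (fun i _ => hpo i j) (sa j)
          (fun i _ => by have := h0 i; simp only [mem_Ioi]; linarith)
        simpa using this
    _ = _ := by
        refine sum_congr rfl fun j _ => ?_
        congr 1
        simp only [mul_add, mul_one, sum_add_distrib, sa]
        congr 1
        simp only [hM', hp, mul_sum, sum_mul, sq, Finset.sum_mul_sum]
        rw [sum_comm]
        refine sum_congr rfl fun k _ => ?_
        rw [sum_comm]
        refine sum_congr rfl fun l _ => ?_
        refine sum_congr rfl fun i _ => ?_
        ring

lemma ld_hadamard_diag {M : Matrix n n ℝ} (hM : M.PosSemidef) :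
    ld M ≤ ∑ i, log (1 + M i i) := by
  have := ld_hadamard hM (fun i j => if i = j then 1 else 0) (by intro i j; simp [eq_comm])
    (by intro i j; simp [eq_comm])
  simpa using this

lemma ld_mono {M M' : Matrix n n ℝ} (hM : M.PosSemidef) (hM' : M'.PosSemidef)
    (h : ∀ x : n → ℝ, ∑ k, ∑ l, x k * M k l * x l ≤ ∑ k, ∑ l, x k * M' k l * x l) :
    ld M ≤ ld M' := by
  obtain ⟨ev, u, h0, huo, huz, hM'', hdet, -, -⟩ := psd_spectral hM'
  rw [ld_eq_sum h0 hdet]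
  refine (ld_hadamard hM u huo huz).trans (sum_le_sum fun i _ => ?_)
  have key : ∑ k, ∑ l, u i k * M' k l * u i l = ev i := by
    simp only [hM'', mul_sum, sum_mul]
    calc _ = ∑ j, ev j * ((∑ k, u i k * u j k) * (∑ l, u i l * u j l)) := by
          rw [sum_congr rfl fun k _ => sum_comm, sum_comm]
          refine sum_congr rfl fun j _ => ?_
          rw [Finset.sum_mul_sum, mul_sum]
          refine sum_congr rfl fun k _ => ?_
          rw [mul_sum]
          refine sum_congr rfl fun l _ => ?_
          ring
      _ = _ := by simp [huo]
  have ho := h (u i)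
  rw [key] at ho
  have hO : 0 ≤ ∑ k, ∑ l, u i k * M k l * u i l := by
    have := hM.dotProduct_mulVec_nonneg (u i)
    simp only [dotProduct, Matrix.mulVec, mul_sum] at this
    refine this.trans_eq ?_
    refine sum_congr rfl fun k _ => sum_congr rfl fun l _ => ?_
    simp; ring
  exact log_le_log (by linarith) (by linarith)

lemma one_add_posDef {X : Matrix n n ℝ} (hX : X.PosSemidef) : (1 + X).PosDef :=
  Matrix.PosDef.one.add_posSemidef hX

lemma ld_subadd {X Y : Matrix n n ℝ} (hX : X.PosSemidef) (hY : Y.PosSemidef) :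
    ld (X + Y) ≤ ld X + ld Y := by
  classical
  obtain ⟨B, hB'⟩ : ∃ B : Matrix n n ℝ, Y = B.transpose * B := by
    obtain ⟨ev, u, h0, -, -, hYe, -, -, -⟩ := psd_spectral hY
    refine ⟨Matrix.of fun i k => sqrt (ev i) * u i k, ?_⟩
    ext k l
    rw [hYe, Matrix.mul_apply]
    refine sum_congr rfl fun i _ => ?_
    simp only [Matrix.transpose_apply, Matrix.of_apply]
    have := mul_self_sqrt (h0 i)
    linear_combination (-(u i k * u i l)) * this
  have hP := one_add_posDef hX
  have hPu : IsUnit (1 + X).det := (Matrix.isUnit_iff_isUnit_det _).1 hP.isUnit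
  set R := (1 + X)⁻¹ with hR
  have hRP : R.PosDef := hP.inv
  have eo : 1 + (X + Y) = (1 + X) * (1 + R * B.transpose * B) := by
    rw [mul_add, mul_one, mul_assoc R, ← mul_assoc (1+X), Matrix.mul_nonsing_inv _ hPu, one_mul,
      hB', add_assoc]
  have ez : (1 + R * B.transpose * B).det = (1 + B * (R * B.transpose)).det :=
    Matrix.det_one_add_mul_comm _ _
  have hZ : (B * (R * B.transpose)).PosSemidef := by
    have := hRP.posSemidef.mul_mul_conjTranspose_same B
    rwa [Matrix.conjTranspose_eq_transpose_of_trivial, mul_assoc] at this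
  have hW : (B * B.transpose).PosSemidef := by
    have := Matrix.posSemidef_self_mul_conjTranspose B
    rwa [Matrix.conjTranspose_eq_transpose_of_trivial] at this
  have ee : ld Y = ld (B * B.transpose) := by
    rw [ld, ld, hB', Matrix.det_one_add_mul_comm]
  have hRs : R.conjTranspose = R := hRP.1
  have hD : (1 - R).PosSemidef := by
    have hXX : (X + X.conjTranspose * X).PosSemidef :=
      hX.add (Matrix.posSemidef_conjTranspose_mul_self X)
    have h := hXX.mul_mul_conjTranspose_same R
    have hXs : X.conjTranspose = X := hX.1
    rw [hRs, hXs] at h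
    have e : R * (X + X * X) * R = 1 - R := by
      have ao : R * (1 + X) = 1 := Matrix.nonsing_inv_mul _ hPu
      have az : (1 + X) * R = 1 := Matrix.mul_nonsing_inv _ hPu
      have aa : X * R = 1 - R := by rw [← az]; noncomm_ring
      calc R * (X + X * X) * R = (R * (1 + X)) * (X * R) := by noncomm_ring
        _ = 1 - R := by rw [ao, one_mul, aa]
    rwa [e] at h
  have hmono : ld (B * (R * B.transpose)) ≤ ld (B * B.transpose) := by
    refine ld_mono hZ hW fun x => ?_
    have h := (hD.mul_mul_conjTranspose_same B).dotProduct_mulVec_nonneg x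
    have e : B * (1 - R) * B.conjTranspose = B * B.transpose - B * (R * B.transpose) := by
      rw [Matrix.conjTranspose_eq_transpose_of_trivial]; noncomm_ring
    rw [e, Matrix.sub_mulVec, dotProduct_sub] at h
    have cv : ∀ M : Matrix n n ℝ, star x ⬝ᵥ M.mulVec x = ∑ k, ∑ l, x k * M k l * x l := by
      intro M
      simp only [dotProduct, Matrix.mulVec, mul_sum]
      refine sum_congr rfl fun k _ => sum_congr rfl fun l _ => ?_
      simp; ring
    rw [cv, cv] at h
    linarith
  have hdet1 : 0 < (1 + X).det := hP.det_pos
  have hdet2 : 0 < (1 + B * (R * B.transpose)).det := (one_add_posDef hZ).det_pos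
  rw [ld, eo, Matrix.det_mul, ez, log_mul hdet1.ne' hdet2.ne', ee]
  exact add_le_add le_rfl hmono

lemma ld_le_trace {M : Matrix n n ℝ} (hM : M.PosSemidef) : ld M ≤ M.trace := by
  obtain ⟨ev, u, h0, huo, huz, hM'', hdet, htr, -⟩ := psd_spectral hM
  rw [ld_eq_sum h0 hdet, htr]
  refine sum_le_sum fun i _ => ?_
  have := log_le_sub_one_of_pos (x := 1 + ev i) (by have := h0 i; positivity)
  linarith

lemma ld_le_rank {M : Matrix n n ℝ} (hM : M.PosSemidef) {c : ℕ} (hc : M.rank ≤ c) :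
    ld M ≤ c * log (1 + M.trace) := by
  classical
  obtain ⟨ev, u, h0, huo, huz, hM'', hdet, htr, hrk⟩ := psd_spectral hM
  rw [ld_eq_sum h0 hdet, htr]
  have hle : ∀ i, ev i ≤ ∑ i, ev i := fun i =>
    Finset.single_le_sum (f := ev) (fun j _ => h0 j) (Finset.mem_univ i)
  have hS : 0 ≤ ∑ i, ev i := sum_nonneg fun i _ => h0 i
  have hL : 0 ≤ log (1 + ∑ i, ev i) := log_nonneg (by linarith)
  calc ∑ i, log (1 + ev i) ≤ ∑ i, if ev i ≠ 0 then log (1 + ∑ i, ev i) else 0 := by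
        refine sum_le_sum fun i _ => ?_
        split_ifs with h
        · exact log_le_log (by have := h0 i; positivity) (by linarith [hle i])
        · push Not at h; simp [h]
    _ = M.rank * log (1 + ∑ i, ev i) := by
        rw [← Finset.sum_filter, sum_const, hrk, Fintype.card_subtype, nsmul_eq_mul]
    _ ≤ _ := by gcongr

end linalg

section gramsec
variable {n : Type*} [Fintype n] [DecidableEq n]
variable {F : Type*} [NormedAddCommGroup F] [InnerProductSpace ℝ F]

lemma gram_quad (v : n → F) (x : n → ℝ) :
    ∑ k, ∑ l, x k * Matrix.gram ℝ v k l * x l = ‖∑ k, x k • v k‖ ^ 2 := by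
  rw [← real_inner_self_eq_norm_sq, sum_inner]
  refine sum_congr rfl fun k _ => ?_
  rw [inner_sum]
  refine sum_congr rfl fun l _ => ?_
  rw [real_inner_smul_left, real_inner_smul_right, Matrix.gram_apply]; ring

lemma smul_quad (g : ℝ) (M : Matrix n n ℝ) (x : n → ℝ) :
    ∑ k, ∑ l, x k * (g • M) k l * x l = g * ∑ k, ∑ l, x k * M k l * x l := by
  simp only [mul_sum]
  refine sum_congr rfl fun k _ => sum_congr rfl fun l _ => ?_
  simp only [Matrix.smul_apply, smul_eq_mul]; ring

lemma add_quad (M M' : Matrix n n ℝ) (x : n → ℝ) :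
    ∑ k, ∑ l, x k * (M + M') k l * x l =
      ∑ k, ∑ l, x k * M k l * x l + ∑ k, ∑ l, x k * M' k l * x l := by
  simp only [← sum_add_distrib]
  refine sum_congr rfl fun k _ => sum_congr rfl fun l _ => ?_
  simp only [Matrix.add_apply]; ring

lemma smul_gram_psd {g : ℝ} (hg : 0 ≤ g) (v : n → F) : (g • Matrix.gram ℝ v).PosSemidef :=
  (Matrix.posSemidef_gram ℝ v).smul hg

lemma norm_add3_sq (η : ℝ) (hη : 0 < η) (t b c : F) :
    ‖t + b + c‖ ^ 2 ≤ 2 * (1 + 1 / η) * ‖t‖ ^ 2 + 2 * (1 + 1 / η) * ‖b‖ ^ 2 + (1 + η) * ‖c‖ ^ 2 := by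
  have ho : ‖t + b + c‖ ≤ ‖t‖ + ‖b‖ + ‖c‖ := norm_add₃_le
  have h0 := norm_nonneg (t + b + c)
  set T := ‖t‖; set B := ‖b‖; set C := ‖c‖
  have hO : ‖t + b + c‖ ^ 2 ≤ (T + B + C) ^ 2 := by gcongr
  have h3 : 2 * (T + B) * C ≤ (1 / η) * (T + B) ^ 2 + η * C ^ 2 := by
    have := sq_nonneg ((T + B) - η * C)
    have e : (1 / η) * (T + B) ^ 2 + η * C ^ 2 - 2 * (T + B) * C = (1 / η) * ((T + B) - η * C) ^ 2 := by
      field_simp; ring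
    have : 0 ≤ (1 / η) * ((T + B) - η * C) ^ 2 := by positivity
    linarith
  have h4 : (1 + 1 / η) * (T + B) ^ 2 ≤ (1 + 1 / η) * (2 * T ^ 2 + 2 * B ^ 2) := by
    gcongr; nlinarith [sq_nonneg (T - B)]
  nlinarith

theorem gram_upper {R : Type*} [Fintype R] (a t b c : n → F) (hsum : ∀ l, a l = t l + b l + c l)
    (w : n → R → ℝ) (f : R → F) (ht : ∀ l, t l = ∑ r, w l r • f r) {g η : ℝ} (hg : 0 ≤ g)
    (hη : 0 < η) :
    ld (g • Matrix.gram ℝ a) ≤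
      Fintype.card R * log (1 + g * (2 * (1 + 1 / η)) * ∑ l, ‖t l‖ ^ 2) +
      g * (2 * (1 + 1 / η)) * ∑ l, ‖b l‖ ^ 2 +
      ∑ l, log (1 + g * (1 + η) * ‖c l‖ ^ 2) := by
  classical
  have hK : 0 ≤ 2 * (1 + 1 / η) := by positivity
  have pT := smul_gram_psd (mul_nonneg hg hK) t
  have pB := smul_gram_psd (mul_nonneg hg hK) b
  have pC := smul_gram_psd (g := g * (1 + η)) ps c
  have tr : ∀ (g : ℝ) (v : n → F), (g • Matrix.gram ℝ v).trace = g * ∑ l, ‖v l‖ ^ 2 := by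
    intro g v
    simp [Matrix.trace, Matrix.gram_apply, mul_sum]
  have ho : ld (g • Matrix.gram ℝ a) ≤ ld ((g * (2 * (1 + 1 / η))) • Matrix.gram ℝ t +
      (g * (2 * (1 + 1 / η))) • Matrix.gram ℝ b + (g * (1 + η)) • Matrix.gram ℝ c) := by
    refine ld_mono (smul_gram_psd hg a) ((pT.add pB).add pC) fun x => ?_
    simp only [add_quad, smul_quad, gram_quad]
    have : ∑ k, x k • a k = ∑ k, x k • t k + ∑ k, x k • b k + ∑ k, x k • c k := by
      simp only [← sum_add_distrib, hsum, smul_add]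
    rw [this]
    have := mul_le_mul_of_nonneg_left (norm_add3_sq η hη (∑ k, x k • t k) (∑ k, x k • b k)
      (∑ k, x k • c k)) hg
    linarith
  have hO := ld_subadd (pT.add pB) pC
  have h3 := ld_subadd pT pB
  have h4 := ld_hadamard_diag pC
  have h5 := ld_le_trace pB
  rw [tr] at h5
  have hrk : ((g * (2 * (1 + 1 / η))) • Matrix.gram ℝ t).rank ≤ Fintype.card R := by
    have e : (g * (2 * (1 + 1 / η))) • Matrix.gram ℝ t =
        Matrix.of w * ((g * (2 * (1 + 1 / η))) • Matrix.gram ℝ f * (Matrix.of w).transpose) := by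
      ext k l
      simp only [Matrix.smul_apply, Matrix.gram_apply, Matrix.mul_apply, Matrix.of_apply,
        Matrix.transpose_apply, ht, sum_inner, inner_sum, real_inner_smul_left,
        real_inner_smul_right, mul_sum, smul_eq_mul]
      rw [sum_comm]
      refine sum_congr rfl fun r _ => sum_congr rfl fun r' _ => ?_
      ring
    rw [e]
    exact (Matrix.rank_mul_le_left _ _).trans (Matrix.rank_le_card_width _)
  have h6 := ld_le_rank pT hrk
  rw [tr] at h6
  have h7 : ∑ i, log (1 + ((g * (1 + η)) • Matrix.gram ℝ c) i i) =
      ∑ l, log (1 + g * (1 + η) * ‖c l‖ ^ 2) := by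
    simp [Matrix.gram_apply]
  rw [h7] at h4
  linarith

theorem gram_mono (a a' : n → F) (h : ∀ x : n → ℝ, ‖∑ k, x k • a k‖ ≤ ‖∑ k, x k • a' k‖) {g : ℝ}
    (hg : 0 ≤ g) : ld (g • Matrix.gram ℝ a) ≤ ld (g • Matrix.gram ℝ a') := by
  refine ld_mono (smul_gram_psd hg a) (smul_gram_psd hg a') fun x => ?_
  simp only [smul_quad, gram_quad]
  have := h x
  gcongr

theorem gram_lower (a φ : n → F) (hφ : Orthonormal ℝ φ) (α : n → ℝ) :
    ∑ l, -log (‖φ l - α l • a l‖ ^ 2 + α l ^ 2) ≤ ld (Matrix.gram ℝ a) := by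
  classical
  obtain ⟨ev, u, h0, huo, huz, hM, hdet, -, -⟩ := psd_spectral (Matrix.posSemidef_gram ℝ a)
  rw [ld_eq_sum h0 hdet]
  set b : n → F := fun i => ∑ k, u i k • a k with hb
  have hbb : ∀ i j, ip (b i) (b j) = if i = j then ev i else 0 := by
    intro i j
    have hM' : ∀ k l, ip (a k) (a l) = ∑ m, ev m * (u m k * u m l) := by
      intro k l; rw [← hM, Matrix.gram_apply]
    simp only [hb, sum_inner, inner_sum, real_inner_smul_left, real_inner_smul_right, hM']
    calc _ = ∑ m, ev m * ((∑ k, u i k * u m k) * (∑ l, u j l * u m l)) := by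
          simp only [mul_sum]
          rw [sum_congr rfl fun k _ => sum_comm, sum_comm]
          refine sum_congr rfl fun m _ => ?_
          refine sum_congr rfl fun k _ => ?_
          rw [sum_mul, mul_sum]
          refine sum_congr rfl fun l _ => ?_
          ring
      _ = _ := by
          simp only [huo]
          simp [eq_comm]
          aesop
  set w : n → F := fun i => (sqrt (ev i))⁻¹ • b i with hw
  have hww : ∀ i j, ip (w i) (w j) = if i = j ∧ ev i ≠ 0 then 1 else 0 := by
    intro i j
    simp only [hw, real_inner_smul_left, real_inner_smul_right, hbb]
    by_cases hij : i = j
    · subst hij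
      by_cases he : ev i = 0
      · simp [he]
      · have : 0 < ev i := lt_of_le_of_ne (h0 i) (Ne.symm he)
        have hO : sqrt (ev i) ≠ 0 := (sqrt_pos.2 this).ne'
        have h3 := mul_self_sqrt (h0 i)
        simp only [he, ne_eq, not_false_eq_true, and_self, if_true]
        field_simp
        nlinarith
    · simp [hij]
  have hbo : ∀ i, ev i = 0 → b i = 0 := by
    intro i hi
    have := hbb i i
    simp only [if_true, hi] at this
    exact inner_self_eq_zero.1 this
  have hbw : ∀ i, b i = sqrt (ev i) • w i := by
    intro i
    by_cases he : ev i = 0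
    · simp [hbo i he, he]
    · have : 0 < ev i := lt_of_le_of_ne (h0 i) (Ne.symm he)
      have hO : sqrt (ev i) ≠ 0 := (sqrt_pos.2 this).ne'
      simp only [hw, smul_smul]
      rw [mul_inv_cancel₀ hO, one_smul]
  have hab : ∀ l, a l = ∑ i, u i l • b i := by
    intro l
    simp only [hb, Finset.smul_sum, smul_smul]
    rw [sum_comm]
    simp only [← Finset.sum_smul, huz]
    simp
  set p : n → n → ℝ := fun i l => (ip (φ l) (w i)) ^ 2 with hp
  have hpo : ∀ i l, 0 ≤ p i l := fun i l => sq_nonneg _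
  have hpa : ∀ i, ∑ l, p i l ≤ 1 := by
    intro i
    have ho := hφ.sum_inner_products_le (w i) (s := Finset.univ)
    have hO : ‖w i‖ ^ 2 ≤ 1 := by
      rw [← real_inner_self_eq_norm_sq, hww]; split_ifs <;> norm_num
    refine le_trans (le_of_eq ?_) (ho.trans hO)
    refine sum_congr rfl fun l _ => ?_
    rw [norm_eq_abs, sq_abs]
  have hpz : ∀ i l, ev i = 0 → p i l = 0 := by
    intro i l h
    simp [hp, hw, h]
  have hpb : ∀ l, ∑ i, p i l ≤ 1 := by
    intro l
    have ho : 0 ≤ ‖φ l - ∑ i, (ip (φ l) (w i)) • w i‖ ^ 2 := sq_nonneg _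
    rw [norm_sub_sq_real, hφ.1 l, ← real_inner_self_eq_norm_sq, inner_sum] at ho
    have eo : ∑ i, ip (φ l) ((ip (φ l) (w i)) • w i) = ∑ i, p i l := by
      refine sum_congr rfl fun i _ => ?_
      rw [real_inner_smul_right]; simp only [hp]; ring
    have ez : ip (∑ i, (ip (φ l) (w i)) • w i)
        (∑ i, (ip (φ l) (w i)) • w i) = ∑ i, p i l := by
      rw [sum_inner]
      refine sum_congr rfl fun i _ => ?_
      rw [inner_sum]
      simp only [real_inner_smul_left, real_inner_smul_right, hww]
      rw [Finset.sum_eq_single i]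
      · by_cases he : ev i = 0
        · simp [he, hpz i l he]
        · simp only [he, ne_eq, not_false_eq_true, and_self, if_true, hp]; ring
      · intro j _ hj; simp [Ne.symm hj]
      · simp
    rw [eo, ez] at ho
    linarith
  have main : ∀ l, -log (‖φ l - α l • a l‖ ^ 2 + α l ^ 2) ≤ ∑ i, p i l * log (1 + ev i) := by
    intro l
    have ho : (1 - ∑ i, p i l) + ∑ i, p i l * (1 / (1 + ev i)) ≤ ‖φ l - α l • a l‖ ^ 2 + α l ^ 2 := by
      have hu : α l ^ 2 = ∑ i, (α l * u i l) ^ 2 := by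
        have := huz l l
        simp only [if_true] at this
        simp only [mul_pow, ← mul_sum, sq (u _ l), this, mul_one]
      have ee : α l • a l = ∑ i, (α l * u i l) • b i := by
        conv_lhs => rw [hab l, Finset.smul_sum]
        simp only [smul_smul]
      have ek : ‖∑ i, (α l * u i l) • b i‖ ^ 2 = ∑ i, ev i * (α l * u i l) ^ 2 := by
        rw [← real_inner_self_eq_norm_sq, sum_inner]
        refine sum_congr rfl fun i _ => ?_
        rw [inner_sum, Finset.sum_eq_single i]
        · simp only [real_inner_smul_left, real_inner_smul_right, hbb, if_true]; ring
        · intro j _ hj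
          simp [real_inner_smul_left, real_inner_smul_right, hbb, Ne.symm hj]
        · simp
      rw [norm_sub_sq_real, hφ.1 l, ee, ek, inner_sum, hu]
      have : ∀ i, p i l * (1 / (1 + ev i)) - p i l ≤
          -2 * ip (φ l) ((α l * u i l) • b i) + ev i * (α l * u i l) ^ 2
            + (α l * u i l) ^ 2 := by
        intro i
        have hs := mul_self_sqrt (h0 i)
        rw [real_inner_smul_right, hbw i, real_inner_smul_right]
        simp only [hp]
        set x := ip (φ l) (w i)
        set c := α l * u i l
        set s := sqrt (ev i)
        have hpos : 0 < 1 + ev i := by have := h0 i; positivity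
        rw [← hs] at hpos ⊢
        have e : -2 * (c * (s * x)) + s * s * c ^ 2 + c ^ 2 - (x ^ 2 * (1 / (1 + s * s)) - x ^ 2) =
            (1 + s * s) * (c - s * x / (1 + s * s)) ^ 2 := by
          field_simp; ring
        have : 0 ≤ (1 + s * s) * (c - s * x / (1 + s * s)) ^ 2 := by positivity
        linarith
      have hsum := sum_le_sum fun i (_ : i ∈ Finset.univ) => this i
      simp only [sum_add_distrib, sum_sub_distrib, ← mul_sum] at hsum
      linarith
    have hpos : 0 < (1 - ∑ i, p i l) + ∑ i, p i l * (1 / (1 + ev i)) := by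
      have hnn : ∀ i ∈ Finset.univ, 0 ≤ p i l * (1 / (1 + ev i)) := fun i _ => by
        have := h0 i; have := hpo i l; positivity
      by_cases hall : ∀ i, p i l = 0
      · simp [hall]
      · push Not at hall
        obtain ⟨i, hi⟩ := hall
        have h3 : 0 < p i l * (1 / (1 + ev i)) := by
          have := h0 i; have := lt_of_le_of_ne (hpo i l) (Ne.symm hi); positivity
        have := Finset.single_le_sum hnn (Finset.mem_univ i)
        linarith [hpb l]
    have hO := log_le_log hpos ho
    have h3 := strictConcaveOn_log_Ioi.concaveOn.le_map_sum (t := Finset.univ)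
          (w := fun o : Option n => o.elim (1 - ∑ i, p i l) (fun i => p i l))
          (p := fun o : Option n => o.elim 1 (fun i => 1 / (1 + ev i)))
          (by
            rintro (_ | i) _
            · simpa using hpb l
            · exact hpo i l)
          (by simp [Fintype.sum_option])
          (by
            rintro (_ | i) _
            · simp
            · have := h0 i
              simp only [Option.elim, mem_Ioi]; positivity)
    simp only [Fintype.sum_option, Option.elim, smul_eq_mul, log_one, mul_zero, mul_one,
      zero_add] at h3
    have h4 : ∀ i, log (1 / (1 + ev i)) = -log (1 + ev i) := by
      intro i; rw [one_div, log_inv]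
    simp only [h4, mul_neg, Finset.sum_neg_distrib] at h3
    linarith
  calc _ ≤ ∑ l, ∑ i, p i l * log (1 + ev i) := sum_le_sum fun l _ => main l
    _ = ∑ i, (∑ l, p i l) * log (1 + ev i) := by
        rw [sum_comm]
        refine sum_congr rfl fun i _ => ?_
        rw [sum_mul]
    _ ≤ ∑ i, log (1 + ev i) := by
        refine sum_le_sum fun i _ => ?_
        have : 0 ≤ log (1 + ev i) := log_nonneg (by linarith [h0 i])
        nlinarith [hpa i]
end gramsec

section gausssec
open ProbabilityTheory

lemma gauss_lap (v : ℝ≥0) {γ : ℝ} (hγ : 0 ≤ γ) :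
    ∫ x, exp (-(γ * x ^ 2)) ∂(gaussianReal 0 v) = exp (-(1/2) * log (1 + 2 * γ * v)) := by
  by_cases hv : v = 0
  · subst hv; simp [gaussianReal_zero_var]
  have hv' : (0:ℝ) < v := by
    have := v.2; exact lt_of_le_of_ne this (fun h => hv (by ext; exact h.symm))
  rw [integral_gaussianReal_eq_integral_smul hv]
  have e : ∀ x : ℝ, gaussianPDFReal 0 v x • exp (-(γ * x ^ 2)) =
      (√(2 * π * v))⁻¹ * exp (-(γ + 1 / (2 * v)) * x ^ 2) := by
    intro x
    rw [gaussianPDFReal_def, smul_eq_mul, mul_assoc, ← exp_add]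
    congr 2
    field_simp
    ring
  simp_rw [e]
  rw [integral_const_mul, integral_gaussian]
  have ho : 0 < 1 + 2 * γ * v := by positivity
  have hO : exp (-(1/2) * log (1 + 2 * γ * v)) = (√(1 + 2 * γ * v))⁻¹ := by
    rw [sqrt_eq_rpow, ← rpow_neg ho.le, rpow_def_of_pos ho]
    congr 1; ring
  rw [hO, ← sqrt_inv, ← sqrt_inv, ← sqrt_mul ps]
  congr 1
  have := pi_pos
  field_simp
  ring

variable {E : Type*} [NormedAddCommGroup E] [InnerProductSpace ℝ E] [MeasurableSpace E] [BorelSpace E]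

theorem gauss_laplace (μ : Measure E) [IsProbabilityMeasure μ]
    (hG : ∀ L : E →L[ℝ] ℝ, ∃ v : ℝ≥0, μ.map L = gaussianReal 0 v)
    {n : Type*} [Fintype n] [DecidableEq n] (e : n → E) {γ : ℝ} (hγ : 0 < γ) (M : Matrix n n ℝ)
    (hpsd : M.PosSemidef)
    (hM : ∀ k l, ∫ f, (ip (e k) f) * (ip (e l) f) ∂μ = M k l) :
    ∫ f, exp (-(γ * ∑ l, (ip (e l) f) ^ 2)) ∂μ =
      exp (-(1/2) * ld ((2 * γ) • M)) := by
  classical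
  have hgam : 0 ≤ 2 * γ := by positivity
  obtain ⟨ev, u, h0, huo, huz, hMe, hdet, -, -⟩ := psd_spectral (hpsd.smul hgam)
  rw [ld_eq_sum h0 hdet]
  have hmem : ∀ x : E, MemLp (fun f => ip x f) 2 μ := by
    intro x
    obtain ⟨v, hv⟩ := hG (innerSL ℝ x)
    have ho : MemLp id 2 (μ.map (innerSL ℝ x)) := by
      rw [hv]; exact memLp_id_gaussianReal 2
    exact ho.comp_of_map (innerSL ℝ x).continuous.aemeasurable
  have hmean : ∀ x : E, ∫ f, ip x f ∂μ = 0 := by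
    intro x
    obtain ⟨v, hv⟩ := hG (innerSL ℝ x)
    have ho : ∫ y, y ∂(μ.map (innerSL ℝ x)) = ∫ f, ip x f ∂μ := by
      rw [integral_map (innerSL ℝ x).continuous.aemeasurable (by fun_prop)]; rfl
    rw [← ho, hv, integral_id_gaussianReal]
  set g : n → E := fun i => ∑ k, u i k • e k with hg
  have hgi : ∀ i f, ip (g i) f = ∑ k, u i k * ip (e k) f := by
    intro i f; simp only [hg, sum_inner, real_inner_smul_left]
  have hcov : ∀ i j, ∫ f, (ip (g i) f) * (ip (g j) f) ∂μ =
      if i = j then ev i / (2 * γ) else 0 := by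
    intro i j
    simp only [hgi, Finset.sum_mul_sum]
    have hint : ∀ k l, Integrable (fun f => (u i k * ip (e k) f) * (u j l * ip (e l) f)) μ := by
      intro k l
      exact MemLp.integrable_mul (p := 2) (q := 2) ((hmem (e k)).const_mul _) ((hmem (e l)).const_mul _)
    rw [integral_finsetSum _ fun k _ => integrable_finsetSum _ fun l _ => hint k l]
    have : ∀ k, ∫ f, ∑ l, (u i k * ip (e k) f) * (u j l * ip (e l) f) ∂μ =
        ∑ l, u i k * u j l * M k l := by
      intro k
      rw [integral_finsetSum _ fun l _ => hint k l]
      refine sum_congr rfl fun l _ => ?_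
      rw [← hM, ← integral_const_mul]
      congr 1; ext f; ring
    simp only [this]
    have hM2 : ∀ k l, M k l = (2 * γ)⁻¹ * ∑ m, ev m * (u m k * u m l) := by
      intro k l; rw [← hMe k l, Matrix.smul_apply, smul_eq_mul]; field_simp
    calc _ = (2 * γ)⁻¹ * ∑ m, ev m * ((∑ k, u i k * u m k) * (∑ l, u j l * u m l)) := by
          simp only [hM2, mul_sum]
          rw [sum_congr rfl fun k _ => sum_comm, sum_comm]
          refine sum_congr rfl fun m _ => ?_
          rw [sum_comm]
          refine sum_congr rfl fun k _ => ?_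
          rw [sum_mul, mul_sum, mul_sum]
          refine sum_congr rfl fun l _ => ?_
          ring
      _ = _ := by
          simp only [huo]
          by_cases hij : i = j
          · subst hij; simp; field_simp
          · have : ∀ m, (if i = m then (1:ℝ) else 0) * (if j = m then 1 else 0) = 0 := by
              intro m; by_cases h : i = m
              · subst h; simp [Ne.symm hij]
              · simp [h]
            simp [this, hij]
  have hsq : ∀ f, ∑ l, (ip (e l) f) ^ 2 = ∑ i, (ip (g i) f) ^ 2 := by
    intro f
    simp only [hgi, sq, Finset.sum_mul_sum]
    rw [sum_comm]
    refine sum_congr rfl fun k _ => ?_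
    rw [sum_comm]
    have : ∀ l, ∑ i, u i k * ip (e k) f * (u i l * ip (e l) f) =
        (∑ i, u i k * u i l) * (ip (e k) f * ip (e l) f) := by
      intro l; rw [sum_mul]; refine sum_congr rfl fun i _ => ?_; ring
    simp only [this, huz]
    simp
  have hGau : IsGaussian μ := isGaussian_of_map_eq_gaussianReal fun L => by
    obtain ⟨v, hv⟩ := hG L; exact ⟨0, v, hv⟩
  have hlaw : HasGaussianLaw (fun f => (fun i => ip (g i) f)) μ := by
    constructor
    exact isGaussian_map (μ := μ) (ContinuousLinearMap.pi fun i => innerSL ℝ (g i))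
  have hind := hlaw.iIndepFun_of_covariance_eq_zero (X := fun i f => ip (g i) f) (by
    intro i j hij
    rw [covariance_eq_sub (hmem _) (hmem _)]
    simp only [Pi.mul_apply, hmean]
    rw [hcov i j, if_neg hij]; simp)
  simp only [hsq, mul_sum, ← Finset.sum_neg_distrib, exp_sum]
  have := hind.integral_fun_prod_comp (f := fun i x => exp (-(γ * x ^ 2)))
    (fun i => (innerSL ℝ (g i)).continuous.aemeasurable)
    (fun i => (by fun_prop : Continuous fun x : ℝ => exp (-(γ * x ^ 2))).aestronglyMeasurable)
  rw [this]
  refine Finset.prod_congr rfl fun i _ => ?_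
  obtain ⟨v, hv⟩ := hG (innerSL ℝ (g i))
  have ho : ∫ y, exp (-(γ * y ^ 2)) ∂(μ.map (innerSL ℝ (g i))) =
      ∫ f, exp (-(γ * (ip (g i) f) ^ 2)) ∂μ := by
    rw [integral_map (innerSL ℝ (g i)).continuous.aemeasurable (by fun_prop)]; rfl
  have hO : ∫ y, y ^ 2 ∂(μ.map (innerSL ℝ (g i))) = ev i / (2 * γ) := by
    rw [integral_map (innerSL ℝ (g i)).continuous.aemeasurable (by fun_prop)]
    have := hcov i i
    rw [if_pos rfl] at this
    rw [← this]
    congr 1; ext f; rw [sq]; rfl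
  have h3 : (v : ℝ) = ev i / (2 * γ) := by
    rw [← hO, hv]
    have := variance_fun_id_gaussianReal (μ := 0) (v := v)
    rw [variance_eq_integral (by fun_prop)] at this
    simpa [integral_id_gaussianReal] using this.symm
  rw [← ho, hv, gauss_lap v hγ.le, h3]
  congr 3
  field_simp
end gausssec

section gausssec2
open ProbabilityTheory
variable {E : Type*} [NormedAddCommGroup E] [InnerProductSpace ℝ E] [MeasurableSpace E] [BorelSpace E]

lemma exp_int (μ : Measure E) [IsProbabilityMeasure μ] {γ : ℝ} (hγ : 0 < γ) (q : E → ℝ)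
    (hq : Continuous q) (h0 : ∀ f, 0 ≤ q f) : Integrable (fun f => exp (-(γ * q f))) μ := by
  refine Integrable.of_bound (C := 1) ?_ (ae_of_all _ fun f => ?_)
  · exact ((continuous_exp.measurable.comp (((hq.measurable).const_mul γ).neg))).aestronglyMeasurable
  · rw [norm_eq_abs, abs_of_pos (exp_pos _), exp_le_one_iff]
    have := h0 f; nlinarith [mul_nonneg hγ.le this]

lemma exp_int_pos (μ : Measure E) [IsProbabilityMeasure μ] {γ : ℝ} (hγ : 0 < γ) :
    0 < ∫ f, exp (-(γ * ‖f‖ ^ 2)) ∂μ := by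
  have := exp_int μ hγ (fun f => ‖f‖ ^ 2) (by fun_prop) (fun f => sq_nonneg _)
  exact integral_exp_pos this

theorem lap_lower (μ : Measure E) [IsProbabilityMeasure μ]
    (hG : ∀ L : E →L[ℝ] ℝ, ∃ v : ℝ≥0, μ.map L = gaussianReal 0 v)
    {n : Type*} [Fintype n] [DecidableEq n] (e : n → E) (he : Orthonormal ℝ e)
    {γ : ℝ} (hγ : 0 < γ) (M : Matrix n n ℝ) (hpsd : M.PosSemidef)
    (hM : ∀ k l, ∫ f, (ip (e k) f) * (ip (e l) f) ∂μ = M k l) :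
    (1/2) * ld ((2 * γ) • M) ≤ -log (∫ f, exp (-(γ * ‖f‖ ^ 2)) ∂μ) := by
  have ho := gauss_laplace μ hG e hγ M hpsd hM
  have hO : ∫ f, exp (-(γ * ‖f‖ ^ 2)) ∂μ ≤
      ∫ f, exp (-(γ * ∑ l, (ip (e l) f) ^ 2)) ∂μ := by
    refine integral_mono (exp_int μ hγ (fun f => ‖f‖ ^ 2) (by fun_prop) (fun f => sq_nonneg _))
      (exp_int μ hγ (fun f => ∑ l, (ip (e l) f) ^ 2) (by fun_prop)
        (fun f => sum_nonneg fun l _ => sq_nonneg _)) fun f => ?_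
    have := he.sum_inner_products_le f (s := Finset.univ)
    simp only [norm_eq_abs, sq_abs] at this
    simp only [exp_le_exp]
    nlinarith
  have h3 := log_le_log (exp_int_pos μ hγ) hO
  rw [ho, log_exp] at h3
  linarith

theorem lap_upper [CompleteSpace E] (μ : Measure E) [IsProbabilityMeasure μ]
    (hG : ∀ L : E →L[ℝ] ℝ, ∃ v : ℝ≥0, μ.map L = gaussianReal 0 v)
    {κ : Type*} [Fintype κ] [DecidableEq κ] (e : κ → ℕ → E)
    (he : Orthonormal ℝ (fun l : κ × ℕ => e l.1 l.2))
    (hc : ∀ f : E, (∀ j k, ip (e j k) f = 0) → f = 0)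
    {γ : ℝ} (hγ : 0 < γ) (M : (K : ℕ) → Matrix (κ × Fin K) (κ × Fin K) ℝ)
    (hpsd : ∀ K, (M K).PosSemidef)
    (hM : ∀ K k l, ∫ f, (ip (e k.1 k.2) f) * (ip (e l.1 l.2) f) ∂μ = M K k l)
    (B : ℝ) (hB : ∀ K, ld ((2 * γ) • M K) ≤ B) :
    -log (∫ f, exp (-(γ * ‖f‖ ^ 2)) ∂μ) ≤ (1/2) * B := by
  have ho : ∀ K, exp (-(1/2) * B) ≤
      ∫ f, exp (-(γ * ∑ l : κ × Fin K, (ip (e l.1 l.2) f) ^ 2)) ∂μ := by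
    intro K
    have := gauss_laplace μ hG (fun l : κ × Fin K => e l.1 l.2) hγ (M K) (hpsd K) (hM K)
    rw [this, exp_le_exp]
    linarith [hB K]
  set b := HilbertBasis.mkOfOrthogonalEqBot he (by
    rw [Submodule.eq_bot_iff]
    intro f hf
    refine hc f fun j k => ?_
    have hmem : e j k ∈ Submodule.span ℝ (range (fun l : κ × ℕ => e l.1 l.2)) :=
      Submodule.subset_span ⟨(j, k), rfl⟩
    exact Submodule.inner_right_of_mem_orthogonal hmem hf) with hb
  have hlim : ∀ f : E, Tendsto (fun K => ∑ l : κ × Fin K, (ip (e l.1 l.2) f) ^ 2) atTop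
      (nhds (‖f‖ ^ 2)) := by
    intro f
    have hs := b.hasSum_inner_mul_inner f f
    rw [real_inner_self_eq_norm_sq] at hs
    have hs' : HasSum (fun l : κ × ℕ => (ip (e l.1 l.2) f) ^ 2) (‖f‖ ^ 2) := by
      refine hs.congr_fun ?_ |> id
      intro l
      simp only [hb, HilbertBasis.coe_mkOfOrthogonalEqBot, sq]
      rw [real_inner_comm]
    have ht : Tendsto (fun K : ℕ => (Finset.univ : Finset κ) ×ˢ Finset.range K) atTop atTop := by
      refine tendsto_atTop_finset_of_monotone ?_ ?_
      · intro a b hab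
        exact Finset.product_subset_product_right (Finset.range_mono hab)
      · rintro ⟨j, k⟩
        exact ⟨k + 1, by simp⟩
    have := hs'.comp ht
    refine this.congr fun K => ?_
    simp only [Function.comp]
    rw [Finset.sum_product, Fintype.sum_prod_type]
    refine sum_congr rfl fun j _ => ?_
    rw [Finset.sum_range]
  have hO : Tendsto (fun K => ∫ f, exp (-(γ * ∑ l : κ × Fin K, (ip (e l.1 l.2) f) ^ 2)) ∂μ)
      atTop (nhds (∫ f, exp (-(γ * ‖f‖ ^ 2)) ∂μ)) := by
    refine tendsto_integral_of_dominated_convergence (fun _ => 1) ?_ (integrable_const _) ?_ ?_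
    · intro K
      exact (exp_int μ hγ (fun f => ∑ l : κ × Fin K, (ip (e l.1 l.2) f) ^ 2) (by fun_prop)
        (fun f => sum_nonneg fun l _ => sq_nonneg _)).aestronglyMeasurable
    · intro K
      refine ae_of_all _ fun f => ?_
      rw [norm_eq_abs, abs_of_pos (exp_pos _), exp_le_one_iff]
      have : 0 ≤ ∑ l : κ × Fin K, (ip (e l.1 l.2) f) ^ 2 :=
        sum_nonneg fun l _ => sq_nonneg _
      nlinarith [mul_nonneg hγ.le this]
    · refine ae_of_all _ fun f => ?_
      exact (continuous_exp.tendsto _).comp (((hlim f).const_mul γ).neg)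
  have h3 := ge_of_tendsto' hO ho
  have h4 := log_le_log (exp_pos _) h3
  rw [log_exp] at h4
  linarith
end gausssec2

section planch
open scoped FourierTransform SchwartzMap ContDiff

lemma fourierL2_ae (f : ℝ → ℂ) (ho : Integrable f) (hO : MemLp f 2 volume) :
    ((𝓕 (hO.toLp f) : Lp ℂ 2 (volume : Measure ℝ)) : ℝ → ℂ) =ᵐ[volume] 𝓕 f := by
  have hcont : Continuous (𝓕 f) :=
    VectorFourier.fourierIntegral_continuous continuous_fourierChar (by fun_prop) ho
  refine ae_eq_of_integral_contDiff_smul_eq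
    ((Lp.memLp _).locallyIntegrable (by norm_num)) hcont.locallyIntegrable ?_
  intro g g_smooth g_cpt
  have hg₁ : HasCompactSupport (Complex.ofRealCLM ∘ g) := g_cpt.comp_left rfl
  have hg₂ : ContDiff ℝ ∞ (Complex.ofRealCLM ∘ g) := by fun_prop
  set G : 𝓢(ℝ, ℂ) := hg₁.toSchwartzMap hg₂ with hG
  have hGg : ∀ x, G x = (g x : ℂ) := fun x => by simp [hG]
  have e := congrArg (fun T => T G) (Lp.fourier_toTemperedDistribution_eq (hO.toLp f))
  simp only [TemperedDistribution.fourier_apply, Lp.toTemperedDistribution_apply] at e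
  have eo : ∫ x, g x • (𝓕 (hO.toLp f) : Lp ℂ 2 (volume : Measure ℝ)) x
      = ∫ x, G x • (𝓕 (hO.toLp f) : Lp ℂ 2 (volume : Measure ℝ)) x := by
    simp [hGg]
  rw [eo, ← e]
  have ez : ∫ x, (𝓕 G) x • (hO.toLp f) x = ∫ x, (𝓕 G) x • f x := by
    refine integral_congr_ae ?_
    filter_upwards [hO.coeFn_toLp] with x hx
    rw [hx]
  rw [ez]
  have ee : ∫ x, (𝓕 (G : ℝ → ℂ)) x • f x = ∫ x, G x • (𝓕 f) x := by
    simpa using! VectorFourier.integral_fourierIntegral_smul_eq_flip (L := innerₗ ℝ)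
      (μ := volume) (ν := volume) (e := fourierChar) (f := (G : ℝ → ℂ)) (g := f)
      continuous_fourierChar continuous_inner G.integrable ho
  rw [SchwartzMap.fourier_coe, ee]
  simp [hGg]

def ft (u : ℝ → ℝ) (ξ : ℝ) : ℂ := ∫ y, (u y : ℂ) * Complex.exp (Complex.I * y * ξ)

lemma ft_eq (u : ℝ → ℝ) (ξ : ℝ) : ft u ξ = 𝓕 (fun y => (u y : ℂ)) ((-(2 * π)⁻¹) * ξ) := by
  rw [fourier_real_eq_integral_exp_smul]
  unfold ft
  refine integral_congr_ae (ae_of_all _ fun y => ?_)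
  simp only [smul_eq_mul]
  rw [mul_comm]
  congr 2
  have : (π : ℂ) ≠ 0 := mod_cast pi_ne_zero
  push_cast
  field_simp

lemma ft_cont (u : ℝ → ℝ) (ho : Integrable u) : Continuous (ft u) := by
  have : Continuous (𝓕 (fun y => (u y : ℂ))) :=
    VectorFourier.fourierIntegral_continuous continuous_fourierChar (by fun_prop) ho.ofReal
  have e : ft u = fun ξ => 𝓕 (fun y => (u y : ℂ)) ((-(2 * π)⁻¹) * ξ) := funext fun ξ => ft_eq u ξ
  rw [e]; fun_prop

lemma memLp_comp_mul (f : ℝ → ℂ) (hf : MemLp f 2 volume) (c : ℝ) (hc : c ≠ 0) :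
    MemLp (fun x => f (c * x)) 2 volume := by
  have hmp := (Homeomorph.mulLeft₀ c hc).measurableEmbedding
  have hm : Measure.map (fun x => c * x) (volume : Measure ℝ) = ENNReal.ofReal |c⁻¹| • volume :=
    map_volume_mul_left hc
  have : MemLp f 2 (Measure.map (fun x => c * x) (volume : Measure ℝ)) := by
    rw [hm]; exact hf.smul_measure (by simp)
  exact this.comp_of_map (by fun_prop)

theorem ft_memLp (u : ℝ → ℝ) (ho : Integrable u) (hO : MemLp u 2 volume) :
    MemLp (ft u) 2 volume := by
  have h2' : MemLp (fun y => (u y : ℂ)) 2 volume := hO.ofReal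
  have e : ft u = fun ξ => 𝓕 (fun y => (u y : ℂ)) ((-(2 * π)⁻¹) * ξ) := funext fun ξ => ft_eq u ξ
  rw [e]
  refine memLp_comp_mul _ ?_ _ (by simp [pi_ne_zero])
  exact (memLp_congr_ae (fourierL2_ae _ ho.ofReal h2')).1 (Lp.memLp _)

theorem ft_inner (u v : ℝ → ℝ) (huo : Integrable u) (huz : MemLp u 2 volume)
    (hvo : Integrable v) (hvz : MemLp v 2 volume) :
    ∫ ξ, ((starRingEnd ℂ) (ft u ξ) * ft v ξ).re = 2 * π * ∫ y, u y * v y := by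
  have hu2' : MemLp (fun y => (u y : ℂ)) 2 volume := huz.ofReal
  have hv2' : MemLp (fun y => (v y : ℂ)) 2 volume := hvz.ofReal
  have hu1' : Integrable (fun y => (u y : ℂ)) volume := huo.ofReal
  have hv1' : Integrable (fun y => (v y : ℂ)) volume := hvo.ofReal
  have hau := fourierL2_ae _ hu1' hu2'
  have hav := fourierL2_ae _ hv1' hv2'
  have key := Lp.inner_fourier_eq (hu2'.toLp _) (hv2'.toLp _)
  rw [L2.inner_def, L2.inner_def] at key
  have eo : ∫ a, inner ℂ ((𝓕 (hu2'.toLp _) : Lp ℂ 2 (volume : Measure ℝ)) a)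
      ((𝓕 (hv2'.toLp _) : Lp ℂ 2 (volume : Measure ℝ)) a) =
      ∫ a, (starRingEnd ℂ) (𝓕 (fun y => (u y : ℂ)) a) * 𝓕 (fun y => (v y : ℂ)) a := by
    refine integral_congr_ae ?_
    filter_upwards [hau, hav] with a h h'
    rw [h, h', RCLike.inner_apply, mul_comm]
  have ez : ∫ a, inner ℂ ((hu2'.toLp _) a) ((hv2'.toLp _) a) =
      ((∫ y, u y * v y : ℝ) : ℂ) := by
    rw [← integral_complex_ofReal]
    refine integral_congr_ae ?_
    filter_upwards [hu2'.coeFn_toLp, hv2'.coeFn_toLp] with a h h'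
    rw [h, h', RCLike.inner_apply]; simp [mul_comm]
  rw [eo, ez] at key
  simp only [ft_eq]
  have ee := Measure.integral_comp_mul_left (fun a => ((starRingEnd ℂ) (𝓕 (fun y => (u y : ℂ)) a) * 𝓕 (fun y => (v y : ℂ)) a).re) (-(2 * π)⁻¹)
  rw [ee]
  have hint : Integrable (fun a => (starRingEnd ℂ) (𝓕 (fun y => (u y : ℂ)) a) * 𝓕 (fun y => (v y : ℂ)) a) := by
    have hU := (memLp_congr_ae hau).1 (Lp.memLp _)
    have hV := (memLp_congr_ae hav).1 (Lp.memLp _)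
    exact MemLp.integrable_mul (p := 2) (q := 2) hU.star hV
  have ek : ∫ a, ((starRingEnd ℂ) (𝓕 (fun y => (u y : ℂ)) a) * 𝓕 (fun y => (v y : ℂ)) a).re = ∫ y, u y * v y := by
    have := integral_re hint
    simp only [RCLike.re_eq_complex_re] at this
    rw [this, key, Complex.ofReal_re]
  rw [ek]
  simp [abs_of_pos pi_pos]
end planch

section cossec

def blk (J j : ℕ) : Set ℝ := Ioc ((j : ℝ) / J) (((j : ℝ) + 1) / J)

def cco (J k : ℕ) : ℝ := if k = 0 then √(J : ℝ) else √(2 * J)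

def cb (J j k : ℕ) : ℝ → ℝ :=
  (blk J j).indicator (fun x => cco J k * cos (π * k * (J * x - j)))

lemma blk_meas (J j : ℕ) : MeasurableSet (blk J j) := measurableSet_Ioc

lemma cb_meas (J j k : ℕ) : Measurable (cb J j k) :=
  Measurable.indicator (by fun_prop) (blk_meas J j)

lemma cb_bound (J j k : ℕ) (x : ℝ) : |cb J j k x| ≤ |cco J k| := by
  unfold cb
  by_cases h : x ∈ blk J j
  · rw [indicator_of_mem h, abs_mul]
    have := abs_cos_le_one (π * k * (J * x - j))
    nlinarith [abs_nonneg (cco J k)]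
  · rw [indicator_of_notMem h]; simp

lemma blk_vol (J j : ℕ) : volume (blk J j) < ⊤ := measure_Ioc_lt_top

lemma cb_memLp (J j k : ℕ) (p : ℝ≥0∞) : MemLp (cb J j k) p volume := by
  have : IsFiniteMeasure (volume.restrict (blk J j)) := ⟨by simpa using blk_vol J j⟩
  unfold cb
  rw [memLp_indicator_iff_restrict (blk_meas J j)]
  refine MemLp.of_bound (by fun_prop) |cco J k| (ae_of_all _ fun x => ?_)
  rw [norm_eq_abs, abs_mul]
  have := abs_cos_le_one (π * k * (J * x - j))
  nlinarith [abs_nonneg (cco J k)]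

lemma cb_int (J j k : ℕ) : Integrable (cb J j k) volume := memLp_one_iff_integrable.1 (cb_memLp J j k 1)

lemma blk_sub {J j : ℕ} (hj : j < J) : blk J j ⊆ Ioc 0 1 := by
  intro x hx
  have hJ : (0:ℝ) < J := mod_cast (Nat.zero_le j).trans_lt hj
  have ho : (j:ℝ) + 1 ≤ J := mod_cast hj
  refine ⟨lt_of_le_of_lt ps hx.1, hx.2.trans ?_⟩
  rw [div_le_one hJ]; exact ho

lemma blk_disj {J i j : ℕ} (hJ : 0 < J) (hij : i ≠ j) : Disjoint (blk J i) (blk J j) := by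
  have hJ' : (0:ℝ) < J := mod_cast hJ
  have key : ∀ a b : ℕ, a < b → Disjoint (blk J a) (blk J b) := by
    intro a b hab
    rw [Set.disjoint_left]
    intro x hx hx'
    have ho : (a:ℝ) + 1 ≤ b := mod_cast hab
    have hO : ((a:ℝ) + 1) / J ≤ b / J := by gcongr
    linarith [hx.2, hx'.1]
  rcases lt_or_gt_of_ne hij with h | h
  · exact key i j h
  · exact (key j i h).symm

lemma int_blk (J j : ℕ) (hJ : 0 < J) (f : ℝ → ℝ) :
    ∫ x in blk J j, f (J * x - j) = (J:ℝ)⁻¹ * ∫ t in (0:ℝ)..1, f t := by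
  have hJ' : (0:ℝ) < J := mod_cast hJ
  have hle : (j:ℝ) / J ≤ ((j:ℝ) + 1) / J := by gcongr; linarith
  rw [blk, ← intervalIntegral.integral_of_le hle,
    intervalIntegral.integral_comp_mul_sub f hJ'.ne']
  have eo : (J:ℝ) * (j / J) - j = 0 := by field_simp; ring
  have ez : (J:ℝ) * ((j + 1) / J) - j = 1 := by field_simp; ring
  rw [eo, ez, smul_eq_mul]

lemma int_cos (m : ℤ) : ∫ t in (0:ℝ)..1, cos (π * m * t) = if m = 0 then 1 else 0 := by
  by_cases hm : m = 0
  · simp [hm]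
  · rw [if_neg hm]
    have h : π * (m:ℝ) ≠ 0 := mul_ne_zero pi_ne_zero (mod_cast hm)
    rw [intervalIntegral.integral_comp_mul_left (fun x => cos x) h]
    simp only [mul_zero, mul_one, integral_cos, sin_zero]
    rw [mul_comm, sin_int_mul_pi]; simp

lemma int_coscos (k l : ℕ) : ∫ t in (0:ℝ)..1, cos (π * k * t) * cos (π * l * t) =
    if k = l then (if k = 0 then 1 else 1/2) else 0 := by
  have e : ∀ t : ℝ, cos (π * k * t) * cos (π * l * t) =
      (1/2) * cos (π * ((k - l : ℤ) : ℝ) * t) + (1/2) * cos (π * ((k + l : ℤ):ℝ) * t) := by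
    intro t
    have ho : π * ((k - l : ℤ) : ℝ) * t = π * k * t - π * l * t := by push_cast; ring
    have hO : π * ((k + l : ℤ) : ℝ) * t = π * k * t + π * l * t := by push_cast; ring
    rw [ho, hO, cos_sub, cos_add]; ring
  simp_rw [e]
  rw [intervalIntegral.integral_add (Continuous.intervalIntegrable (by fun_prop) _ _)
    (Continuous.intervalIntegrable (by fun_prop) _ _), intervalIntegral.integral_const_mul,
    intervalIntegral.integral_const_mul, int_cos, int_cos]
  by_cases h : k = l
  · subst h
    by_cases h0 : k = 0
    · simp [h0]; norm_num
    · have : ((k:ℤ) + k) ≠ 0 := by omega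
      simp [h0, this]
  · have ho : (k:ℤ) - l ≠ 0 := by omega
    have hO : (k:ℤ) + l ≠ 0 := by omega
    simp [h, ho, hO]

lemma cb_mul_self (J j k l : ℕ) : (fun x => cb J j k x * cb J j l x) = (blk J j).indicator
    (fun x => cco J k * cco J l * (cos (π * k * (J * x - j)) * cos (π * l * (J * x - j)))) := by
  ext x
  unfold cb
  by_cases h : x ∈ blk J j
  · simp only [indicator_of_mem h]; ring
  · simp only [indicator_of_notMem h]; ring

theorem cb_orth (J i j k l : ℕ) (hJ : 0 < J) :
    ∫ x, cb J i k x * cb J j l x = if i = j ∧ k = l then 1 else 0 := by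
  have hJ' : (0:ℝ) < J := mod_cast hJ
  by_cases hij : i = j
  · subst hij
    rw [cb_mul_self, integral_indicator (blk_meas J i), integral_const_mul,
      int_blk J i hJ (fun t => cos (π * k * t) * cos (π * l * t)), int_coscos]
    by_cases h : k = l
    · subst h
      by_cases h0 : k = 0
      · simp only [h0, cco, if_true, and_self]
        rw [mul_self_sqrt hJ'.le]; field_simp
      · simp only [h0, cco, if_true, and_self, if_false]
        rw [mul_self_sqrt ps]; field_simp
    · simp [h]
  · rw [if_neg (fun h => hij h.1)]
    have : ∀ x, cb J i k x * cb J j l x = 0 := by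
      intro x
      unfold cb
      by_cases h : x ∈ blk J i
      · have := Set.disjoint_left.1 (blk_disj hJ hij) h
        rw [indicator_of_notMem this]; simp
      · rw [indicator_of_notMem h]; simp
    simp [this]

lemma cb_zero_int (J j k : ℕ) (hJ : 0 < J) (hk : k ≠ 0) : ∫ x, cb J j k x = 0 := by
  unfold cb
  rw [integral_indicator (blk_meas J j), integral_const_mul,
    int_blk J j hJ (fun t => cos (π * k * t))]
  have := int_cos (k : ℤ)
  push_cast at this
  rw [this]; simp [hk]

lemma cb_complete_blk (J j : ℕ) (hJ : 0 < J) (f : ℝ → ℝ) (hf : IntegrableOn f (blk J j))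
    (h : ∀ k : ℕ, ∫ x in blk J j, f x * cos (π * k * (J * x - j)) = 0)
    (g : ℝ → ℝ) (hg : Continuous g) : ∫ x in blk J j, g x * f x = 0 := by
  have hJ' : (0:ℝ) < J := mod_cast hJ
  have hint : ∀ (q : ℝ → ℝ) (C : ℝ), Continuous q → (∀ x, |q x| ≤ C) → IntegrableOn (fun x => f x * q x) (blk J j) := by
    intro q C hq hC
    exact hf.mul_bdd (c := C) hq.aestronglyMeasurable (ae_of_all _ fun x => by simpa using hC x)
  have ho : ∀ n k : ℕ, ∫ x in blk J j, f x * (cos (π * (J * x - j)) ^ n * cos (π * k * (J * x - j))) = 0 := by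
    have bd : ∀ (n k : ℕ) x, |cos (π * (J * x - j)) ^ n * cos (π * k * (J * x - j))| ≤ 1 := by
      intro n k x
      rw [abs_mul, abs_pow]
      have ho := abs_cos_le_one (π * (J * x - j))
      have hO := abs_cos_le_one (π * k * (J * x - j))
      have h3 : |cos (π * (J * x - j))| ^ n ≤ 1 := pow_le_one₀ (abs_nonneg _) ho
      exact mul_le_one₀ h3 (abs_nonneg _) hO
    intro n
    induction n with
    | zero => intro k; simpa using h k
    | succ n ih =>
      intro k
      rcases Nat.eq_zero_or_pos k with hk | hk
      · subst hk
        have := ih 1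
        rw [← this]
        congr 1; ext x
        simp only [Nat.cast_zero, Nat.cast_one, mul_zero, zero_mul, cos_zero, mul_one, pow_succ]
      · obtain ⟨m, rfl⟩ : ∃ m, k = m + 1 := ⟨k - 1, by omega⟩
        have e : ∀ x, f x * (cos (π * (J * x - j)) ^ (n+1) * cos (π * (m + 1 : ℕ) * (J * x - j))) =
            (1/2) * (f x * (cos (π * (J * x - j)) ^ n * cos (π * (m + 2 : ℕ) * (J * x - j)))) +
            (1/2) * (f x * (cos (π * (J * x - j)) ^ n * cos (π * m * (J * x - j)))) := by
          intro x
          set θ := π * (J * x - j)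
          have ao : π * (m + 2 : ℕ) * (J * x - j) = (π * (m + 1 : ℕ) * (J * x - j)) + θ := by
            push_cast; simp only [θ]; ring
          have az : π * m * (J * x - j) = (π * (m + 1 : ℕ) * (J * x - j)) - θ := by
            push_cast; simp only [θ]; ring
          rw [ao, az, cos_add, cos_sub]; ring
        simp_rw [e]
        rw [integral_add, integral_const_mul, integral_const_mul, ih, ih]
        · simp
        · exact (hint _ 1 (by fun_prop) (bd n (m+2))).const_mul _
        · exact (hint _ 1 (by fun_prop) (bd n m)).const_mul _
  have hO : ∀ p : Polynomial ℝ, ∫ x in blk J j, f x * p.eval (cos (π * (J * x - j))) = 0 := by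
    intro p
    simp only [Polynomial.eval_eq_sum_range, mul_sum]
    rw [integral_finsetSum]
    · refine Finset.sum_eq_zero fun i _ => ?_
      have := ho i 0
      simp only [Nat.cast_zero, mul_zero, zero_mul, cos_zero, mul_one] at this
      have e : ∀ x, f x * (p.coeff i * cos (π * (J * x - j)) ^ i) = p.coeff i * (f x * cos (π * (J * x - j)) ^ i) := by
        intro x; ring
      simp_rw [e]
      rw [integral_const_mul, this, mul_zero]
    · intro i _
      refine hint _ |p.coeff i| (by fun_prop) fun x => ?_
      rw [abs_mul, abs_pow]
      have h3 : |cos (π * (J * x - j))| ^ i ≤ 1 := pow_le_one₀ (abs_nonneg _) (abs_cos_le_one _)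
      nlinarith [abs_nonneg (p.coeff i)]
  have h3 : ∀ ε > 0, |∫ x in blk J j, g x * f x| ≤ ε * ∫ x in blk J j, |f x| := by
    intro ε hε
    obtain ⟨p, hp⟩ := exists_polynomial_near_of_continuousOn (-1) 1
      (fun c => g ((arccos c / π + j) / J)) (by fun_prop) ε hε
    have hgi : IntegrableOn (fun x => g x * f x) (blk J j) := by
      obtain ⟨C, hC⟩ := (isCompact_Icc (a := (j:ℝ)/J) (b := ((j:ℝ)+1)/J)).exists_bound_of_continuousOn hg.continuousOn
      refine hf.bdd_mul (c := C) hg.aestronglyMeasurable ?_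
      refine (ae_restrict_iff' (blk_meas J j)).2 (ae_of_all _ fun x hx => hC x ⟨hx.1.le, hx.2⟩)
    have hpi : IntegrableOn (fun x => f x * p.eval (cos (π * (J * x - j)))) (blk J j) := by
      obtain ⟨C, hC⟩ := (isCompact_Icc (a := (-1:ℝ)) (b := 1)).exists_bound_of_continuousOn p.continuous.continuousOn
      refine hint _ C (by fun_prop) fun x => ?_
      exact hC _ ⟨neg_one_le_cos _, cos_le_one _⟩
    have : ∫ x in blk J j, g x * f x = ∫ x in blk J j, (g x * f x - f x * p.eval (cos (π * (J * x - j)))) := by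
      rw [integral_sub hgi hpi, hO, sub_zero]
    rw [this, ← integral_const_mul]
    refine (abs_integral_le_integral_abs).trans ?_
    refine setIntegral_mono_on (hgi.sub hpi).abs (hf.abs.const_mul _) (blk_meas J j) fun x hx => ?_
    have hx1 : 0 ≤ J * x - j := by
      have := hx.1; rw [div_lt_iff₀ hJ'] at this; linarith
    have hx2 : J * x - j ≤ 1 := by
      have := hx.2; rw [le_div_iff₀ hJ'] at this; linarith
    have hp' := hp (cos (π * (J * x - j))) ⟨neg_one_le_cos _, cos_le_one _⟩
    have hac : arccos (cos (π * (J * x - j))) = π * (J * x - j) :=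
      arccos_cos (by have := pi_pos; positivity) (by nlinarith [pi_pos])
    rw [hac] at hp'
    have e : (π * (J * x - j) / π + j) / J = x := by
      have := pi_pos; field_simp; ring
    rw [e] at hp'
    have : g x * f x - f x * p.eval (cos (π * (J * x - j))) = -((p.eval (cos (π * (J * x - j))) - g x) * f x) := by ring
    rw [this, abs_neg, abs_mul]
    exact mul_le_mul_of_nonneg_right hp'.le (abs_nonneg _)
  have hA : 0 ≤ ∫ x in blk J j, |f x| := integral_nonneg fun x => abs_nonneg _
  by_contra hne
  have hpos : 0 < |∫ x in blk J j, g x * f x| := abs_pos.2 hne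
  have := h3 (|∫ x in blk J j, g x * f x| / (2 * ((∫ x in blk J j, |f x|) + 1))) ps
  rw [div_mul_eq_mul_div, le_div_iff₀ ps] at this
  nlinarith
end cossec

section c2

def Wf (so sz ξ : ℝ) : ℝ := if |ξ| ≤ 1 then |ξ| ^ (1 - sz) else |ξ| ^ (-so)

lemma Wf_nonneg (so sz ξ : ℝ) : 0 ≤ Wf so sz ξ := by
  unfold Wf; split_ifs <;> positivity

lemma Wf_meas (so sz : ℝ) : Measurable (Wf so sz) := by
  unfold Wf
  exact Measurable.ite (measurableSet_le (by fun_prop) (by fun_prop)) (by fun_prop) (by fun_prop)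

lemma int_even (f : ℝ → ℝ) (hf : ∀ x, f (-x) = f x) (h : IntegrableOn f (Ioi 0)) : Integrable f := by
  have hO : IntegrableOn f (Iic 0) := by
    rw [integrableOn_Iic_iff_integrableOn_Iio]
    have h3 : IntegrableOn (fun x => f (-x)) (Iio 0) := by
      have h4 := (MeasurePreserving.integrableOn_comp_preimage (Measure.measurePreserving_neg (volume : Measure ℝ)) (Homeomorph.neg ℝ).measurableEmbedding (f := f) (s := Ioi 0)).2 h
      simpa [Function.comp_def] using h4
    simpa [hf] using h3
  rw [← integrableOn_univ, ← Iic_union_Ioi (a := (0:ℝ))]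
  exact hO.union h

lemma Wf_sq_int {so sz : ℝ} (h0 : 1/2 < so) (ho : sz < 3/2) : Integrable (fun ξ => Wf so sz ξ ^ 2) := by
  refine int_even _ (fun x => by simp [Wf]) ?_
  rw [← Ioc_union_Ioi_eq_Ioi (zero_le_one' ℝ)]
  refine IntegrableOn.union ?_ ?_
  · have h : IntegrableOn (fun ξ : ℝ => ξ ^ (2 - 2 * sz)) (Ioc 0 1) :=
      (intervalIntegrable_iff_integrableOn_Ioc_of_le zero_le_one).1
        (intervalIntegral.intervalIntegrable_rpow' (by linarith))
    refine h.congr_fun (fun x hx => ?_) measurableSet_Ioc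
    simp only [Wf, abs_of_pos hx.1, if_pos hx.2]
    rw [← rpow_natCast, ← rpow_mul hx.1.le]; congr 1; push_cast; ring
  · have h : IntegrableOn (fun ξ : ℝ => ξ ^ (-2 * so)) (Ioi 1) :=
      integrableOn_Ioi_rpow_of_lt (by linarith) one_pos
    refine h.congr_fun (fun x hx => ?_) measurableSet_Ioi
    have hx' : 0 < x := lt_trans one_pos hx
    simp only [Wf, abs_of_pos hx', if_neg (not_le.2 (mem_Ioi.1 hx))]
    rw [← rpow_natCast, ← rpow_mul hx'.le]; congr 1; push_cast; ring

lemma bessel_real (J j : ℕ) (hJ : 0 < J) (f : ℝ → ℝ) (hf : Measurable f) (W : ℝ)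
    (hW : ∀ y ∈ blk J j, |f y| ≤ W) (S : Finset ℕ) :
    ∑ k ∈ S, (∫ y, cb J j k y * f y) ^ 2 ≤ ∫ y in blk J j, f y ^ 2 := by
  set c : ℕ → ℝ := fun k => ∫ y, cb J j k y * f y with hc
  have : IsFiniteMeasure (volume.restrict (blk J j)) := ⟨by simpa using blk_vol J j⟩
  have hfi : IntegrableOn (fun y => f y ^ 2) (blk J j) := by
    refine Measure.integrableOn_of_bounded (M := W^2) (blk_vol J j).ne (by fun_prop) ?_
    refine (ae_restrict_iff' (blk_meas J j)).2 (ae_of_all _ fun x hx => ?_)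
    have := hW x hx
    rw [norm_eq_abs, abs_pow]; gcongr
  set F : ℝ → ℝ := (blk J j).indicator f with hF
  have hFm : Measurable F := hf.indicator (blk_meas J j)
  have hFW : ∀ y, |F y| ≤ |W| := by
    intro y
    by_cases h : y ∈ blk J j
    · rw [hF, indicator_of_mem h]; exact (hW y h).trans (le_abs_self _)
    · rw [hF, indicator_of_notMem h]; simp
  have hcF : ∀ k, c k = ∫ y, cb J j k y * F y := by
    intro k
    refine integral_congr_ae (ae_of_all _ fun y => ?_)
    by_cases h : y ∈ blk J j
    · simp [hF, indicator_of_mem h]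
    · simp [cb, indicator_of_notMem h]
  have iz : ∀ k, Integrable (fun y => cb J j k y * F y) := fun k =>
    (cb_int J j k).mul_bdd (c := |W|) hFm.aestronglyMeasurable (ae_of_all _ fun y => hFW y)
  have io : ∀ k l, Integrable (fun y => cb J j k y * cb J j l y) := fun k l =>
    (cb_int J j k).mul_bdd (c := |cco J l|) (cb_meas J j l).aestronglyMeasurable
      (ae_of_all _ fun y => cb_bound J j l y)
  have ia : Integrable (fun y => F y ^ 2) := by
    have : (fun y => F y ^ 2) = (blk J j).indicator (fun y => f y ^ 2) := by
      ext y; by_cases h : y ∈ blk J j <;> simp [hF, h]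
    rw [this, integrable_indicator_iff (blk_meas J j)]; exact hfi
  have ee : ∫ y, F y ^ 2 = ∫ y in blk J j, f y ^ 2 := by
    rw [← integral_indicator (blk_meas J j)]
    refine integral_congr_ae (ae_of_all _ fun y => ?_)
    by_cases h : y ∈ blk J j <;> simp [hF, h]
  have key : 0 ≤ ∫ y, (F y - ∑ k ∈ S, c k * cb J j k y) ^ 2 := integral_nonneg fun y => sq_nonneg _
  have ex : ∀ y, (F y - ∑ k ∈ S, c k * cb J j k y) ^ 2 =
      F y ^ 2 - 2 * ∑ k ∈ S, c k * (cb J j k y * F y) +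
        ∑ k ∈ S, ∑ l ∈ S, (c k * c l) * (cb J j k y * cb J j l y) := by
    intro y
    rw [sub_sq, sq (∑ k ∈ S, c k * cb J j k y), Finset.sum_mul_sum]
    congr 1
    · rw [mul_assoc, mul_sum]
      congr 2
      exact sum_congr rfl fun k _ => by ring
    · exact sum_congr rfl fun k _ => sum_congr rfl fun l _ => by ring
  simp_rw [ex] at key
  rw [integral_add, integral_sub, integral_const_mul, integral_finsetSum, integral_finsetSum, ee] at key
  · simp_rw [integral_const_mul] at key
    have : ∀ k ∈ S, ∫ y, ∑ l ∈ S, (c k * c l) * (cb J j k y * cb J j l y) = c k ^ 2 := by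
      intro k hk
      rw [integral_finsetSum]
      · simp_rw [integral_const_mul, cb_orth J j j k _ hJ]
        simp [hk, sq]
      · intro l _; exact (io k l).const_mul _
    rw [sum_congr rfl this] at key
    have ek : ∑ k ∈ S, c k * ∫ y, cb J j k y * F y = ∑ k ∈ S, c k ^ 2 :=
      sum_congr rfl fun k _ => by rw [← hcF]; ring
    rw [ek] at key
    linarith
  · intro k _; exact integrable_finsetSum _ fun l _ => (io k l).const_mul _
  · intro k _; exact (iz k).const_mul _
  · exact ia
  · exact (integrable_finsetSum _ fun k _ => (iz k).const_mul _).const_mul _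
  · exact ia.sub ((integrable_finsetSum _ fun k _ => (iz k).const_mul _).const_mul _)
  · exact integrable_finsetSum _ fun k _ => integrable_finsetSum _ fun l _ => (io k l).const_mul _

lemma blk_volr (J j : ℕ) : volume.real (blk J j) = 1 / J := by
  unfold blk
  rw [volume_real_Ioc_of_le (by gcongr; linarith)]
  ring

lemma bessel_blk (J j : ℕ) (hJ : 0 < J) (f : ℝ → ℂ) (hf : Measurable f) (W : ℝ)
    (hW : ∀ y ∈ blk J j, ‖f y‖ ≤ W) (S : Finset ℕ) :
    ∑ k ∈ S, ‖∫ y, (cb J j k y : ℂ) * f y‖ ^ 2 ≤ W ^ 2 / J := by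
  have hre : Measurable fun y => (f y).re := by fun_prop
  have him : Measurable fun y => (f y).im := by fun_prop
  have ho := bessel_real J j hJ _ hre W (fun y hy => (Complex.abs_re_le_norm _).trans (hW y hy)) S
  have hO := bessel_real J j hJ _ him W (fun y hy => (Complex.abs_im_le_norm _).trans (hW y hy)) S
  have hint : ∀ k, Integrable (fun y => (cb J j k y : ℂ) * f y) := by
    intro k
    set F : ℝ → ℂ := (blk J j).indicator f with hF
    have : (fun y => (cb J j k y : ℂ) * f y) = fun y => (cb J j k y : ℂ) * F y := by
      ext y
      by_cases h : y ∈ blk J j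
      · simp [hF, h]
      · simp [cb, h]
    rw [this]
    have h0 : Integrable (fun y => (cb J j k y : ℂ)) volume := (cb_int J j k).ofReal
    refine h0.mul_bdd (c := |W|) (hf.indicator (blk_meas J j)).aestronglyMeasurable (ae_of_all _ fun y => ?_)
    by_cases h : y ∈ blk J j
    · rw [hF, indicator_of_mem h]; exact (hW y h).trans (le_abs_self _)
    · rw [hF, indicator_of_notMem h]; simp
  have e : ∀ k, ‖∫ y, (cb J j k y : ℂ) * f y‖ ^ 2 =
      (∫ y, cb J j k y * (f y).re) ^ 2 + (∫ y, cb J j k y * (f y).im) ^ 2 := by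
    intro k
    rw [Complex.sq_norm, Complex.normSq_apply]
    have ao := integral_re (hint k)
    have az := integral_im (hint k)
    simp at ao az
    rw [← ao, ← az]; ring
  simp_rw [e]
  rw [sum_add_distrib]
  refine (add_le_add ho hO).trans ?_
  have : IsFiniteMeasure (volume.restrict (blk J j)) := ⟨by simpa using blk_vol J j⟩
  have ii : ∀ g : ℝ → ℝ, Measurable g → (∀ y ∈ blk J j, |g y| ≤ W) → IntegrableOn (fun y => g y ^ 2) (blk J j) := by
    intro g hg hb
    refine Measure.integrableOn_of_bounded (M := W^2) (blk_vol J j).ne (by fun_prop) ?_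
    refine (ae_restrict_iff' (blk_meas J j)).2 (ae_of_all _ fun x hx => ?_)
    have := hb x hx
    rw [norm_eq_abs, abs_pow]; gcongr
  rw [← integral_add (ii _ hre fun y hy => (Complex.abs_re_le_norm _).trans (hW y hy))
    (ii _ him fun y hy => (Complex.abs_im_le_norm _).trans (hW y hy))]
  have : ∫ y in blk J j, ((f y).re ^ 2 + (f y).im ^ 2) ≤ ∫ y in blk J j, W ^ 2 := by
    refine setIntegral_mono_on ((ii _ hre fun y hy => (Complex.abs_re_le_norm _).trans (hW y hy)).add
      (ii _ him fun y hy => (Complex.abs_im_le_norm _).trans (hW y hy))) (integrable_const _) (blk_meas J j) fun y hy => ?_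
    have h3 := hW y hy
    have h4 : ‖f y‖ ^ 2 ≤ W ^ 2 := by gcongr
    rw [Complex.sq_norm, Complex.normSq_apply] at h4
    linarith
  refine this.trans (le_of_eq ?_)
  rw [setIntegral_const, blk_volr, smul_eq_mul]; ring

end c2

section c3

lemma ft_cb_bound (J j k : ℕ) (hJ : 0 < J) (hk : k ≠ 0) (ξ : ℝ) (hξ : (π * k * J) ^ 2 - ξ ^ 2 ≠ 0) :
    ‖ft (cb J j k) ξ‖ ≤ 2 * √(2 * J) * |ξ| / |(π * k * J) ^ 2 - ξ ^ 2| := by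
  have hJ' : (0:ℝ) < J := mod_cast hJ
  set ω : ℝ := π * k * J with hω
  set a : ℝ := (j:ℝ) / J
  set b : ℝ := ((j:ℝ) + 1) / J
  have hab : a ≤ b := by simp only [a, b]; gcongr; linarith
  set θ : ℝ → ℝ := fun x => π * k * (J * x - j) with hθ
  set P : ℝ → ℂ := fun x => Complex.exp (Complex.I * x * ξ) *
    (Complex.I * ξ * (cos (θ x) : ℂ) + ω * (sin (θ x) : ℂ)) / ((ω ^ 2 - ξ ^ 2 : ℝ) : ℂ) with hP
  have hne : ((ω ^ 2 - ξ ^ 2 : ℝ) : ℂ) ≠ 0 := mod_cast hξ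
  have hd : ∀ x : ℝ, HasDerivAt P ((cos (θ x) : ℂ) * Complex.exp (Complex.I * x * ξ)) x := by
    intro x
    have ho : HasDerivAt (fun x : ℝ => Complex.exp (Complex.I * x * ξ)) (Complex.exp (Complex.I * x * ξ) * (Complex.I * ξ)) x := by
      have : HasDerivAt (fun x : ℝ => Complex.I * (x:ℂ) * ξ) (Complex.I * ξ) x := by
        have := ((Complex.ofRealCLM.hasDerivAt (x := x)).const_mul Complex.I).mul_const (ξ : ℂ)
        simpa using this
      exact this.cexp
    have hθd : HasDerivAt θ ω x := by
      have := (((hasDerivAt_id x).const_mul (J:ℝ)).sub_const (j:ℝ)).const_mul (π * k)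
      refine HasDerivAt.congr_deriv this ?_
      simp [hω]
    have hO : HasDerivAt (fun x => (cos (θ x) : ℂ)) ((-sin (θ x) * ω : ℝ) : ℂ) x := hθd.cos.ofReal_comp
    have h3 : HasDerivAt (fun x => (sin (θ x) : ℂ)) ((cos (θ x) * ω : ℝ) : ℂ) x := hθd.sin.ofReal_comp
    have h4 := (ho.mul ((hO.const_mul (Complex.I * ξ)).add (h3.const_mul (ω : ℂ)))).div_const ((ω ^ 2 - ξ ^ 2 : ℝ) : ℂ)
    refine HasDerivAt.congr_deriv h4 ?_
    rw [div_eq_iff hne]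
    simp only [Pi.add_apply]
    push_cast
    linear_combination (Complex.exp (Complex.I * x * ξ) * (ξ:ℂ) ^ 2 * Complex.cos (θ x : ℂ)) * Complex.I_sq
  have eo : ft (cb J j k) ξ = (cco J k : ℂ) * ∫ x in a..b, (cos (θ x) : ℂ) * Complex.exp (Complex.I * x * ξ) := by
    unfold ft
    rw [intervalIntegral.integral_of_le hab, ← integral_const_mul, ← integral_indicator measurableSet_Ioc]
    refine integral_congr_ae (ae_of_all _ fun x => ?_)
    by_cases h : x ∈ blk J j
    · have h' : x ∈ Ioc a b := h
      simp only [cb, indicator_of_mem h, indicator_of_mem h', hθ]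
      push_cast; ring
    · have h' : x ∉ Ioc a b := h
      simp only [cb, indicator_of_notMem h, indicator_of_notMem h']
      simp
  have ez : ∫ x in a..b, (cos (θ x) : ℂ) * Complex.exp (Complex.I * x * ξ) = P b - P a := by
    refine intervalIntegral.integral_eq_sub_of_hasDerivAt (fun x _ => hd x) ?_
    refine Continuous.intervalIntegrable ?_ _ _
    simp only [hθ]; fun_prop
  have hn : ∀ x : ℝ, sin (θ x) = 0 → ‖P x‖ ≤ |ξ| / |ω ^ 2 - ξ ^ 2| := by
    intro x hs
    simp only [hP, hs]
    rw [norm_div, norm_mul]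
    have : ‖Complex.exp (Complex.I * x * ξ)‖ = 1 := by
      rw [show Complex.I * x * ξ = ((x * ξ : ℝ) : ℂ) * Complex.I by push_cast; ring, Complex.norm_exp_ofReal_mul_I]
    rw [this, Complex.norm_real, norm_eq_abs]
    gcongr
    simp only [Complex.ofReal_zero, mul_zero, add_zero, one_mul, norm_mul, Complex.norm_I, Complex.norm_real, norm_eq_abs]
    have := abs_cos_le_one (θ x)
    nlinarith [abs_nonneg ξ]
  have ha : sin (θ a) = 0 := by
    have : θ a = 0 := by simp only [hθ, a]; field_simp; simp
    rw [this]; simp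
  have hb : sin (θ b) = 0 := by
    have : θ b = k * π := by simp only [hθ, b]; field_simp; ring
    rw [this]; exact sin_nat_mul_pi k
  rw [eo, ez, norm_mul, Complex.norm_real, norm_eq_abs]
  have hcc : |cco J k| = √(2 * J) := by simp [cco, hk, abs_of_nonneg]
  rw [hcc]
  have := norm_sub_le (P b) (P a)
  have ho := hn a ha
  have hO := hn b hb
  calc _ ≤ √(2 * J) * (|ξ| / |ω ^ 2 - ξ ^ 2| + |ξ| / |ω ^ 2 - ξ ^ 2|) := by gcongr; linarith
    _ = _ := by ring

lemma ft_cb_memLp (J j k : ℕ) : MemLp (ft (cb J j k)) 2 volume :=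
  ft_memLp _ (cb_int J j k) (cb_memLp J j k 2)

def phf (J j k : ℕ) (ξ : ℝ) : ℂ := ((√(2 * π))⁻¹ : ℝ) * ft (cb J j k) ξ

lemma phf_memLp (J j k : ℕ) : MemLp (phf J j k) 2 volume := (ft_cb_memLp J j k).const_mul _

def ddf (s : ℝ) (J j k : ℕ) (ξ : ℝ) : ℂ := (((|ξ| / (π * k * J)) ^ (-s) - 1 : ℝ) : ℂ) * phf J j k ξ

lemma u_bound {s sz u : ℝ} (h0 : 1/2 < s) (ho : s ≤ sz) (hO : sz < 3/2) (hu : 0 < u) (huo : u ≠ 1) :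
    u * |u ^ (-s) - 1| / |1 - u ^ 2| ≤ 2 * Wf 1 sz u := by
  unfold Wf
  rw [abs_of_pos hu]
  have hne : |1 - u ^ 2| > 0 := abs_pos.2 (by
    intro h; apply huo; nlinarith [sq_nonneg (u-1)])
  rw [div_le_iff₀ hne]
  split_ifs with hc
  · have hlt : u < 1 := lt_of_le_of_ne hc huo
    have eo : 1 ≤ u ^ (-s) := by
      rw [rpow_neg hu.le]
      exact (one_le_inv₀ ps).2 (rpow_le_one hu.le hc (by linarith))
    rw [abs_of_nonneg (by linarith), abs_of_nonneg (by nlinarith)]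
    have ez : u ^ s ≥ u ^ 2 := by
      rw [← rpow_natCast]; exact rpow_le_rpow_of_exponent_ge hu hc (by push_cast; linarith)
    have ee : u ^ (-s) * u ^ s = 1 := by rw [← rpow_add hu]; simp
    have ek : u ^ (-s) - 1 ≤ 2 * (1 - u) * u ^ (-s) := by
      have : 1 - u ^ s ≤ 2 * (1 - u) := by nlinarith [sq_nonneg (u-1)]
      have h5 : 0 < u ^ (-s) := by positivity
      nlinarith
    have e5 : u * u ^ (-s) ≤ u ^ (1 - sz) := by
      calc u * u ^ (-s) = u ^ (1 - s) := by rw [sub_eq_add_neg, rpow_add hu, rpow_one]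
        _ ≤ _ := rpow_le_rpow_of_exponent_ge hu hc (by linarith)
    have h6 : 0 < u ^ (1 - sz) := by positivity
    calc u * (u ^ (-s) - 1) ≤ u * (2 * (1 - u) * u ^ (-s)) := by gcongr
      _ = 2 * (1 - u) * (u * u ^ (-s)) := by ring
      _ ≤ 2 * (1 - u) * u ^ (1 - sz) := by gcongr
      _ ≤ 2 * u ^ (1 - sz) * (1 - u ^ 2) := by
        have : 1 - u ≤ 1 - u ^ 2 := by nlinarith
        nlinarith
  · push Not at hc
    have eo : u ^ (-s) ≤ 1 := rpow_le_one_of_one_le_of_nonpos hc.le (by linarith)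
    rw [abs_of_nonpos (by linarith), abs_of_nonpos (by nlinarith)]
    have ez : u ^ (-2 : ℝ) ≤ u ^ (-s) := rpow_le_rpow_of_exponent_le hc.le (by linarith)
    have ee : u ^ (-2 : ℝ) = (u ^ 2)⁻¹ := by
      rw [rpow_neg hu.le]; norm_num
    have ek : u ^ (-1 : ℝ) = u⁻¹ := by rw [rpow_neg_one]
    rw [ek]
    rw [ee] at ez
    have e5 : u * (u ^ 2)⁻¹ = u⁻¹ := by field_simp
    have e6 : 0 < u⁻¹ := by positivity
    have e7 : u⁻¹ * u ^ 2 = u := by field_simp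
    nlinarith

lemma ddf_bound {s sz : ℝ} (h0 : 1/2 < s) (ho : s ≤ sz) (hO : sz < 3/2) (J j k : ℕ) (hJ : 0 < J)
    (hk : k ≠ 0) (ξ : ℝ) (hξ : ξ ≠ 0) (hξ' : |ξ| ≠ π * k * J) :
    ‖ddf s J j k ξ‖ ≤ (√(2 * π))⁻¹ * (4 * √(2 * J)) / (π * k * J) * Wf 1 sz ((π * k * J)⁻¹ * ξ) := by
  have hJ' : (0:ℝ) < J := mod_cast hJ
  have hk' : (0:ℝ) < k := mod_cast Nat.pos_of_ne_zero hk
  have hω : 0 < π * k * J := by positivity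
  set ω : ℝ := π * k * J with hωd
  have hu : 0 < |ξ| / ω := by positivity
  set u := |ξ| / ω with hud
  have huo : u ≠ 1 := by
    rw [hud]; intro h; rw [div_eq_one_iff_eq hω.ne'] at h; exact hξ' h
  have hxu : |ξ| = ω * u := by rw [hud]; field_simp
  have hne : ω ^ 2 - ξ ^ 2 ≠ 0 := by
    rw [← sq_abs ξ]; intro h
    have : |ξ| = ω := by
      have : (|ξ| - ω) * (|ξ| + ω) = 0 := by nlinarith
      rcases mul_eq_zero.1 this with h | h
      · linarith
      · have := abs_nonneg ξ; linarith
    exact hξ' this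
  have hb := ft_cb_bound J j k hJ hk ξ hne
  rw [← hωd] at hb
  have hub := u_bound h0 ho hO hu huo
  have hW : Wf 1 sz (ω⁻¹ * ξ) = Wf 1 sz u := by
    unfold Wf
    rw [abs_mul, abs_of_pos (inv_pos.2 hω), show ω⁻¹ * |ξ| = u by rw [hud]; field_simp, abs_of_pos hu]
  rw [hW]
  unfold ddf phf
  rw [norm_mul, norm_mul, Complex.norm_real, Complex.norm_real, norm_eq_abs, norm_eq_abs,
    abs_of_nonneg (by positivity : (0:ℝ) ≤ (√(2 * π))⁻¹), ← hωd, ← hud]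
  have e : |ω ^ 2 - ξ ^ 2| = ω ^ 2 * |1 - u ^ 2| := by
    rw [← sq_abs ξ, hxu, ← abs_of_pos (by positivity : 0 < ω ^ 2), ← abs_mul, abs_of_pos (by positivity : 0 < ω ^ 2)]
    congr 1; ring
  rw [e, hxu] at hb
  have hne2 : |1 - u ^ 2| ≠ 0 := by
    have := abs_pos.2 hne
    rw [e] at this; intro h; rw [h] at this; simp at this
  calc |u ^ (-s) - 1| * ((√(2 * π))⁻¹ * ‖ft (cb J j k) ξ‖)
      ≤ |u ^ (-s) - 1| * ((√(2 * π))⁻¹ * (2 * √(2 * J) * (ω * u) / (ω ^ 2 * |1 - u ^ 2|))) := by gcongr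
    _ = (√(2 * π))⁻¹ * (2 * √(2 * J)) / ω * (u * |u ^ (-s) - 1| / |1 - u ^ 2|) := by
        field_simp
    _ ≤ (√(2 * π))⁻¹ * (2 * √(2 * J)) / ω * (2 * Wf 1 sz u) := by gcongr
    _ = _ := by ring

end c3

section kz

abbrev FF := Lp ℂ 2 (volume : Measure ℝ)

open Classical in
def toF (f : ℝ → ℂ) : FF := if h : MemLp f 2 volume then h.toLp f else 0

lemma toF_eq {f : ℝ → ℂ} (h : MemLp f 2 volume) : toF f = h.toLp f := by simp [toF, h]

lemma toF_coe {f : ℝ → ℂ} (h : MemLp f 2 volume) : (toF f : ℝ → ℂ) =ᵐ[volume] f := by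
  rw [toF_eq h]; exact h.coeFn_toLp

lemma toF_add {f g : ℝ → ℂ} (hf : MemLp f 2 volume) (hg : MemLp g 2 volume) :
    toF (fun ξ => f ξ + g ξ) = toF f + toF g := by
  rw [toF_eq hf, toF_eq hg, ← MemLp.toLp_add]; exact toF_eq (hf.add hg)

lemma toF_sub {f g : ℝ → ℂ} (hf : MemLp f 2 volume) (hg : MemLp g 2 volume) :
    toF (fun ξ => f ξ - g ξ) = toF f - toF g := by
  rw [toF_eq hf, toF_eq hg, ← MemLp.toLp_sub]; exact toF_eq (hf.sub hg)

lemma toF_smul {f : ℝ → ℂ} (c : ℝ) (hf : MemLp f 2 volume) :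
    toF (fun ξ => (c : ℂ) * f ξ) = c • toF f := by
  have hO : MemLp (c • f) 2 volume := hf.const_smul c
  have : (fun ξ => (c : ℂ) * f ξ) = c • f := by ext; simp
  rw [this, toF_eq hf, ← MemLp.toLp_const_smul, toF_eq hO]

lemma toF_sum {ι : Type*} (S : Finset ι) (f : ι → ℝ → ℂ) (hf : ∀ i ∈ S, MemLp (f i) 2 volume) :
    toF (fun ξ => ∑ i ∈ S, f i ξ) = ∑ i ∈ S, toF (f i) := by
  classical
  induction S using Finset.induction_on with
  | empty =>
    simp only [Finset.sum_empty]
    have : MemLp (fun _ : ℝ => (0:ℂ)) 2 volume := MemLp.zero'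
    rw [toF_eq this]; exact MemLp.toLp_zero _
  | insert i S hi ih =>
    simp only [Finset.sum_insert hi]
    rw [toF_add (hf i (by simp)) (memLp_finsetSum _ fun k hk => hf k (by simp [hk])), ih fun k hk => hf k (by simp [hk])]

lemma toF_inner {f g : ℝ → ℂ} (hf : MemLp f 2 volume) (hg : MemLp g 2 volume) :
    ip (toF f) (toF g) = ∫ ξ, (g ξ * (starRingEnd ℂ) (f ξ)).re := by
  rw [L2.inner_def]
  refine integral_congr_ae ?_
  filter_upwards [toF_coe hf, toF_coe hg] with x ho hO
  rw [ho, hO, Complex.inner]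

lemma toF_norm_sq {f : ℝ → ℂ} (hf : MemLp f 2 volume) : ‖toF f‖ ^ 2 = ∫ ξ, ‖f ξ‖ ^ 2 := by
  rw [← real_inner_self_eq_norm_sq, toF_inner hf hf]
  congr 1; ext ξ
  rw [Complex.mul_conj, Complex.ofReal_re, Complex.normSq_eq_norm_sq]

lemma memLp_sq {f : ℝ → ℂ} (hf : MemLp f 2 volume) : Integrable (fun ξ => ‖f ξ‖ ^ 2) :=
  (memLp_two_iff_integrable_sq_norm hf.1).1 hf

lemma memLp_of_le {f : ℝ → ℂ} (hf : AEStronglyMeasurable f) {w : ℝ → ℝ} (hw : Integrable (fun ξ => w ξ ^ 2))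
    (h : ∀ᵐ ξ : ℝ, ‖f ξ‖ ≤ w ξ) : MemLp f 2 volume := by
  rw [memLp_two_iff_integrable_sq_norm hf]
  refine hw.mono' (by fun_prop) ?_
  filter_upwards [h] with ξ hx
  rw [norm_eq_abs, abs_of_nonneg (sq_nonneg _)]; gcongr

lemma toF_le {f g : ℝ → ℂ} (hf : MemLp f 2 volume) (hg : MemLp g 2 volume) (h : ∀ᵐ ξ : ℝ, ‖f ξ‖ ≤ ‖g ξ‖) :
    ‖toF f‖ ≤ ‖toF g‖ := by
  have : ‖toF f‖ ^ 2 ≤ ‖toF g‖ ^ 2 := by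
    rw [toF_norm_sq hf, toF_norm_sq hg]
    refine integral_mono_ae (memLp_sq hf) (memLp_sq hg) ?_
    filter_upwards [h] with ξ hx
    gcongr
  exact (sq_le_sq₀ (norm_nonneg _) (norm_nonneg _)).1 this

lemma toF_sum_sq {ι : Type*} (S : Finset ι) (f : ι → ℝ → ℂ) (hf : ∀ i ∈ S, MemLp (f i) 2 volume)
    {w : ℝ → ℝ} (hw : Integrable (fun ξ => w ξ ^ 2)) (h : ∀ᵐ ξ : ℝ, ∑ i ∈ S, ‖f i ξ‖ ^ 2 ≤ w ξ ^ 2) :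
    ∑ i ∈ S, ‖toF (f i)‖ ^ 2 ≤ ∫ ξ, w ξ ^ 2 := by
  rw [sum_congr rfl fun i hi => toF_norm_sq (hf i hi), ← integral_finsetSum _ fun i hi => memLp_sq (hf i hi)]
  exact integral_mono_ae (integrable_finsetSum _ fun i hi => memLp_sq (hf i hi)) hw h

lemma phf_inner (J i j k l : ℕ) (hJ : 0 < J) :
    ip (toF (phf J i k)) (toF (phf J j l)) = if i = j ∧ k = l then 1 else 0 := by
  rw [toF_inner (phf_memLp J i k) (phf_memLp J j l)]
  have h := ft_inner (cb J i k) (cb J j l) (cb_int J i k) (cb_memLp J i k 2) (cb_int J j l) (cb_memLp J j l 2)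
  rw [cb_orth J i j k l hJ] at h
  have e : ∀ ξ, (phf J j l ξ * (starRingEnd ℂ) (phf J i k ξ)).re =
      (2 * π)⁻¹ * ((starRingEnd ℂ) (ft (cb J i k) ξ) * ft (cb J j l) ξ).re := by
    intro ξ
    unfold phf
    rw [map_mul, Complex.conj_ofReal, ← Complex.re_ofReal_mul]
    congr 1
    have : ((2 * π)⁻¹ : ℝ) = (√(2 * π))⁻¹ * (√(2 * π))⁻¹ := by
      rw [← mul_inv, mul_self_sqrt ps]
    rw [this]; push_cast; ring
  simp_rw [e]
  rw [integral_const_mul, h, ← mul_assoc, inv_mul_cancel₀ ps, one_mul]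

lemma phf_orthonormal {ι : Type*} (J : ℕ) (hJ : 0 < J) (p : ι → ℕ × ℕ) (hp : Function.Injective p) :
    Orthonormal ℝ (fun l => toF (phf J (p l).1 (p l).2)) := by
  classical
  rw [orthonormal_iff_ite]
  intro a b
  rw [phf_inner J _ _ _ _ hJ]
  congr 1
  rw [← Prod.ext_iff, hp.eq_iff]

lemma ddf_meas (s : ℝ) (J j k : ℕ) : AEStronglyMeasurable (ddf s J j k) volume := by
  unfold ddf
  refine AEStronglyMeasurable.mul ?_ (phf_memLp J j k).1
  exact Measurable.aestronglyMeasurable (by fun_prop)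

lemma Wf_scale {so sz : ℝ} (h0 : 1/2 < so) (ho : sz < 3/2) {ω : ℝ} (hω : 0 < ω) (c : ℝ) :
    Integrable (fun ξ => (c * Wf so sz (ω⁻¹ * ξ)) ^ 2) ∧
    ∫ ξ, (c * Wf so sz (ω⁻¹ * ξ)) ^ 2 = c ^ 2 * ω * ∫ ξ, Wf so sz ξ ^ 2 := by
  simp only [mul_pow]
  constructor
  · exact ((Wf_sq_int h0 ho).comp_mul_left' (inv_ne_zero hω.ne')).const_mul _
  · rw [integral_const_mul, Measure.integral_comp_mul_left (fun ξ => Wf so sz ξ ^ 2)]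
    rw [inv_inv, abs_of_pos hω, smul_eq_mul]; ring

lemma ddf_main {s sz : ℝ} (h0 : 1/2 < s) (ho : s ≤ sz) (hO : sz < 3/2) (J j k : ℕ) (hJ : 0 < J)
    (hk : k ≠ 0) : MemLp (ddf s J j k) 2 volume ∧
    ‖toF (ddf s J j k)‖ ^ 2 ≤ 2 * (∫ ξ, Wf 1 sz ξ ^ 2) / k := by
  have hJ' : (0:ℝ) < J := mod_cast hJ
  have hk' : (0:ℝ) < k := mod_cast Nat.pos_of_ne_zero hk
  have hω : 0 < π * k * J := by positivity
  have hae : ∀ᵐ ξ : ℝ, ‖ddf s J j k ξ‖ ≤ (√(2 * π))⁻¹ * (4 * √(2 * J)) / (π * k * J) * Wf 1 sz ((π * k * J)⁻¹ * ξ) := by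
    have hfin : volume ({0, π * k * J, -(π * k * J)} : Set ℝ) = 0 := (Set.toFinite _).measure_zero _
    filter_upwards [measure_eq_zero_iff_ae_notMem.1 hfin] with ξ hξ
    simp only [mem_insert_iff, mem_singleton_iff, not_or] at hξ
    refine ddf_bound h0 ho hO J j k hJ hk ξ hξ.1 ?_
    intro h
    rcases abs_eq hω.le |>.1 h with h | h
    · exact hξ.2.1 h
    · exact hξ.2.2 h
  obtain ⟨hi, he⟩ := Wf_scale (so := 1) (by norm_num) hO hω ((√(2 * π))⁻¹ * (4 * √(2 * J)) / (π * k * J))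
  have hm := memLp_of_le (ddf_meas s J j k) hi hae
  refine ⟨hm, ?_⟩
  rw [toF_norm_sq hm]
  refine (integral_mono_ae (memLp_sq hm) hi ?_).trans ?_
  · filter_upwards [hae] with ξ h
    gcongr
  rw [he]
  have e : ((√(2 * π))⁻¹ * (4 * √(2 * J)) / (π * k * J)) ^ 2 * (π * k * J) = 16 / π ^ 2 / k := by
    rw [div_pow, mul_pow, mul_pow, inv_pow, sq_sqrt ps, sq_sqrt ps]
    field_simp; ring
  rw [e]
  have h3 : 0 ≤ ∫ ξ, Wf 1 sz ξ ^ 2 := integral_nonneg fun _ => sq_nonneg _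
  have h4 : 16 / π ^ 2 ≤ 2 := by
    rw [div_le_iff₀ ps]; nlinarith [pi_gt_three]
  calc 16 / π ^ 2 / k * ∫ ξ, Wf 1 sz ξ ^ 2 ≤ 2 / k * ∫ ξ, Wf 1 sz ξ ^ 2 := by gcongr
    _ = _ := by ring

end kz

section k2

def AA (J j k : ℕ) (κ : ℝ → ℝ → ℂ) (ξ : ℝ) : ℂ := ∫ y, (cb J j k y : ℂ) * κ y ξ

lemma cbf_int (J j k : ℕ) (f : ℝ → ℂ) (hf : Measurable f) (W : ℝ) (hW : ∀ y ∈ blk J j, ‖f y‖ ≤ W) :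
    Integrable (fun y => (cb J j k y : ℂ) * f y) := by
  set F : ℝ → ℂ := (blk J j).indicator f with hF
  have : (fun y => (cb J j k y : ℂ) * f y) = fun y => (cb J j k y : ℂ) * F y := by
    ext y
    by_cases h : y ∈ blk J j
    · simp [hF, h]
    · simp [cb, h]
  rw [this]
  have h0 : Integrable (fun y => (cb J j k y : ℂ)) volume := (cb_int J j k).ofReal
  refine h0.mul_bdd (c := |W|) (hf.indicator (blk_meas J j)).aestronglyMeasurable (ae_of_all _ fun y => ?_)
  by_cases h : y ∈ blk J j
  · rw [hF, indicator_of_mem h]; exact (hW y h).trans (le_abs_self _)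
  · rw [hF, indicator_of_notMem h]; simp

structure GK (J j : ℕ) (κ : ℝ → ℝ → ℂ) (w : ℝ → ℝ) : Prop where
  meas : Measurable (Function.uncurry κ)
  bd : ∀ y ∈ blk J j, ∀ ξ, ‖κ y ξ‖ ≤ w ξ

lemma blk_ne (J j : ℕ) (hJ : 0 < J) : (((j:ℝ) + 1) / J) ∈ blk J j := by
  have hJ' : (0:ℝ) < J := mod_cast hJ
  refine ⟨?_, le_refl _⟩
  gcongr; linarith

lemma GK.nonneg {J j : ℕ} (hJ : 0 < J) {κ : ℝ → ℝ → ℂ} {w : ℝ → ℝ} (h : GK J j κ w) (ξ : ℝ) : 0 ≤ w ξ :=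
  (norm_nonneg _).trans (h.bd _ (blk_ne J j hJ) ξ)

lemma GK.sec {J j : ℕ} {κ : ℝ → ℝ → ℂ} {w : ℝ → ℝ} (h : GK J j κ w) (ξ : ℝ) : Measurable fun y => κ y ξ :=
  h.meas.comp (measurable_id.prodMk measurable_const)

lemma GK.int {J j : ℕ} {κ : ℝ → ℝ → ℂ} {w : ℝ → ℝ} (h : GK J j κ w) (k : ℕ) (ξ : ℝ) :
    Integrable (fun y => (cb J j k y : ℂ) * κ y ξ) :=
  cbf_int J j k _ (h.sec ξ) (w ξ) fun y hy => h.bd y hy ξ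

lemma AA_meas (J j k : ℕ) {κ : ℝ → ℝ → ℂ} (h : Measurable (Function.uncurry κ)) :
    AEStronglyMeasurable (AA J j k κ) volume := by
  have hc := cb_meas J j k
  have hO : Measurable (fun z : ℝ × ℝ => (cb J j k z.2 : ℂ) * κ z.2 z.1) := by
    refine Measurable.mul (by fun_prop) ?_
    exact h.comp (measurable_snd.prodMk measurable_fst)
  exact (StronglyMeasurable.integral_prod_right (ν := volume) hO.stronglyMeasurable).aestronglyMeasurable

lemma GK.le {J j : ℕ} (hJ : 0 < J) {κ : ℝ → ℝ → ℂ} {w : ℝ → ℝ} (h : GK J j κ w) (k : ℕ) (ξ : ℝ) :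
    ‖AA J j k κ ξ‖ ≤ w ξ := by
  have := bessel_blk J j hJ _ (h.sec ξ) (w ξ) (fun y hy => h.bd y hy ξ) {k}
  rw [Finset.sum_singleton] at this
  have ho : (1:ℝ) ≤ J := mod_cast hJ
  have hO : w ξ ^ 2 / J ≤ w ξ ^ 2 := div_le_self (sq_nonneg _) ho
  exact (sq_le_sq₀ (norm_nonneg _) (h.nonneg hJ ξ)).1 (this.trans hO)

lemma GK.memLp {J j : ℕ} (hJ : 0 < J) {κ : ℝ → ℝ → ℂ} {w : ℝ → ℝ} (h : GK J j κ w)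
    (hw : Integrable (fun ξ => w ξ ^ 2)) (k : ℕ) : MemLp (AA J j k κ) 2 volume :=
  memLp_of_le (AA_meas J j k h.meas) hw (ae_of_all _ fun ξ => h.le hJ k ξ)

lemma AA_bessel {ι : Type*} [Fintype ι] (J : ℕ) (hJ : 0 < J) (p : ι → ℕ × ℕ) (hp : Function.Injective p)
    (hpJ : ∀ l, (p l).1 < J) (κ : ℕ → ℝ → ℝ → ℂ) (w : ℝ → ℝ) (h : ∀ j < J, GK J j (κ j) w)
    (hw : Integrable (fun ξ => w ξ ^ 2)) :
    ∑ l, ‖toF (AA J (p l).1 (p l).2 (κ (p l).1))‖ ^ 2 ≤ ∫ ξ, w ξ ^ 2 := by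
  classical
  refine toF_sum_sq Finset.univ _ (fun l _ => (h _ (hpJ l)).memLp hJ hw _) hw (ae_of_all _ fun ξ => ?_)
  have hJ' : (0:ℝ) < J := mod_cast hJ
  set G : ℕ × ℕ → ℝ := fun q => ‖AA J q.1 q.2 (κ q.1) ξ‖ ^ 2
  calc ∑ l, G (p l) = ∑ q ∈ Finset.univ.image p, G q := by
        rw [Finset.sum_image fun a _ b _ hab => hp hab]
    _ ≤ ∑ q ∈ Finset.range J ×ˢ (Finset.univ.image fun l => (p l).2), G q := by
        refine Finset.sum_le_sum_of_subset_of_nonneg ?_ fun _ _ _ => sq_nonneg _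
        intro q hq
        obtain ⟨l, -, rfl⟩ := Finset.mem_image.1 hq
        simp only [Finset.mem_product, Finset.mem_range, Finset.mem_image, Finset.mem_univ, true_and]
        exact ⟨hpJ l, l, rfl⟩
    _ = ∑ j ∈ Finset.range J, ∑ k ∈ Finset.univ.image fun l => (p l).2, G (j, k) := Finset.sum_product _ _ _
    _ ≤ ∑ j ∈ Finset.range J, w ξ ^ 2 / J := by
        refine sum_le_sum fun j hj => ?_
        have hj' := h j (Finset.mem_range.1 hj)
        exact bessel_blk J j hJ _ (hj'.sec ξ) (w ξ) (fun y hy => hj'.bd y hy ξ) _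
    _ = w ξ ^ 2 := by rw [sum_const, Finset.card_range, nsmul_eq_mul]; field_simp

structure Stg where
  s : ℝ → ℝ
  c : ℝ → ℝ
  so : ℝ
  sz : ℝ
  M : ℝ
  L : ℝ
  r : ℝ
  hso : 1/2 < so
  hsz : sz < 3/2
  hM : 1 ≤ M
  hL : 1 ≤ L
  hr : 0 < r
  hro : r ≤ 1
  sm : Measurable s
  cm : Measurable c
  hs : ∀ y ∈ I₁, so ≤ s y ∧ s y ≤ sz
  hc : ∀ y ∈ I₁, 0 ≤ c y ∧ c y ≤ M
  hsH : ∀ x ∈ I₁, ∀ y ∈ I₁, |s x - s y| ≤ L * |x - y| ^ r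
  hcH : ∀ x ∈ I₁, ∀ y ∈ I₁, |c x - c y| ≤ L * |x - y| ^ r

def Kb (c s y ξ : ℝ) : ℂ := (c : ℂ) * (Complex.exp (Complex.I * y * ξ) - 1) * ((|ξ| ^ (-s) : ℝ) : ℂ)

def Stg.K (P : Stg) (y ξ : ℝ) : ℂ := Kb (P.c y) (P.s y) y ξ

lemma exp_sub_one_le (y ξ : ℝ) : ‖Complex.exp (Complex.I * y * ξ) - 1‖ ≤ |y * ξ| ∧
    ‖Complex.exp (Complex.I * y * ξ) - 1‖ ≤ 2 := by
  have e : Complex.I * y * ξ = Complex.I * ((y * ξ : ℝ) : ℂ) := by push_cast; ring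
  rw [e]
  refine ⟨norm_exp_I_mul_ofReal_sub_one_le, ?_⟩
  refine (norm_sub_le _ _).trans ?_
  rw [mul_comm, Complex.norm_exp_ofReal_mul_I]; norm_num

lemma Wf_mul {so sz s : ℝ} (h0 : so ≤ s) (ho : s ≤ sz) (hs : 0 < s) (ξ a : ℝ) (ha : a ≤ 2 * |ξ|) (ha' : a ≤ 2) :
    a * |ξ| ^ (-s) ≤ 2 * Wf so sz ξ := by
  rcases eq_or_ne ξ 0 with rfl | hξ
  · rw [abs_zero, zero_rpow (by linarith), mul_zero]
    have := Wf_nonneg so sz 0; linarith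
  have hx : 0 < |ξ| := abs_pos.2 hξ
  unfold Wf
  split_ifs with h
  · calc a * |ξ| ^ (-s) ≤ 2 * |ξ| * |ξ| ^ (-s) := by gcongr
      _ = 2 * |ξ| ^ (1 - s) := by rw [sub_eq_add_neg, rpow_add hx, rpow_one]; ring
      _ ≤ _ := by
        have := rpow_le_rpow_of_exponent_ge hx h (by linarith : 1 - sz ≤ 1 - s)
        linarith
  · push Not at h
    have := rpow_le_rpow_of_exponent_le h.le (by linarith : -s ≤ -so)
    have h3 : 0 ≤ |ξ| ^ (-s) := by positivity
    nlinarith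

lemma Kb_meas {c s : ℝ → ℝ} (hc : Measurable c) (hs : Measurable s) :
    Measurable (Function.uncurry fun y ξ => Kb (c y) (s y) y ξ) := by
  unfold Function.uncurry Kb
  have ho : Measurable fun z : ℝ × ℝ => |z.2| ^ (-s z.1) := by
    refine Measurable.pow (by fun_prop) (by fun_prop)
  fun_prop

lemma Kb_bd {c s so sz M y : ℝ} (hc : 0 ≤ c ∧ c ≤ M) (h0 : so ≤ s) (ho : s ≤ sz) (hs : 0 < s)
    (hy : y ∈ I₁) (ξ : ℝ) : ‖Kb c s y ξ‖ ≤ 2 * M * Wf so sz ξ := by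
  unfold Kb
  rw [norm_mul, norm_mul, Complex.norm_real, Complex.norm_real, norm_eq_abs, norm_eq_abs,
    abs_of_nonneg hc.1, abs_of_nonneg ps]
  obtain ⟨eo, ez⟩ := exp_sub_one_le y ξ
  have ee : |y * ξ| ≤ 2 * |ξ| := by
    rw [abs_mul, abs_of_nonneg hy.1]
    nlinarith [abs_nonneg ξ, hy.2]
  have := Wf_mul h0 ho hs ξ _ (eo.trans ee) ez
  have hw := Wf_nonneg so sz ξ
  calc _ = c * (‖Complex.exp (Complex.I * y * ξ) - 1‖ * |ξ| ^ (-s)) := by ring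
    _ ≤ M * (2 * Wf so sz ξ) := by
      have h5 : 0 ≤ ‖Complex.exp (Complex.I * y * ξ) - 1‖ * |ξ| ^ (-s) := by positivity
      exact mul_le_mul hc.2 this h5 (hc.1.trans hc.2)
    _ = _ := by ring

lemma blk_Icc {J j : ℕ} (hj : j < J) {y : ℝ} (hy : y ∈ blk J j) : y ∈ I₁ :=
  Ioc_subset_Icc_self (blk_sub hj hy)

lemma Stg.gk (P : Stg) {J j : ℕ} (hj : j < J) : GK J j P.K (fun ξ => 2 * P.M * Wf P.so P.sz ξ) where
  meas := Kb_meas P.cm P.sm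
  bd y hy ξ := by
    have h := blk_Icc hj hy
    exact Kb_bd (P.hc y h) (P.hs y h).1 (P.hs y h).2 (by linarith [P.hso, (P.hs y h).1]) h ξ

lemma GK.add {J j : ℕ} {κ κ' : ℝ → ℝ → ℂ} {w w' : ℝ → ℝ} (h : GK J j κ w) (h' : GK J j κ' w') (k : ℕ) (ξ : ℝ) :
    AA J j k (fun y ξ => κ y ξ + κ' y ξ) ξ = AA J j k κ ξ + AA J j k κ' ξ := by
  unfold AA
  rw [← integral_add (h.int k ξ) (h'.int k ξ)]
  congr 1; ext y; ring

lemma AA_Kb (J j k : ℕ) (hJ : 0 < J) (hk : k ≠ 0) (c s ξ : ℝ) :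
    AA J j k (fun y ξ => Kb c s y ξ) ξ = (c : ℂ) * ((|ξ| ^ (-s) : ℝ) : ℂ) * ft (cb J j k) ξ := by
  unfold AA Kb ft
  have h0 : Integrable (fun y => (cb J j k y : ℂ)) volume := (cb_int J j k).ofReal
  have ho : Integrable (fun y => (cb J j k y : ℂ) * Complex.exp (Complex.I * y * ξ)) volume := by
    refine h0.mul_bdd (c := 1) (by fun_prop) (ae_of_all _ fun y => ?_)
    rw [show Complex.I * y * ξ = ((y * ξ : ℝ) : ℂ) * Complex.I by push_cast; ring, Complex.norm_exp_ofReal_mul_I]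
  have e : ∀ y : ℝ, (cb J j k y : ℂ) * ((c:ℂ) * (Complex.exp (Complex.I * y * ξ) - 1) * ((|ξ| ^ (-s) : ℝ) : ℂ)) =
      ((c:ℂ) * ((|ξ| ^ (-s) : ℝ) : ℂ)) * ((cb J j k y : ℂ) * Complex.exp (Complex.I * y * ξ) - (cb J j k y : ℂ)) := by
    intro y; ring
  simp_rw [e]
  have h9 : ∫ y, (cb J j k y : ℂ) = 0 := by
    have := integral_complex_ofReal (f := cb J j k) (μ := volume)
    rw [this, cb_zero_int J j k hJ hk]; simp
  rw [integral_const_mul, integral_sub ho h0, h9, sub_zero]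

lemma AA_Kb' (J j k : ℕ) (hJ : 0 < J) (hk : k ≠ 0) (c s ξ : ℝ) :
    AA J j k (fun y ξ => Kb c s y ξ) ξ =
      ((√(2 * π) * c * (π * k * J) ^ (-s) : ℝ) : ℂ) * (phf J j k ξ + ddf s J j k ξ) := by
  have hJ' : (0:ℝ) < J := mod_cast hJ
  have hk' : (0:ℝ) < k := mod_cast Nat.pos_of_ne_zero hk
  rw [AA_Kb J j k hJ hk]
  unfold ddf phf
  have ho : (|ξ| / (π * k * J)) ^ (-s) = |ξ| ^ (-s) / (π * k * J) ^ (-s) :=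
    div_rpow (abs_nonneg _) ps _
  have hO : (((π * k * J) ^ (-s) : ℝ) : ℂ) ≠ 0 := by
    have : (0:ℝ) < (π * k * J) ^ (-s) := by positivity
    exact_mod_cast this.ne'
  have h3 : ((√(2 * π) : ℝ) : ℂ) ≠ 0 := by
    have : (0:ℝ) < √(2 * π) := by positivity
    exact_mod_cast this.ne'
  rw [ho]
  rw [Complex.ofReal_mul, Complex.ofReal_mul, Complex.ofReal_sub, Complex.ofReal_div, Complex.ofReal_inv]
  field_simp
  push_cast; ring

end k2

section k3

def whi (ko e C ξ : ℝ) : ℝ := if ko < |ξ| then C * |ξ| ^ (-e) else 0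

lemma whi_int {ko e : ℝ} (hk : 0 < ko) (he : 1/2 < e) (C : ℝ) :
    Integrable (fun ξ => whi ko e C ξ ^ 2) ∧
      ∫ ξ, whi ko e C ξ ^ 2 = C ^ 2 * (2 * ko ^ (1 - 2 * e) / (2 * e - 1)) := by
  have hE : ∀ ξ ∈ Ioi (0:ℝ), whi ko e C ξ ^ 2 = (Ioi ko).indicator (fun ξ => C ^ 2 * ξ ^ (-(2 * e))) ξ := by
    intro ξ hξ
    have hx : 0 < ξ := hξ
    unfold whi
    rw [abs_of_pos hx]
    by_cases h : ko < ξ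
    · rw [if_pos h, indicator_of_mem (mem_Ioi.2 h), mul_pow, ← rpow_natCast (ξ ^ (-e)), ← rpow_mul hx.le]
      congr 2; push_cast; ring
    · rw [if_neg h, indicator_of_notMem (by simpa using h)]; simp
  have hsub : Ioi (0:ℝ) ∩ Ioi ko = Ioi ko := by
    rw [inter_eq_right]; exact Ioi_subset_Ioi hk.le
  have hio : IntegrableOn (fun ξ => whi ko e C ξ ^ 2) (Ioi 0) := by
    have : IntegrableOn ((Ioi ko).indicator (fun ξ : ℝ => C ^ 2 * ξ ^ (-(2 * e)))) (Ioi 0) := by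
      rw [IntegrableOn, integrable_indicator_iff measurableSet_Ioi, IntegrableOn, Measure.restrict_restrict measurableSet_Ioi,
        inter_comm, hsub]
      exact (integrableOn_Ioi_rpow_of_lt (by linarith) hk).const_mul _
    exact this.congr_fun (fun ξ hξ => (hE ξ hξ).symm) measurableSet_Ioi
  have hev : ∀ x, whi ko e C (-x) ^ 2 = whi ko e C x ^ 2 := fun x => by simp [whi]
  refine ⟨int_even _ hev hio, ?_⟩
  have hO : ∫ ξ, whi ko e C ξ ^ 2 = 2 * ∫ ξ in Ioi (0:ℝ), whi ko e C ξ ^ 2 := by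
    rw [← integral_comp_abs (f := fun ξ => whi ko e C ξ ^ 2)]
    congr 1; ext x; simp [whi]
  rw [hO, setIntegral_congr_fun measurableSet_Ioi hE, setIntegral_indicator measurableSet_Ioi, hsub, integral_const_mul,
    integral_Ioi_rpow_of_lt (by linarith) hk]
  have : -(2 * e) + 1 = -(2 * e - 1) := by ring
  rw [this, show 1 - 2 * e = -(2*e-1) by ring]
  have h3 : 2 * e - 1 ≠ 0 := by linarith
  field_simp

lemma rpow_diff {a s t so : ℝ} (ha : 1 ≤ a) (hs : so ≤ s) (ht : so ≤ t) :
    |a ^ (-s) - a ^ (-t)| ≤ |s - t| * log a * a ^ (-so) := by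
  have key : ∀ s t : ℝ, so ≤ s → s ≤ t → |a ^ (-s) - a ^ (-t)| ≤ |s - t| * log a * a ^ (-so) := by
    intro s t hs hst
    have hao : 0 < a := by linarith
    have ho : a ^ (-t) = a ^ (-s) * a ^ (-(t - s)) := by rw [← rpow_add hao]; congr 1; ring
    have hO : a ^ (-(t - s)) ≤ 1 := rpow_le_one_of_one_le_of_nonpos ha (by linarith)
    have h3 : 1 - (t - s) * log a ≤ a ^ (-(t - s)) := by
      rw [rpow_def_of_pos hao]
      have := add_one_le_exp (log a * -(t - s)); linarith
    have h4 : a ^ (-s) ≤ a ^ (-so) := rpow_le_rpow_of_exponent_le ha (by linarith)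
    have h5 : 0 ≤ a ^ (-s) := by positivity
    rw [ho, abs_of_nonneg (by nlinarith), abs_sub_comm, abs_of_nonneg (by linarith)]
    have h6 : 0 ≤ (t - s) * log a := mul_nonneg (by linarith) (log_nonneg ha)
    calc a ^ (-s) - a ^ (-s) * a ^ (-(t - s)) = a ^ (-s) * (1 - a ^ (-(t - s))) := by ring
      _ ≤ a ^ (-so) * ((t - s) * log a) := by
        refine mul_le_mul h4 (by linarith) (by linarith) ps
      _ = _ := by ring
  rcases le_total s t with h | h
  · exact key s t hs h
  · rw [abs_sub_comm, abs_sub_comm s t]; exact key t s ht h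

def Stg.khi (P : Stg) (ko x y ξ : ℝ) : ℂ := if ko < |ξ| then P.K y ξ - Kb (P.c x) (P.s x) y ξ else 0

lemma blk_dist {J j : ℕ} {x y : ℝ} (hx : x ∈ blk J j) (hy : y ∈ blk J j) :
    |y - x| ≤ 1 / J := by
  have ho := hx.1; have hO := hx.2; have h3 := hy.1; have h4 := hy.2
  have e : ((j:ℝ) + 1) / J = j / J + 1 / J := by ring
  rw [e] at hO h4
  rw [abs_le]; constructor <;> linarith

lemma Stg.khi_gk (P : Stg) {J j : ℕ} (hj : j < J) {ko ν : ℝ} (hk : 1 ≤ ko) (hν : 0 < ν)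
    {x : ℝ} (hx : x ∈ blk J j) :
    GK J j (P.khi ko x) (whi ko (P.so - ν) (2 * P.L * (1 / (J:ℝ)) ^ P.r * (1 + P.M / ν))) where
  meas := by
    unfold Stg.khi Function.uncurry
    refine Measurable.ite (measurableSet_lt (by fun_prop) (by fun_prop)) ?_ measurable_const
    refine Measurable.sub (Kb_meas P.cm P.sm) ?_
    exact Kb_meas (c := fun _ => P.c x) (s := fun _ => P.s x) measurable_const measurable_const
  bd y hy ξ := by
    unfold Stg.khi whi
    split_ifs with h
    · have hxI := blk_Icc hj hx
      have hyI := blk_Icc hj hy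
      set a := |ξ| with ha
      have haz : 1 ≤ a := hk.trans h.le
      have hao : 0 < a := by linarith
      have hr : |y - x| ^ P.r ≤ (1 / (J:ℝ)) ^ P.r :=
        rpow_le_rpow (abs_nonneg _) (blk_dist hx hy) P.hr.le
      have hc : |P.c y - P.c x| ≤ P.L * (1 / (J:ℝ)) ^ P.r :=
        (P.hcH y hyI x hxI).trans (by have := P.hL; gcongr)
      have hs : |P.s y - P.s x| ≤ P.L * (1 / (J:ℝ)) ^ P.r :=
        (P.hsH y hyI x hxI).trans (by have := P.hL; gcongr)
      have e : P.K y ξ - Kb (P.c x) (P.s x) y ξ = (Complex.exp (Complex.I * y * ξ) - 1) *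
          (((P.c y - P.c x) * a ^ (-P.s y) + P.c x * (a ^ (-P.s y) - a ^ (-P.s x)) : ℝ) : ℂ) := by
        unfold Stg.K Kb; push_cast; ring
      rw [e, norm_mul, Complex.norm_real, norm_eq_abs]
      have ho := (exp_sub_one_le y ξ).2
      have hO := rpow_diff haz (P.hs y hyI).1 (P.hs x hxI).1
      have h3 : a ^ (-P.s y) ≤ a ^ (-P.so) := rpow_le_rpow_of_exponent_le haz (by linarith [(P.hs y hyI).1])
      have h4 : log a ≤ a ^ ν / ν := log_le_rpow_div hao.le hν
      have h4' : 0 ≤ log a := log_nonneg haz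
      have h5 : a ^ (-(P.so - ν)) = a ^ ν * a ^ (-P.so) := by rw [← rpow_add hao]; congr 1; ring
      have h6 : 1 ≤ a ^ ν := one_le_rpow haz hν.le
      have hM := P.hM
      have hL := P.hL
      set R := P.L * (1 / (J:ℝ)) ^ P.r with hR
      have hRo : 0 ≤ R := by positivity
      have hAo : 0 < a ^ (-P.so) := by positivity
      have h7 : |(P.c y - P.c x) * a ^ (-P.s y) + P.c x * (a ^ (-P.s y) - a ^ (-P.s x))| ≤
          R * a ^ (-P.so) + P.M * (R * (a ^ ν / ν) * a ^ (-P.so)) := by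
        refine (abs_add_le _ _).trans (add_le_add ?_ ?_)
        · rw [abs_mul, abs_of_nonneg (by positivity : 0 ≤ a ^ (-P.s y))]
          exact mul_le_mul hc h3 ps hRo
        · rw [abs_mul, abs_of_nonneg (P.hc x hxI).1]
          refine mul_le_mul (P.hc x hxI).2 (hO.trans ?_) (abs_nonneg _) (by linarith)
          gcongr
      calc _ ≤ 2 * (R * a ^ (-P.so) + P.M * (R * (a ^ ν / ν) * a ^ (-P.so))) := by gcongr
        _ ≤ 2 * (R * (a ^ ν * a ^ (-P.so)) + P.M * (R * (a ^ ν / ν) * a ^ (-P.so))) := by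
          gcongr
          nlinarith
        _ = 2 * P.L * (1 / (J:ℝ)) ^ P.r * (1 + P.M / ν) * a ^ (-(P.so - ν)) := by
          rw [h5, hR]; ring
    · simp

def Ex (m : ℕ) (z : ℂ) : ℂ := ∑ b ∈ Finset.range m, z ^ b / (b.factorial : ℂ)

lemma Ex_err (m : ℕ) (z : ℂ) : ‖Complex.exp z - Ex m z‖ ≤ ‖z‖ ^ m * exp ‖z‖ :=
  Complex.norm_exp_sub_sum_le_norm_mul_exp z m

lemma Ex_le (m : ℕ) (z : ℂ) : ‖Ex m z‖ ≤ exp ‖z‖ := by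
  unfold Ex
  refine (norm_sum_le _ _).trans ?_
  calc _ = ∑ b ∈ Finset.range m, ‖z‖ ^ b / (b.factorial : ℝ) := by
        refine sum_congr rfl fun b _ => ?_
        rw [norm_div, norm_pow, Complex.norm_natCast]
    _ ≤ _ := sum_le_exp_of_nonneg (norm_nonneg _) m

lemma Wlow {s so sz ν ko ξ : ℝ} (h0 : so ≤ s) (ho : s ≤ sz) (hs : 0 < s) (hk : 1 ≤ ko)
    (hξ : |ξ| ≤ ko) : |ξ| * |ξ| ^ (-s) * exp (ν * |log (|ξ|)|) ≤ ko * Wf (so - ν) (sz + ν) ξ := by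
  rcases eq_or_ne ξ 0 with rfl | h
  · have := Wf_nonneg (so - ν) (sz + ν) 0
    simp only [abs_zero, zero_mul]; positivity
  have ha : 0 < |ξ| := abs_pos.2 h
  unfold Wf
  set a := |ξ|
  split_ifs with hc
  · rw [abs_of_nonpos (log_nonpos ha.le hc)]
    have e : a * a ^ (-s) * exp (ν * -log a) = a ^ (1 - s - ν) := by
      rw [rpow_def_of_pos ha, rpow_def_of_pos ha]
      nth_rewrite 1 [← exp_log ha]
      rw [← exp_add, ← exp_add]; congr 1; ring
    rw [e]
    have := rpow_le_rpow_of_exponent_ge ha hc (by linarith : 1 - (sz + ν) ≤ 1 - s - ν)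
    have h3 : 0 ≤ a ^ (1 - (sz + ν)) := by positivity
    nlinarith
  · push Not at hc
    rw [abs_of_nonneg (log_nonneg hc.le)]
    have e : a ^ (-s) * exp (ν * log a) = a ^ (-s + ν) := by
      rw [rpow_def_of_pos ha, rpow_def_of_pos ha, ← exp_add]; congr 1; ring
    rw [mul_assoc, e]
    have := rpow_le_rpow_of_exponent_le hc.le (by linarith : -s + ν ≤ -(so - ν))
    gcongr

end k3

section k4

def qf (a : ℝ) (α : ℕ) (ξ : ℝ) : ℂ :=
  if α = 0 then Complex.exp (Complex.I * a * ξ) - 1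
  else Complex.exp (Complex.I * a * ξ) * (Complex.I * ξ) ^ α / (α.factorial : ℂ)

def hlf (a s ko : ℝ) (α b : ℕ) (ξ : ℝ) : ℂ :=
  if |ξ| ≤ ko then qf a α ξ * ((|ξ| ^ (-s) * ((log (|ξ|)) ^ b / (b.factorial : ℝ)) : ℝ) : ℂ) else 0

def Stg.wtf (P : Stg) (a x : ℝ) (α b : ℕ) (y : ℝ) : ℝ := P.c y * (y - a) ^ α * (-(P.s y - P.s x)) ^ b

def Stg.klo (P : Stg) (ko a x : ℝ) (m : ℕ) (y ξ : ℝ) : ℂ :=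
  if |ξ| ≤ ko then P.K y ξ - ∑ α ∈ Finset.range m, ∑ b ∈ Finset.range m, (P.wtf a x α b y : ℂ) * hlf a (P.s x) ko α b ξ
  else 0

lemma qf_sum (a y ξ : ℝ) (m : ℕ) (hm : 1 ≤ m) :
    ∑ α ∈ Finset.range m, ((y - a : ℝ) : ℂ) ^ α * qf a α ξ =
      Complex.exp (Complex.I * a * ξ) * Ex m (Complex.I * ((y - a) * ξ : ℝ)) - 1 := by
  obtain ⟨n, rfl⟩ : ∃ n, m = n + 1 := ⟨m - 1, by omega⟩
  unfold Ex
  rw [Finset.sum_range_succ', Finset.sum_range_succ']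
  simp only [qf, Nat.succ_ne_zero, if_false, if_true, pow_zero, one_mul, Nat.factorial_zero, Nat.cast_one, div_one, mul_add, mul_one]
  rw [mul_sum, ← add_sub_assoc]
  congr 2
  refine sum_congr rfl fun i _ => ?_
  push_cast
  rw [mul_pow, mul_pow, mul_pow]; ring

lemma klo_id (P : Stg) (ko a x y ξ : ℝ) (m : ℕ) (hm : 1 ≤ m) (hξ : |ξ| ≤ ko) (hξ0 : ξ ≠ 0) :
    P.klo ko a x m y ξ = (P.c y : ℂ) * ((|ξ| ^ (-P.s x) : ℝ) : ℂ) *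
      ((Complex.exp (Complex.I * y * ξ) - 1) *
          (Complex.exp ((-(P.s y - P.s x) * log (|ξ|) : ℝ) : ℂ) - Ex m ((-(P.s y - P.s x) * log (|ξ|) : ℝ) : ℂ)) +
        Ex m ((-(P.s y - P.s x) * log (|ξ|) : ℝ) : ℂ) *
          (Complex.exp (Complex.I * a * ξ) * (Complex.exp (Complex.I * ((y - a) * ξ : ℝ)) - Ex m (Complex.I * ((y - a) * ξ : ℝ))))) := by
  have ha : 0 < |ξ| := abs_pos.2 hξ0
  set θ : ℝ := -(P.s y - P.s x) * log (|ξ|) with hθ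
  unfold Stg.klo
  rw [if_pos hξ]
  have eo : ∑ α ∈ Finset.range m, ∑ b ∈ Finset.range m, (P.wtf a x α b y : ℂ) * hlf a (P.s x) ko α b ξ =
      (P.c y : ℂ) * ((|ξ| ^ (-P.s x) : ℝ) : ℂ) * ((∑ α ∈ Finset.range m, ((y - a : ℝ) : ℂ) ^ α * qf a α ξ) * Ex m (θ : ℂ)) := by
    unfold Ex
    rw [Finset.sum_mul_sum, mul_sum]
    refine sum_congr rfl fun α _ => ?_
    rw [mul_sum]
    refine sum_congr rfl fun b _ => ?_
    simp only [hlf, if_pos hξ, Stg.wtf, hθ]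
    push_cast
    rw [mul_pow]; ring
  rw [eo, qf_sum a y ξ m hm]
  have ez : ((|ξ| ^ (-P.s y) : ℝ) : ℂ) = ((|ξ| ^ (-P.s x) : ℝ) : ℂ) * Complex.exp (θ : ℂ) := by
    rw [← Complex.ofReal_exp, ← Complex.ofReal_mul]
    congr 1
    rw [rpow_def_of_pos ha, rpow_def_of_pos ha, ← exp_add, hθ]
    congr 1; ring
  have ee : Complex.exp (Complex.I * y * ξ) = Complex.exp (Complex.I * a * ξ) * Complex.exp (Complex.I * ((y - a) * ξ : ℝ)) := by
    rw [← Complex.exp_add]; congr 1; push_cast; ring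
  unfold Stg.K Kb
  rw [ez, ee]; ring

lemma klo_zero (P : Stg) {J j : ℕ} (hj : j < J) (ko a x y : ℝ) (m : ℕ) (hk : 0 ≤ ko) (hx : x ∈ blk J j) (hy : y ∈ blk J j) :
    P.klo ko a x m y 0 = 0 := by
  have ho : -P.s x ≠ 0 := by linarith [P.hso, (P.hs x (blk_Icc hj hx)).1]
  have hO : -P.s y ≠ 0 := by linarith [P.hso, (P.hs y (blk_Icc hj hy)).1]
  unfold Stg.klo Stg.K Kb hlf
  simp [ho, hO, zero_rpow, hk]

lemma pow_exp_bd {z t ν : ℝ} (m : ℕ) (hz : 0 ≤ z) (ht : 0 ≤ t) (hν : 0 < ν) (hzν : z ≤ ν / 2) :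
    (z * t) ^ m * exp (z * t) ≤ m.factorial * (2 * z / ν) ^ m * exp (ν * t) := by
  have ho : (ν / 2 * t) ^ m ≤ m.factorial * exp (ν / 2 * t) := by
    have := pow_div_factorial_le_exp (ν / 2 * t) ps m
    rw [div_le_iff₀ ps] at this; linarith
  have hO : exp (z * t) ≤ exp (ν / 2 * t) := by
    apply exp_le_exp.2; gcongr
  have e : (z * t) ^ m = (2 * z / ν) ^ m * (ν / 2 * t) ^ m := by
    rw [← mul_pow]; congr 1; field_simp
  calc _ = (2 * z / ν) ^ m * (ν / 2 * t) ^ m * exp (z * t) := by rw [e]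
    _ ≤ (2 * z / ν) ^ m * (m.factorial * exp (ν / 2 * t)) * exp (ν / 2 * t) := by gcongr
    _ = m.factorial * (2 * z / ν) ^ m * (exp (ν / 2 * t) * exp (ν / 2 * t)) := by ring
    _ = _ := by rw [← exp_add]; congr 2; ring

def elo (P : Stg) (J m : ℕ) (ν ko : ℝ) : ℝ :=
  m.factorial * (2 * (P.L * (1 / (J:ℝ)) ^ P.r) / ν) ^ m + 3 * (ko / J) ^ (m - 1)

lemma qf_meas (a : ℝ) (α : ℕ) : Measurable (qf a α) := by
  unfold qf; split_ifs <;> fun_prop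

lemma hlf_meas (a s ko : ℝ) (α b : ℕ) : Measurable (hlf a s ko α b) := by
  unfold hlf
  have := qf_meas a α
  refine Measurable.ite (measurableSet_le (by fun_prop) (by fun_prop)) (by fun_prop) (by fun_prop)

lemma wtf_meas (P : Stg) (a x : ℝ) (α b : ℕ) : Measurable (P.wtf a x α b) := by
  have := P.cm; have := P.sm
  unfold Stg.wtf; fun_prop

lemma Stg.klo_gk (P : Stg) {J j m : ℕ} (hj : j < J) (hm : 1 ≤ m) {ko ν : ℝ} (hk : 1 ≤ ko) (hkJ : ko ≤ J) (hν : 0 < ν)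
    (hLν : P.L * (1 / (J:ℝ)) ^ P.r ≤ ν / 2) {x : ℝ} (hx : x ∈ blk J j) :
    GK J j (P.klo ko ((j:ℝ) / J) x m) (fun ξ => P.M * elo P J m ν ko * ko * Wf (P.so - ν) (P.sz + ν) ξ) where
  meas := by
    unfold Stg.klo Function.uncurry
    refine Measurable.ite (measurableSet_le (by fun_prop) (by fun_prop)) ?_ measurable_const
    refine Measurable.sub (Kb_meas P.cm P.sm) ?_
    refine Finset.measurable_sum _ fun α _ => Finset.measurable_sum _ fun b _ => ?_
    have ho := wtf_meas P ((j:ℝ) / J) x α b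
    have hO := hlf_meas ((j:ℝ) / J) (P.s x) ko α b
    fun_prop
  bd y hy ξ := by
    have hJ : (0:ℝ) < J := mod_cast (Nat.zero_le j).trans_lt hj
    have hM := P.hM
    have hL := P.hL
    set R := P.L * (1 / (J:ℝ)) ^ P.r with hR
    have hRo : 0 ≤ R := by positivity
    have hEo : 0 ≤ elo P J m ν ko := by unfold elo; positivity
    have hWo := Wf_nonneg (P.so - ν) (P.sz + ν) ξ
    have hrhs : 0 ≤ P.M * elo P J m ν ko * ko * Wf (P.so - ν) (P.sz + ν) ξ := by positivity
    by_cases h : |ξ| ≤ ko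
    swap
    · unfold Stg.klo; rw [if_neg h, norm_zero]; exact hrhs
    rcases eq_or_ne ξ 0 with rfl | hξ0
    · rw [klo_zero P hj _ _ _ _ _ (by linarith) hx hy, norm_zero]; exact hrhs
    rw [klo_id P ko _ x y ξ m hm h hξ0]
    have hxI := blk_Icc hj hx
    have hyI := blk_Icc hj hy
    have ha : 0 < |ξ| := abs_pos.2 hξ0
    set t := |log (|ξ|)| with ht
    set θ : ℝ := -(P.s y - P.s x) * log (|ξ|) with hθ
    have hr : |y - x| ^ P.r ≤ (1 / (J:ℝ)) ^ P.r :=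
      rpow_le_rpow (abs_nonneg _) (blk_dist hx hy) P.hr.le
    have hs : |P.s y - P.s x| ≤ R := (P.hsH y hyI x hxI).trans (mul_le_mul_of_nonneg_left hr (by linarith [P.hL]))
    have hθb : ‖(θ : ℂ)‖ ≤ R * t := by
      rw [Complex.norm_real, norm_eq_abs, hθ, abs_mul, abs_neg]; gcongr
    have hto : 0 ≤ t := abs_nonneg _
    have bo : ‖Complex.exp (θ : ℂ) - Ex m (θ : ℂ)‖ ≤ m.factorial * (2 * R / ν) ^ m * exp (ν * t) := by
      refine (Ex_err m _).trans (le_trans ?_ (pow_exp_bd m hRo hto hν hLν))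
      gcongr
    have bz : ‖Ex m (θ : ℂ)‖ ≤ exp (ν * t) := by
      refine (Ex_le m _).trans (exp_le_exp.2 (hθb.trans ?_))
      gcongr; linarith
    have b3 : ‖Complex.exp (Complex.I * y * ξ) - 1‖ ≤ |ξ| := by
      refine (exp_sub_one_le y ξ).1.trans ?_
      rw [abs_mul, abs_of_nonneg hyI.1]; nlinarith [hyI.2]
    have b4 : ‖Complex.exp (Complex.I * (((j:ℝ) / J : ℝ) : ℂ) * ξ)‖ = 1 := by
      rw [show Complex.I * (((j:ℝ) / J : ℝ) : ℂ) * ξ = (((j:ℝ) / J * ξ : ℝ) : ℂ) * Complex.I by push_cast; ring, Complex.norm_exp_ofReal_mul_I]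
    have hz : |(y - (j:ℝ) / J) * ξ| ≤ |ξ| / J := by
      have ho := hy.1; have hO := hy.2
      have e : ((j:ℝ) + 1) / J = j / J + 1 / J := by ring
      rw [e] at hO
      rw [abs_mul, abs_of_nonneg (by linarith)]
      calc _ ≤ 1 / (J:ℝ) * |ξ| := by gcongr; linarith
        _ = _ := by ring
    have hz1 : |ξ| / J ≤ 1 := by rw [div_le_one hJ]; linarith
    have b5 : ‖Complex.exp (Complex.I * ((y - (j:ℝ) / J) * ξ : ℝ)) - Ex m (Complex.I * ((y - (j:ℝ) / J) * ξ : ℝ))‖ ≤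
        3 * (ko / J) ^ (m - 1) * |ξ| := by
      refine (Ex_err m _).trans ?_
      rw [norm_mul, Complex.norm_I, one_mul, Complex.norm_real, norm_eq_abs]
      have h3 : exp |(y - (j:ℝ) / J) * ξ| ≤ 3 :=
        (exp_le_exp.2 (hz.trans hz1)).trans (by linarith [exp_one_lt_d9])
      have h4 : |(y - (j:ℝ) / J) * ξ| ^ m ≤ (ko / J) ^ (m - 1) * |ξ| := by
        obtain ⟨n, rfl⟩ : ∃ n, m = n + 1 := ⟨m - 1, by omega⟩
        have hJz : (1:ℝ) ≤ J := by linarith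
        have h5 : |ξ| / J ≤ |ξ| := div_le_self ha.le hJz
        calc _ ≤ (|ξ| / J) ^ (n + 1) := by gcongr
          _ = (|ξ| / J) ^ n * (|ξ| / J) := pow_succ _ _
          _ ≤ (ko / J) ^ n * |ξ| := by gcongr
      calc _ ≤ ((ko / J) ^ (m - 1) * |ξ|) * 3 := by gcongr
        _ = _ := by ring
    rw [norm_mul, norm_mul, Complex.norm_real, Complex.norm_real, norm_eq_abs, norm_eq_abs,
      abs_of_nonneg (P.hc y hyI).1, abs_of_nonneg (by positivity : 0 ≤ |ξ| ^ (-P.s x))]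
    have hin : ‖(Complex.exp (Complex.I * y * ξ) - 1) * (Complex.exp (θ : ℂ) - Ex m (θ : ℂ)) +
        Ex m (θ : ℂ) * (Complex.exp (Complex.I * (((j:ℝ) / J : ℝ) : ℂ) * ξ) * (Complex.exp (Complex.I * ((y - (j:ℝ) / J) * ξ : ℝ)) - Ex m (Complex.I * ((y - (j:ℝ) / J) * ξ : ℝ))))‖
        ≤ elo P J m ν ko * (|ξ| * exp (ν * t)) := by
      refine (norm_add_le _ _).trans ?_
      rw [norm_mul, norm_mul, norm_mul, b4, one_mul]
      calc _ ≤ |ξ| * (m.factorial * (2 * R / ν) ^ m * exp (ν * t)) + exp (ν * t) * (3 * (ko / J) ^ (m - 1) * |ξ|) := by gcongr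
        _ = _ := by unfold elo; ring
    have hWl := Wlow (ν := ν) (P.hs x hxI).1 (P.hs x hxI).2 (by linarith [P.hso, (P.hs x hxI).1]) hk h
    calc _ ≤ P.M * |ξ| ^ (-P.s x) * (elo P J m ν ko * (|ξ| * exp (ν * t))) := by
          gcongr
          exact (P.hc y hyI).2
      _ = P.M * elo P J m ν ko * (|ξ| * |ξ| ^ (-P.s x) * exp (ν * t)) := by ring
      _ ≤ P.M * elo P J m ν ko * (ko * Wf (P.so - ν) (P.sz + ν) ξ) := by gcongr
      _ = _ := by ring

lemma hlf_memLp {s so sz ν ko a : ℝ} (h0 : so ≤ s) (ho : s ≤ sz) (hs : 0 < s) (hk : 1 ≤ ko) (hν : 0 < ν)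
    (hso : 1/2 < so - ν) (hsz : sz + ν < 3/2) (ha : a ∈ I₁) (α b : ℕ) :
    MemLp (hlf a s ko α b) 2 volume := by
  set C := ko ^ α * ν⁻¹ ^ b * ko
  have hi : Integrable (fun ξ => (C * Wf (so - ν) (sz + ν) ξ) ^ 2) := by
    simp only [mul_pow]; exact (Wf_sq_int hso hsz).const_mul _
  refine memLp_of_le (hlf_meas _ _ _ _ _).aestronglyMeasurable hi (ae_of_all _ fun ξ => ?_)
  have hWo := Wf_nonneg (so - ν) (sz + ν) ξ
  unfold hlf
  split_ifs with h
  swap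
  · rw [norm_zero]; positivity
  have hq : ‖qf a α ξ‖ ≤ ko ^ α * |ξ| := by
    unfold qf
    split_ifs with hα
    · refine (exp_sub_one_le a ξ).1.trans ?_
      rw [hα, abs_mul, abs_of_nonneg ha.1, pow_zero]
      have := ha.2
      gcongr
    · have hexp : ‖Complex.exp (Complex.I * a * ξ)‖ = 1 := by
        rw [show Complex.I * a * ξ = ((a * ξ : ℝ) : ℂ) * Complex.I by push_cast; ring, Complex.norm_exp_ofReal_mul_I]
      rw [norm_div, norm_mul, hexp, norm_pow, norm_mul, Complex.norm_I, Complex.norm_real, norm_eq_abs, Complex.norm_natCast,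
        one_mul, one_mul]
      have hf : (1:ℝ) ≤ α.factorial := mod_cast Nat.one_le_iff_ne_zero.2 (Nat.factorial_ne_zero α)
      obtain ⟨n, rfl⟩ : ∃ n, α = n + 1 := ⟨α - 1, by omega⟩
      calc |ξ| ^ (n+1) / ((n+1).factorial : ℝ) ≤ |ξ| ^ (n+1) := div_le_self ps hf
        _ = |ξ| ^ n * |ξ| := pow_succ _ _
        _ ≤ ko ^ n * |ξ| := by gcongr
        _ ≤ ko ^ (n+1) * |ξ| := by gcongr <;> simp [hk]
  rw [norm_mul, Complex.norm_real, norm_eq_abs, abs_mul, abs_div, abs_pow, abs_of_nonneg (by positivity : 0 ≤ |ξ| ^ (-s)), Nat.abs_cast]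
  have hlog : |log (|ξ|)| ^ b / (b.factorial : ℝ) ≤ ν⁻¹ ^ b * exp (ν * |log (|ξ|)|) := by
    have := pow_div_factorial_le_exp (ν * |log (|ξ|)|) ps b
    calc _ = ν⁻¹ ^ b * ((ν * |log (|ξ|)|) ^ b / (b.factorial : ℝ)) := by
          rw [mul_pow, ← mul_div_assoc, ← mul_assoc, ← mul_pow, inv_mul_cancel₀ hν.ne']; simp
      _ ≤ _ := by gcongr
  have hWl := Wlow (ν := ν) h0 ho hs hk h
  calc _ ≤ ko ^ α * |ξ| * (|ξ| ^ (-s) * (ν⁻¹ ^ b * exp (ν * |log (|ξ|)|))) := by gcongr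
    _ = ko ^ α * ν⁻¹ ^ b * (|ξ| * |ξ| ^ (-s) * exp (ν * |log (|ξ|)|)) := by ring
    _ ≤ ko ^ α * ν⁻¹ ^ b * (ko * Wf (so - ν) (sz + ν) ξ) := by gcongr
    _ = _ := by ring

lemma AA_low (P : Stg) {J j m : ℕ} (hj : j < J) (hm : 1 ≤ m) {ko ν : ℝ} (hk : 1 ≤ ko) (hkJ : ko ≤ J) (hν : 0 < ν)
    (hLν : P.L * (1 / (J:ℝ)) ^ P.r ≤ ν / 2) {x : ℝ} (hx : x ∈ blk J j) (k : ℕ) (ξ : ℝ) (hξ : |ξ| ≤ ko) :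
    AA J j k P.K ξ = (∑ α ∈ Finset.range m, ∑ b ∈ Finset.range m,
      ((∫ y, cb J j k y * P.wtf ((j:ℝ)/J) x α b y : ℝ) : ℂ) * hlf ((j:ℝ)/J) (P.s x) ko α b ξ) +
      AA J j k (P.klo ko ((j:ℝ) / J) x m) ξ := by
  have hJ : (0:ℝ) < J := mod_cast (Nat.zero_le j).trans_lt hj
  have hi : ∀ α b, Integrable (fun y => (cb J j k y : ℂ) * (P.wtf ((j:ℝ)/J) x α b y : ℂ)) := by
    intro α b
    have ho := wtf_meas P ((j:ℝ) / J) x α b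
    refine cbf_int J j k (fun y => (P.wtf ((j:ℝ)/J) x α b y : ℂ)) (by fun_prop) P.M fun y hy => ?_
    have hyI := blk_Icc hj hy
    have hxI := blk_Icc hj hx
    rw [Complex.norm_real, norm_eq_abs, Stg.wtf, abs_mul, abs_mul, abs_pow, abs_pow, abs_neg, abs_of_nonneg (P.hc y hyI).1]
    have hO : |y - (j:ℝ)/J| ≤ 1 := by
      have h3 : 0 ≤ (j:ℝ)/J := by positivity
      rw [abs_of_nonneg (by linarith [hy.1])]; linarith [hyI.2]
    have h4 : |P.s y - P.s x| ≤ 1 := by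
      have := P.hs y hyI; have := P.hs x hxI; have := P.hso; have := P.hsz
      rw [abs_le]; constructor <;> linarith
    have h5 := pow_le_one₀ (n := α) (abs_nonneg _) hO
    have h6 := pow_le_one₀ (n := b) (abs_nonneg _) h4
    have hM := P.hM
    calc _ ≤ P.M * 1 * 1 := by
          have := (P.hc y hyI).2
          gcongr
      _ = P.M := by ring
  have hklo := P.klo_gk hj hm hk hkJ hν hLν hx
  have e : ∀ α b, ((∫ y, cb J j k y * P.wtf ((j:ℝ)/J) x α b y : ℝ) : ℂ) * hlf ((j:ℝ)/J) (P.s x) ko α b ξ =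
      ∫ y, (cb J j k y : ℂ) * (P.wtf ((j:ℝ)/J) x α b y : ℂ) * hlf ((j:ℝ)/J) (P.s x) ko α b ξ := by
    intro α b
    rw [integral_mul_const, ← integral_complex_ofReal]
    congr 2; ext y; push_cast; ring
  simp_rw [e]
  have hiz := fun α b => (hi α b).mul_const (hlf ((j:ℝ)/J) (P.s x) ko α b ξ)
  rw [sum_congr rfl fun α _ => (integral_finsetSum (Finset.range m) fun b _ => hiz α b).symm,
    ← integral_finsetSum _ fun α _ => integrable_finsetSum _ fun b _ => hiz α b]
  unfold AA
  rw [← integral_add (integrable_finsetSum _ fun α _ => integrable_finsetSum _ fun b _ => hiz α b) (hklo.int k ξ)]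
  congr 1; ext y
  unfold Stg.klo
  rw [if_pos hξ, mul_sub, mul_sum]
  have : ∑ α ∈ Finset.range m, (cb J j k y : ℂ) * ∑ b ∈ Finset.range m, (P.wtf ((j:ℝ)/J) x α b y : ℂ) * hlf ((j:ℝ)/J) (P.s x) ko α b ξ =
      ∑ α ∈ Finset.range m, ∑ b ∈ Finset.range m, (cb J j k y : ℂ) * (P.wtf ((j:ℝ)/J) x α b y : ℂ) * hlf ((j:ℝ)/J) (P.s x) ko α b ξ := by
    refine sum_congr rfl fun α _ => ?_
    rw [mul_sum]
    exact sum_congr rfl fun b _ => by ring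
  rw [this]; ring

end k4

section u1

lemma memLp_add' {f g : ℝ → ℂ} (hf : MemLp f 2 volume) (hg : MemLp g 2 volume) : MemLp (fun ξ => f ξ + g ξ) 2 volume :=
  hf.add hg

def Stg.tl (P : Stg) (J j k m : ℕ) (ko x ξ : ℝ) : ℂ :=
  ∑ α ∈ Finset.range m, ∑ b ∈ Finset.range m,
      ((∫ y, cb J j k y * P.wtf ((j:ℝ)/J) x α b y : ℝ) : ℂ) * hlf ((j:ℝ)/J) (P.s x) ko α b ξ

def Stg.cl (P : Stg) (J j k : ℕ) (ko x ξ : ℝ) : ℂ :=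
  if ko < |ξ| then AA J j k (fun y ξ => Kb (P.c x) (P.s x) y ξ) ξ else 0

lemma AA_hi (P : Stg) {J j : ℕ} (hj : j < J) {ko ν : ℝ} (hk : 1 ≤ ko) (hν : 0 < ν) {x : ℝ} (hx : x ∈ blk J j) (k : ℕ)
    (ξ : ℝ) (h : ko < |ξ|) : AA J j k P.K ξ = AA J j k (P.khi ko x) ξ + P.cl J j k ko x ξ := by
  have hkb : GK J j (fun y ξ => Kb (P.c x) (P.s x) y ξ) (fun ξ => 2 * P.M * Wf P.so P.sz ξ) :=
    ⟨Kb_meas measurable_const measurable_const, fun y hy ξ => by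
      have hxI := blk_Icc hj hx
      exact Kb_bd (P.hc x hxI) (P.hs x hxI).1 (P.hs x hxI).2 (by linarith [P.hso, (P.hs x hxI).1]) (blk_Icc hj hy) ξ⟩
  rw [Stg.cl, if_pos h, ← (P.khi_gk hj hk hν hx).add hkb]
  unfold AA; congr 1; ext y
  simp [Stg.khi, h]

lemma AA_dec (P : Stg) {J j m : ℕ} (hj : j < J) (hm : 1 ≤ m) {ko ν : ℝ} (hk : 1 ≤ ko) (hkJ : ko ≤ J) (hν : 0 < ν)
    (hLν : P.L * (1 / (J:ℝ)) ^ P.r ≤ ν / 2) {x : ℝ} (hx : x ∈ blk J j) (k : ℕ) (ξ : ℝ) :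
    AA J j k P.K ξ = P.tl J j k m ko x ξ + (AA J j k (P.klo ko ((j:ℝ) / J) x m) ξ + AA J j k (P.khi ko x) ξ) +
      P.cl J j k ko x ξ := by
  by_cases h : |ξ| ≤ ko
  · rw [AA_low P hj hm hk hkJ hν hLν hx k ξ h, Stg.cl, if_neg (not_lt.2 h)]
    have : AA J j k (P.khi ko x) ξ = 0 := by
      unfold AA; simp [Stg.khi, not_lt.2 h]
    rw [this, Stg.tl]; ring
  · rw [AA_hi P hj hk hν hx k ξ (not_le.1 h)]
    have ho : AA J j k (P.klo ko ((j:ℝ) / J) x m) ξ = 0 := by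
      unfold AA; simp [Stg.klo, h]
    have hO : P.tl J j k m ko x ξ = 0 := by
      unfold Stg.tl; simp [hlf, h]
    rw [ho, hO]; ring

lemma cl_norm (P : Stg) {J j k : ℕ} (hJ : 0 < J) (hk : k ≠ 0) {x : ℝ} (hx : x ∈ I₁) (ko : ℝ) :
    MemLp (P.cl J j k ko x) 2 volume ∧
    ‖toF (P.cl J j k ko x)‖ ≤ √(2 * π) * P.c x * (π * k * J) ^ (-P.s x) * (1 + √(2 * (∫ ξ, Wf 1 P.sz ξ ^ 2) / k)) := by
  have hd := ddf_main (lt_of_lt_of_le P.hso (P.hs x hx).1) (P.hs x hx).2 P.hsz J j k hJ hk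
  set κ : ℝ := √(2 * π) * P.c x * (π * k * J) ^ (-P.s x)
  have hκ : 0 ≤ κ := by have := (P.hc x hx).1; positivity
  have hfull : MemLp (fun ξ => (κ : ℂ) * (phf J j k ξ + ddf (P.s x) J j k ξ)) 2 volume :=
    ((phf_memLp J j k).add hd.1).const_mul _
  have he : P.cl J j k ko x = {ξ | ko < |ξ|}.indicator (fun ξ => (κ : ℂ) * (phf J j k ξ + ddf (P.s x) J j k ξ)) := by
    ext ξ
    simp only [Stg.cl, indicator, mem_ofPred_eq]
    split_ifs
    · exact AA_Kb' J j k hJ hk _ _ _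
    · rfl
  have hS : MeasurableSet {ξ : ℝ | ko < |ξ|} := measurableSet_lt measurable_const (by fun_prop)
  have hm : MemLp (P.cl J j k ko x) 2 volume := by rw [he]; exact hfull.indicator hS
  refine ⟨hm, (toF_le hm hfull (ae_of_all _ fun ξ => ?_)).trans ?_⟩
  · rw [he]; exact norm_indicator_le_norm_self _ _
  · have mb := memLp_add' (phf_memLp J j k) hd.1
    rw [toF_smul κ mb, norm_smul, norm_eq_abs, abs_of_nonneg hκ]
    gcongr
    rw [toF_add (phf_memLp J j k) hd.1]
    refine (norm_add_le _ _).trans (add_le_add ?_ (le_sqrt_of_sq_le hd.2))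
    exact ((phf_orthonormal J hJ id Function.injective_id).1 (j, k)).le

def T1c (P : Stg) (J m : ℕ) (ν ko : ℝ) : ℝ := ∫ ξ, (P.M * elo P J m ν ko * ko * Wf (P.so - ν) (P.sz + ν) ξ) ^ 2
def T2c (P : Stg) (J : ℕ) (ν ko : ℝ) : ℝ :=
  ∫ ξ, whi ko (P.so - ν) (2 * P.L * (1 / (J:ℝ)) ^ P.r * (1 + P.M / ν)) ξ ^ 2
def T0c (P : Stg) : ℝ := ∫ ξ, (2 * P.M * Wf P.so P.sz ξ) ^ 2

lemma Wc_int {so sz : ℝ} (h0 : 1/2 < so) (ho : sz < 3/2) (c : ℝ) : Integrable (fun ξ => (c * Wf so sz ξ) ^ 2) := by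
  simp only [mul_pow]; exact (Wf_sq_int h0 ho).const_mul _

lemma par (F : Type*) [NormedAddCommGroup F] [InnerProductSpace ℝ F] (a b : F) :
    ‖a + b‖ ^ 2 ≤ 2 * ‖a‖ ^ 2 + 2 * ‖b‖ ^ 2 := by
  have ho := norm_add_le a b
  have hO : ‖a + b‖ ^ 2 ≤ (‖a‖ + ‖b‖) ^ 2 := by gcongr
  nlinarith [sq_nonneg (‖a‖ - ‖b‖)]

theorem upper_fin (P : Stg) {J K m kz : ℕ} (hJ : 0 < J) (hm : 1 ≤ m) (hkz : 1 ≤ kz) {ko ν : ℝ} (hk : 1 ≤ ko) (hkJ : ko ≤ J)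
    (hν : 0 < ν) (hLν : P.L * (1 / (J:ℝ)) ^ P.r ≤ ν / 2) (hso : 1/2 < P.so - ν) (hsz : P.sz + ν < 3/2)
    (x : ℕ → ℝ) (hx : ∀ j < J, x j ∈ blk J j) {g η : ℝ} (hg : 0 ≤ g) (hη : 0 < η) :
    ld (g • Matrix.gram ℝ (fun l : Fin J × Fin K => toF (AA J l.1 l.2 P.K))) ≤
      (J * kz + J * (m * m)) * log (1 + g * (2 * (1 + 1 / η)) * (2 * T0c P + 2 * T1c P J m ν ko)) +
      g * (2 * (1 + 1 / η)) * (2 * T1c P J m ν ko + 2 * T2c P J ν ko) +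
      ∑ l : Fin J × Fin K, if kz ≤ (l.2 : ℕ) then log (1 + g * (1 + η) *
        (√(2 * π) * P.c (x l.1) * (π * (l.2 : ℕ) * J) ^ (-P.s (x l.1)) * (1 + √(2 * (∫ ξ, Wf 1 P.sz ξ ^ 2) / kz))) ^ 2) else 0 := by
  classical
  set p : Fin J × Fin K → ℕ × ℕ := fun l => (l.1, l.2) with hpdef
  have hp : Function.Injective p := by
    rintro ⟨a, b⟩ ⟨c, d⟩ h
    simp only [hpdef, Prod.mk.injEq] at h
    ext <;> simp [h.1, h.2]
  have hpJ : ∀ l, (p l).1 < J := fun l => l.1.2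
  have ib := Wc_int P.hso P.hsz (2 * P.M)
  have iz := Wc_int hso hsz (P.M * elo P J m ν ko * ko)
  have io := (whi_int (lt_of_lt_of_le one_pos hk) hso (2 * P.L * (1 / (J:ℝ)) ^ P.r * (1 + P.M / ν))).1
  have Bo := AA_bessel J hJ p hp hpJ (fun _ => P.K) _ (fun j hj => P.gk hj) ib
  have B1 := AA_bessel J hJ p hp hpJ (fun j => P.klo ko ((j:ℝ)/J) (x j) m) _ (fun j hj => P.klo_gk hj hm hk hkJ hν hLν (hx j hj)) iz
  have Bz := AA_bessel J hJ p hp hpJ (fun j => P.khi ko (x j)) _ (fun j hj => P.khi_gk hj hk hν (hx j hj)) io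
  have mo : ∀ l, MemLp (AA J (p l).1 (p l).2 P.K) 2 volume := fun l => (P.gk (hpJ l)).memLp hJ ib _
  have mz : ∀ l, MemLp (AA J (p l).1 (p l).2 (P.klo ko (((p l).1:ℝ)/J) (x (p l).1) m)) 2 volume :=
    fun l => (P.klo_gk (hpJ l) hm hk hkJ hν hLν (hx _ (hpJ l))).memLp hJ iz _
  have ma : ∀ l, MemLp (AA J (p l).1 (p l).2 (P.khi ko (x (p l).1))) 2 volume :=
    fun l => (P.khi_gk (hpJ l) hk hν (hx _ (hpJ l))).memLp hJ io _
  have hxI : ∀ j < J, x j ∈ I₁ := fun j hj => blk_Icc hj (hx j hj)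
  have hmh : ∀ j < J, ∀ α b, MemLp (hlf ((j:ℝ)/J) (P.s (x j)) ko α b) 2 volume := by
    intro j hj α b
    have hj' : (j:ℝ) < J := mod_cast hj
    have hJ' : (0:ℝ) < J := mod_cast hJ
    refine hlf_memLp (P.hs _ (hxI j hj)).1 (P.hs _ (hxI j hj)).2 (by linarith [P.hso, (P.hs _ (hxI j hj)).1]) hk hν hso hsz ⟨by positivity, ?_⟩ α b
    rw [div_le_one hJ']; exact hj'.le
  have hte : ∀ l, toF (P.tl J (p l).1 (p l).2 m ko (x (p l).1)) = ∑ α ∈ Finset.range m, ∑ b ∈ Finset.range m,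
      (∫ y, cb J (p l).1 (p l).2 y * P.wtf (((p l).1:ℝ)/J) (x (p l).1) α b y) • toF (hlf (((p l).1:ℝ)/J) (P.s (x (p l).1)) ko α b) := by
    intro l
    unfold Stg.tl
    rw [toF_sum _ _ fun α _ => memLp_finsetSum _ fun b _ => (hmh _ (hpJ l) α b).const_mul _]
    refine sum_congr rfl fun α _ => ?_
    rw [toF_sum _ _ fun b _ => (hmh _ (hpJ l) α b).const_mul _]
    exact sum_congr rfl fun b _ => toF_smul _ (hmh _ (hpJ l) α b)
  have mt : ∀ l, MemLp (P.tl J (p l).1 (p l).2 m ko (x (p l).1)) 2 volume := fun l => by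
    unfold Stg.tl
    exact memLp_finsetSum _ fun α _ => memLp_finsetSum _ fun b _ => (hmh _ (hpJ l) α b).const_mul _
  set a : Fin J × Fin K → FF := fun l => toF (AA J (p l).1 (p l).2 P.K) with ha
  set bo : Fin J × Fin K → FF := fun l => toF (AA J (p l).1 (p l).2 (P.klo ko (((p l).1:ℝ)/J) (x (p l).1) m)) with hbz
  set bz : Fin J × Fin K → FF := fun l => toF (AA J (p l).1 (p l).2 (P.khi ko (x (p l).1))) with hb2
  set tz : Fin J × Fin K → FF := fun l => toF (P.tl J (p l).1 (p l).2 m ko (x (p l).1)) with hto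
  set co : Fin J × Fin K → FF := fun l => toF (P.cl J (p l).1 (p l).2 ko (x (p l).1)) with hc0
  have htn : ∀ l, ‖tz l‖ ^ 2 ≤ 2 * ‖a l‖ ^ 2 + 2 * ‖bo l‖ ^ 2 := by
    intro l
    have ho : ‖tz l‖ ≤ ‖a l + (-1:ℝ) • bo l‖ := by
      rw [neg_one_smul, ← sub_eq_add_neg, ha, hbz]; dsimp only
      rw [← toF_sub (mo l) (mz l)]
      refine toF_le (mt l) ((mo l).sub (mz l)) (ae_of_all _ fun ξ => ?_)
      by_cases h : |ξ| ≤ ko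
      · rw [AA_low P (hpJ l) hm hk hkJ hν hLν (hx _ (hpJ l)) _ ξ h, add_sub_cancel_right]; rfl
      · have hO : P.tl J (p l).1 (p l).2 m ko (x (p l).1) ξ = 0 := by unfold Stg.tl; simp [hlf, h]
        rw [hO, norm_zero]; exact norm_nonneg _
    have hO := par FF (a l) ((-1:ℝ) • bo l)
    rw [norm_smul] at hO
    norm_num at hO
    have h3 : ‖tz l‖ ^ 2 ≤ ‖a l + (-1:ℝ) • bo l‖ ^ 2 := by gcongr
    norm_num at h3
    linarith
  have hcm : ∀ l : Fin J × Fin K, kz ≤ (l.2:ℕ) → MemLp (P.cl J (p l).1 (p l).2 ko (x (p l).1)) 2 volume := fun l h =>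
    (cl_norm P hJ (by simp only [hpdef]; omega) (hxI _ (hpJ l)) ko).1
  have hdec : ∀ l : Fin J × Fin K, kz ≤ (l.2:ℕ) → a l = tz l + (bo l + bz l) + co l := by
    intro l h
    simp only [ha, hbz, hb2, hto, hc0]
    have m12 := memLp_add' (mz l) (ma l)
    have mb := memLp_add' (mt l) m12
    rw [← toF_add (mz l) (ma l), ← toF_add (mt l) m12, ← toF_add mb (hcm l h)]
    congr 1; ext ξ
    exact AA_dec P (hpJ l) hm hk hkJ hν hLν (hx _ (hpJ l)) _ ξ
  set f : (Fin J × Fin kz) ⊕ (Fin J × (Fin m × Fin m)) → FF := Sum.elim (fun q => toF (AA J q.1 q.2 P.K))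
    (fun q => toF (hlf (((q.1:ℕ):ℝ)/J) (P.s (x q.1)) ko q.2.1 q.2.2)) with hf
  set t : Fin J × Fin K → FF := fun l => if kz ≤ (l.2:ℕ) then tz l else a l with ht
  have hspan : ∀ l, ∃ w : (Fin J × Fin kz) ⊕ (Fin J × (Fin m × Fin m)) → ℝ, ∑ q, w q • f q = t l := by
    intro l
    rw [← Submodule.mem_span_range_iff_exists_fun]
    simp only [ht]
    split_ifs with h
    · rw [hto]; dsimp only
      rw [hte]
      refine Submodule.sum_mem _ fun α hα => Submodule.sum_mem _ fun b hb => Submodule.smul_mem _ _ (Submodule.subset_span ?_)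
      exact ⟨Sum.inr (l.1, (⟨α, Finset.mem_range.1 hα⟩, ⟨b, Finset.mem_range.1 hb⟩)), rfl⟩
    · exact Submodule.subset_span ⟨Sum.inl (l.1, ⟨l.2, not_le.1 h⟩), rfl⟩
  choose w hw using hspan
  have main := gram_upper a t (fun l => if kz ≤ (l.2:ℕ) then bo l + bz l else 0)
    (fun l => if kz ≤ (l.2:ℕ) then co l else 0)
    (fun l => by
      simp only [ht]
      split_ifs with h
      · exact hdec l h
      · simp) w f (fun l => (hw l).symm) hg hη
  refine main.trans (add_le_add (add_le_add ?_ ?_) (sum_le_sum fun l _ => ?_))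
  · have hc : (Fintype.card ((Fin J × Fin kz) ⊕ (Fin J × (Fin m × Fin m))) : ℝ) = J * kz + J * (m * m) := by
      simp [Fintype.card_sum, Fintype.card_prod]
    rw [hc]
    have hT : ∑ l, ‖t l‖ ^ 2 ≤ 2 * T0c P + 2 * T1c P J m ν ko := by
      calc _ ≤ ∑ l, (2 * ‖a l‖ ^ 2 + 2 * ‖bo l‖ ^ 2) := by
            refine sum_le_sum fun l _ => ?_
            simp only [ht]
            split_ifs with h
            · exact htn l
            · nlinarith [sq_nonneg ‖a l‖, sq_nonneg ‖bo l‖]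
        _ = 2 * ∑ l, ‖a l‖ ^ 2 + 2 * ∑ l, ‖bo l‖ ^ 2 := by
            rw [sum_add_distrib, mul_sum, mul_sum]
        _ ≤ _ := by unfold T0c T1c; gcongr
    have h0 : 0 ≤ ∑ l, ‖t l‖ ^ 2 := sum_nonneg fun l _ => sq_nonneg _
    gcongr
  · gcongr
    calc _ ≤ ∑ l, (2 * ‖bo l‖ ^ 2 + 2 * ‖bz l‖ ^ 2) := by
          refine sum_le_sum fun l _ => ?_
          split_ifs with h
          · exact par FF _ _
          · rw [norm_zero]; nlinarith [sq_nonneg ‖bo l‖, sq_nonneg ‖bz l‖]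
      _ = 2 * ∑ l, ‖bo l‖ ^ 2 + 2 * ∑ l, ‖bz l‖ ^ 2 := by
          rw [sum_add_distrib, mul_sum, mul_sum]
      _ ≤ _ := by unfold T1c T2c; gcongr
  · split_ifs with h
    swap
    · simp
    have hk1' : (0:ℝ) < kz := mod_cast hkz
    have hk2 : (kz:ℝ) ≤ (l.2:ℕ) := mod_cast h
    have ho := (cl_norm P (j := l.1) (k := l.2) hJ (by omega) (hxI _ (hpJ l)) ko).2
    have hc := (P.hc _ (hxI _ (hpJ l))).1
    have hW : 0 ≤ ∫ ξ, Wf 1 P.sz ξ ^ 2 := integral_nonneg fun _ => sq_nonneg _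
    have hO : ‖co l‖ ≤ √(2 * π) * P.c (x l.1) * (π * (l.2 : ℕ) * J) ^ (-P.s (x l.1)) * (1 + √(2 * (∫ ξ, Wf 1 P.sz ξ ^ 2) / kz)) := by
      refine ho.trans ?_
      simp only [hpdef] at hc ⊢
      gcongr
    gcongr
end u1

section d1

lemma inner_exp {t q : ℝ} (ht : 0 < t) (hq : 1 < q) :
    ∫⁻ u in Ioi (0:ℝ), ENNReal.ofReal (1 / (u ^ q + t)) =
      ENNReal.ofReal (π / q / sin (π / q) * t ^ (1 / q - 1)) := by
  have hqo : 0 < q := by linarith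
  have hpa : 1 / q < 1 := by rw [div_lt_one hqo]; exact hq
  have hpo : 0 < 1 / q := by positivity
  have eo : ∀ u ∈ Ioi (0:ℝ), ENNReal.ofReal (1 / (u ^ q + t)) =
      ∫⁻ v in Ioi (0:ℝ), ENNReal.ofReal (exp (-(u ^ q + t) * v)) := by
    intro u hu
    have hu' : 0 < u := hu
    have hb : 0 < u ^ q + t := by positivity
    rw [← ofReal_integral_eq_lintegral_ofReal (integrableOn_exp_mul_Ioi (neg_neg_of_pos hb) 0)
      (ae_of_all _ fun _ => (exp_pos _).le), integral_exp_mul_Ioi (neg_neg_of_pos hb) 0]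
    congr 1; rw [mul_zero, exp_zero, neg_div_neg_eq]
  rw [setLIntegral_congr_fun measurableSet_Ioi eo, lintegral_lintegral_swap (by fun_prop)]
  have ez : ∀ v ∈ Ioi (0:ℝ), ∫⁻ u in Ioi (0:ℝ), ENNReal.ofReal (exp (-(u ^ q + t) * v)) =
      ENNReal.ofReal (Gamma (1 / q + 1) * (v ^ (1 - 1 / q - 1) * exp (-(t * v)))) := by
    intro v hv
    have hv' : 0 < v := hv
    have hi : IntegrableOn (fun u : ℝ => exp (-v * u ^ q)) (Ioi 0) := by
      have := integrableOn_rpow_mul_exp_neg_mul_rpow (p := q) (s := 0) (b := v) (by norm_num) hqo hv'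
      simpa using this
    have ho : ∀ u : ℝ, exp (-(u ^ q + t) * v) = exp (-v * u ^ q) * exp (-(t * v)) := by
      intro u; rw [← exp_add]; congr 1; ring
    simp_rw [ho]
    rw [← ofReal_integral_eq_lintegral_ofReal (hi.mul_const _) (ae_of_all _ fun _ => by positivity), integral_mul_const,
      integral_exp_neg_mul_rpow hqo hv']
    congr 1
    rw [show (1 - 1 / q - 1 : ℝ) = -1 / q by ring]; ring
  rw [setLIntegral_congr_fun measurableSet_Ioi ez]
  have hi : IntegrableOn (fun v : ℝ => v ^ (1 - 1 / q - 1) * exp (-(t * v))) (Ioi 0) := by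
    have := integrableOn_rpow_mul_exp_neg_mul_rpow (p := 1) (s := 1 - 1 / q - 1) (b := t) (by linarith) one_pos ht
    simpa using this
  have hG : 0 < Gamma (1 / q + 1) := Gamma_pos_of_pos ps
  rw [← ofReal_integral_eq_lintegral_ofReal (hi.const_mul _), integral_const_mul,
    integral_rpow_mul_exp_neg_mul_Ioi (by linarith) ht, Gamma_add_one hpo.ne']
  · congr 1
    have := Gamma_mul_Gamma_one_sub (1 / q)
    rw [show π / q = π * (1 / q) by ring]
    calc _ = 1 / q * (Gamma (1 / q) * Gamma (1 - 1 / q)) * (1 / t) ^ (1 - 1 / q) := by ring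
      _ = _ := by
        rw [this, one_div t, inv_rpow ht.le, ← rpow_neg ht.le, neg_sub]; ring
  · filter_upwards [ae_restrict_mem measurableSet_Ioi] with v hv
    have hv' : 0 < v := hv
    positivity

lemma log_lint {G q : ℝ} (hG : 0 < G) (hq : 1 < q) :
    ∫⁻ u in Ioi (0:ℝ), ENNReal.ofReal (log (1 + G * u ^ (-q))) =
      ENNReal.ofReal (G ^ (1 / q) * (π / sin (π / q))) := by
  have hqo : 0 < q := by linarith
  have hpo : 0 < 1 / q := by positivity
  have hpa : 1 / q < 1 := by rw [div_lt_one hqo]; exact hq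
  have hsin : 0 < sin (π / q) := sin_pos_of_pos_of_lt_pi ps (by
    rw [div_lt_iff₀ hqo]; nlinarith [pi_pos])
  have eo : ∀ u ∈ Ioi (0:ℝ), ENNReal.ofReal (log (1 + G * u ^ (-q))) =
      ∫⁻ t in Ioc (0:ℝ) G, ENNReal.ofReal (1 / (u ^ q + t)) := by
    intro u hu
    have hu' : 0 < u := hu
    have hb : 0 < u ^ q := by positivity
    have hc : ContinuousOn (fun t : ℝ => 1 / (u ^ q + t)) (uIcc 0 G) := by
      refine continuousOn_const.div (by fun_prop) fun t ht => ?_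
      rw [uIcc_of_le hG.le] at ht
      have := ht.1; positivity
    have hint : IntervalIntegrable _ volume _ _ := hc.intervalIntegrable
    rw [← ofReal_integral_eq_lintegral_ofReal ((intervalIntegrable_iff_integrableOn_Ioc_of_le hG.le).1 hint),
      ← intervalIntegral.integral_of_le hG.le, intervalIntegral.integral_eq_sub_of_hasDerivAt (f := fun t => log (u ^ q + t))
        _ hint]
    · congr 1
      rw [add_zero, ← log_div ps ps, rpow_neg hu'.le]
      congr 1; field_simp
    · intro t ht
      rw [uIcc_of_le hG.le] at ht
      have := ht.1
      exact ((hasDerivAt_id t).const_add (u ^ q)).log (by simp only [id]; positivity)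
    · filter_upwards [ae_restrict_mem measurableSet_Ioc] with t ht
      have := ht.1; positivity
  rw [setLIntegral_congr_fun measurableSet_Ioi eo, lintegral_lintegral_swap (by fun_prop),
    setLIntegral_congr_fun measurableSet_Ioc (fun t ht => inner_exp ht.1 hq)]
  have hint : IntervalIntegrable (fun t : ℝ => t ^ (1 / q - 1)) volume 0 G := intervalIntegral.intervalIntegrable_rpow' (by linarith)
  rw [← ofReal_integral_eq_lintegral_ofReal (((intervalIntegrable_iff_integrableOn_Ioc_of_le hG.le).1 hint).const_mul _),
    integral_const_mul, ← intervalIntegral.integral_of_le hG.le, integral_rpow (Or.inl (by linarith))]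
  · congr 1
    rw [show 1 / q - 1 + 1 = 1 / q by ring, zero_rpow hpo.ne']
    field_simp; simp
  · filter_upwards [ae_restrict_mem measurableSet_Ioc] with t ht
    have := ht.1; positivity

lemma log_int {G q : ℝ} (hG : 0 < G) (hq : 1 < q) :
    IntegrableOn (fun u => log (1 + G * u ^ (-q))) (Ioi 0) ∧
    ∫ u in Ioi (0:ℝ), log (1 + G * u ^ (-q)) = G ^ (1 / q) * (π / sin (π / q)) := by
  have h := log_lint hG hq
  have hsin : 0 < sin (π / q) := sin_pos_of_pos_of_lt_pi ps (by
    rw [div_lt_iff₀ (by linarith)]; nlinarith [pi_pos])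
  have hn : 0 ≤ᵐ[volume.restrict (Ioi 0)] fun u : ℝ => log (1 + G * u ^ (-q)) := by
    filter_upwards [ae_restrict_mem measurableSet_Ioi] with u hu
    have hu' : 0 < u := hu
    have : 0 < u ^ (-q) := by positivity
    exact log_nonneg (by nlinarith)
  have hm : AEStronglyMeasurable (fun u : ℝ => log (1 + G * u ^ (-q))) (volume.restrict (Ioi 0)) :=
    Measurable.aestronglyMeasurable (by fun_prop)
  refine ⟨⟨hm, ?_⟩, ?_⟩
  · rw [hasFiniteIntegral_iff_ofReal hn, h]; exact ENNReal.ofReal_lt_top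
  · rw [integral_eq_lintegral_of_nonneg_ae hn hm, h, ENNReal.toReal_ofReal ps]

lemma log_anti {G q : ℝ} (hG : 0 ≤ G) (hq : 0 < q) : AntitoneOn (fun u : ℝ => log (1 + G * u ^ (-q))) (Ioi 0) := by
  intro u hu v hv huv
  have hu' : 0 < u := hu
  have hv' : 0 < v := hv
  have : v ^ (-q) ≤ u ^ (-q) := rpow_le_rpow_of_nonpos hu' huv (by linarith)
  dsimp only
  gcongr

lemma sum_block_le {G q : ℝ} (hG : 0 < G) (hq : 1 < q) (J K kz : ℕ) (hJ : 0 < J) (hkz : 1 ≤ kz) :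
    ∑ k : Fin K, (if kz ≤ (k:ℕ) then log (1 + G * (π * (k:ℕ) * J) ^ (-q)) else 0) ≤
      G ^ (1 / q) / sin (π / q) / J := by
  have hJ' : (0:ℝ) < J := mod_cast hJ
  set G' : ℝ := G * (π * J) ^ (-q) with hG'
  have hG'0 : 0 < G' := by positivity
  have hI := log_int hG'0 hq
  have hval : G' ^ (1 / q) * (π / sin (π / q)) = G ^ (1 / q) / sin (π / q) / J := by
    rw [hG', mul_rpow hG.le ps, ← rpow_mul ps,
      show -q * (1 / q) = -1 by field_simp, rpow_neg_one]
    field_simp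
  rw [← hval, ← hI.2]
  have hnn : ∀ u ∈ Ioi (0:ℝ), 0 ≤ log (1 + G' * u ^ (-q)) := fun u hu => by
    have hu' : 0 < u := hu
    have : 0 < u ^ (-q) := by positivity
    exact log_nonneg (by nlinarith)
  have hterm : ∀ k : ℕ, 1 ≤ k → log (1 + G * (π * k * J) ^ (-q)) ≤ ∫ u in Ioc ((k:ℝ) - 1) k, log (1 + G' * u ^ (-q)) := by
    intro k hk
    have hk' : (1:ℝ) ≤ k := mod_cast hk
    have e : G * (π * k * J) ^ (-q) = G' * (k:ℝ) ^ (-q) := by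
      rw [hG', mul_assoc G, ← mul_rpow ps ps]; congr 2; ring
    rw [e]
    have ho : ∫ u in Ioc ((k:ℝ) - 1) k, log (1 + G' * (k:ℝ) ^ (-q)) = log (1 + G' * (k:ℝ) ^ (-q)) := by
      simp
    rw [← ho]
    refine setIntegral_mono_on (by simp) (hI.1.mono_set fun u hu => ?_) measurableSet_Ioc fun u hu => ?_
    · have := hu.1; simp only [mem_Ioi]; linarith
    · have h0 : 0 < u := by linarith [hu.1]
      exact log_anti hG'0.le (by linarith) h0 (by simp only [mem_Ioi]; linarith) hu.2
  have hsum : ∀ n : ℕ, ∑ k ∈ Finset.range n, (if kz ≤ k then log (1 + G * (π * k * J) ^ (-q)) else 0) ≤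
      ∫ u in Ioc (0:ℝ) ((n:ℝ) - 1), log (1 + G' * u ^ (-q)) := by
    intro n
    induction n with
    | zero => simp
    | succ n ih =>
      rw [Finset.sum_range_succ]
      rcases Nat.eq_zero_or_pos n with rfl | hn
      · rw [if_neg (by omega)]; simp
      have hn' : (1:ℝ) ≤ n := mod_cast hn
      have hsp : ∫ u in Ioc (0:ℝ) (((n+1 : ℕ):ℝ) - 1), log (1 + G' * u ^ (-q)) =
          (∫ u in Ioc (0:ℝ) ((n:ℝ) - 1), log (1 + G' * u ^ (-q))) + ∫ u in Ioc ((n:ℝ) - 1) n, log (1 + G' * u ^ (-q)) := by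
        rw [← setIntegral_union (by
            rw [Set.disjoint_left]; intro u hu hu'; exact absurd hu.2 (not_le.2 hu'.1)) measurableSet_Ioc
          (hI.1.mono_set fun u hu => hu.1) (hI.1.mono_set fun u hu => by
            have := hu.1; simp only [mem_Ioi]; linarith)]
        congr 2
        rw [Ioc_union_Ioc_eq_Ioc (by linarith) (by linarith)]
        push_cast; ring_nf
      rw [hsp]
      refine add_le_add ih ?_
      split_ifs with h
      · exact hterm n hn
      · refine setIntegral_nonneg measurableSet_Ioc fun u hu => hnn u ?_
        have := hu.1; simp only [mem_Ioi]; linarith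
  have ho := hsum K
  rw [← Fin.sum_univ_eq_sum_range (fun k => if kz ≤ k then log (1 + G * (π * k * J) ^ (-q)) else 0)] at ho
  refine ho.trans (setIntegral_mono_set hI.1 ?_ (ae_of_all _ fun u hu => hu.1))
  filter_upwards [ae_restrict_mem measurableSet_Ioi] with u hu
  exact hnn u hu
end d1

section u2

def JN (P : Stg) (N : ℝ) : ℕ := ⌈N ^ (1 - P.r / 8)⌉₊
def k0N (P : Stg) (N : ℝ) : ℝ := N ^ (1 - P.r / 4)
def mP (P : Stg) : ℕ := ⌈24 / P.r⌉₊ + 1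
def νP (P : Stg) : ℝ := min (P.r / 8) (min ((3/2 - P.sz) / 2) ((P.so - 1/2) / 2))

lemma νP_spec (P : Stg) : 0 < νP P ∧ νP P ≤ P.r / 8 ∧ 1/2 < P.so - νP P ∧ P.sz + νP P < 3/2 := by
  have ho := P.hr; have hO := P.hso; have h3 := P.hsz
  have ao : νP P ≤ P.r / 8 := min_le_left _ _
  have az : νP P ≤ (3/2 - P.sz) / 2 := (min_le_right _ _).trans (min_le_left _ _)
  have aa : νP P ≤ (P.so - 1/2) / 2 := (min_le_right _ _).trans (min_le_right _ _)
  refine ⟨lt_min (by linarith) (lt_min (by linarith) (by linarith)), ao, by linarith, by linarith⟩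

lemma JN_bd (P : Stg) {N : ℝ} (hN : 1 ≤ N) : N ^ (1 - P.r / 8) ≤ JN P N ∧ (JN P N : ℝ) ≤ 2 * N ^ (1 - P.r / 8) ∧ 0 < JN P N := by
  have h0 : 1 ≤ N ^ (1 - P.r / 8) := one_le_rpow hN (by linarith [P.hro])
  have ho : N ^ (1 - P.r / 8) ≤ JN P N := Nat.le_ceil _
  refine ⟨ho, ?_, ?_⟩
  · have := (Nat.ceil_lt_add_one (by linarith : 0 ≤ N ^ (1 - P.r / 8))).le
    unfold JN; linarith
  · have : (0:ℝ) < JN P N := by linarith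
    exact_mod_cast this

lemma k0N_bd (P : Stg) {N : ℝ} (hN : 1 ≤ N) : 1 ≤ k0N P N ∧ k0N P N ≤ N ∧ k0N P N / JN P N ≤ N ^ (-(P.r / 8)) := by
  have hNo : 0 < N := by linarith
  have hr := P.hr; have hro := P.hro
  refine ⟨one_le_rpow hN (by linarith), ?_, ?_⟩
  · calc k0N P N ≤ N ^ (1:ℝ) := rpow_le_rpow_of_exponent_le hN (by linarith)
      _ = N := rpow_one N
  · have h := JN_bd P hN
    rw [div_le_iff₀ (mod_cast h.2.2)]
    calc k0N P N = N ^ (-(P.r / 8)) * N ^ (1 - P.r / 8) := by rw [k0N, ← rpow_add hNo]; congr 1; ring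
      _ ≤ _ := by gcongr; exact h.1

lemma Jr_bd (P : Stg) {N : ℝ} (hN : 1 ≤ N) : (1 / (JN P N : ℝ)) ^ P.r ≤ N ^ (-(P.r * (1 - P.r / 8))) := by
  have hNo : 0 < N := by linarith
  have h := JN_bd P hN
  have hp : 0 < N ^ (1 - P.r / 8) := by positivity
  calc (1 / (JN P N : ℝ)) ^ P.r ≤ (1 / N ^ (1 - P.r / 8)) ^ P.r := by
        have := h.1
        have := P.hr
        gcongr
    _ = _ := by
        rw [one_div, ← rpow_neg hNo.le, ← rpow_mul hNo.le]; congr 1; ring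

lemma elo_nonneg (P : Stg) (J m : ℕ) {ν ko : ℝ} (hν : 0 < ν) (hk : 0 ≤ ko) : 0 ≤ elo P J m ν ko := by
  have := P.hL; unfold elo; positivity

lemma elo_bd (P : Stg) : ∃ C, 0 ≤ C ∧ ∀ N, 1 ≤ N → elo P (JN P N) (mP P) (νP P) (k0N P N) ≤ C * N ^ (-3 : ℝ) := by
  have hν := (νP_spec P).1
  have hL := P.hL; have hr := P.hr; have hro := P.hro
  have hm : 24 / P.r ≤ (mP P : ℝ) - 1 := by
    unfold mP; push_cast; linarith [Nat.le_ceil (24 / P.r)]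
  have hmz : ((mP P - 1 : ℕ) : ℝ) = (mP P : ℝ) - 1 := by unfold mP; push_cast; simp
  rw [div_le_iff₀ hr] at hm
  refine ⟨(mP P).factorial * (2 * P.L / νP P) ^ (mP P) + 3, by positivity, fun N hN => ?_⟩
  have hNo : 0 < N := by linarith
  have hk := k0N_bd P hN
  have hJ := JN_bd P hN
  have hJo : (0:ℝ) < JN P N := mod_cast hJ.2.2
  have ho : ((1 / (JN P N : ℝ)) ^ P.r) ^ (mP P) ≤ N ^ (-3 : ℝ) := by
    calc _ ≤ (N ^ (-(P.r * (1 - P.r / 8)))) ^ (mP P) := by gcongr; exact Jr_bd P hN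
      _ = N ^ (-(P.r * (1 - P.r / 8)) * mP P) := by rw [← rpow_natCast, ← rpow_mul hNo.le]
      _ ≤ _ := rpow_le_rpow_of_exponent_le hN (by nlinarith)
  have hO : (k0N P N / JN P N) ^ (mP P - 1) ≤ N ^ (-3 : ℝ) := by
    have : 0 ≤ k0N P N := by linarith [hk.1]
    calc _ ≤ (N ^ (-(P.r / 8))) ^ (mP P - 1) := by gcongr; exact hk.2.2
      _ = N ^ (-(P.r / 8) * ((mP P - 1 : ℕ) : ℝ)) := by rw [← rpow_natCast, ← rpow_mul hNo.le]
      _ ≤ _ := rpow_le_rpow_of_exponent_le hN (by rw [hmz]; nlinarith)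
  unfold elo
  have e : (2 * (P.L * (1 / (JN P N : ℝ)) ^ P.r) / νP P) ^ mP P = (2 * P.L / νP P) ^ (mP P) * ((1 / (JN P N : ℝ)) ^ P.r) ^ (mP P) := by
    rw [← mul_pow]; congr 1; ring
  rw [e]
  calc _ ≤ (mP P).factorial * ((2 * P.L / νP P) ^ (mP P) * N ^ (-3 : ℝ)) + 3 * N ^ (-3 : ℝ) := by gcongr
    _ = _ := by ring

lemma T1_bd (P : Stg) : ∃ C, 0 ≤ C ∧ ∀ N, 1 ≤ N → T1c P (JN P N) (mP P) (νP P) (k0N P N) ≤ C * N ^ (-4 : ℝ) := by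
  obtain ⟨C, hC, h⟩ := elo_bd P
  obtain ⟨hν, -, h0, ho⟩ := νP_spec P
  set W := ∫ ξ, Wf (P.so - νP P) (P.sz + νP P) ξ ^ 2 with hW
  have hWo : 0 ≤ W := integral_nonneg fun _ => sq_nonneg _
  have hM := P.hM
  refine ⟨(P.M * C) ^ 2 * W, by positivity, fun N hN => ?_⟩
  have hNo : 0 < N := by linarith
  have hk := k0N_bd P hN
  have hE := elo_nonneg P (JN P N) (mP P) hν (by linarith : 0 ≤ k0N P N)
  unfold T1c
  simp_rw [mul_pow _ (Wf _ _ _)]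
  rw [integral_const_mul, ← hW]
  have e : N ^ (-4 : ℝ) = (N ^ (-3:ℝ) * N) ^ 2 := by
    rw [← rpow_add_one hNo.ne', ← rpow_natCast, ← rpow_mul hNo.le]; norm_num
  have hko : 0 ≤ k0N P N := by linarith
  calc _ ≤ (P.M * (C * N ^ (-3 : ℝ)) * N) ^ 2 * W := by
        gcongr
        · exact h N hN
        · exact hk.2.1
    _ = _ := by rw [e]; ring

lemma T2_bd (P : Stg) : ∃ C, 0 ≤ C ∧ ∀ N, 1 ≤ N → N ^ (2 * P.so) * T2c P (JN P N) (νP P) (k0N P N) ≤ C * N ^ (1 - P.r) := by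
  obtain ⟨hν, hνr, h0, ho⟩ := νP_spec P
  have hM := P.hM; have hL := P.hL; have hr := P.hr; have hro := P.hro
  set e := P.so - νP P with he
  have h2e : 0 < 2 * e - 1 := by linarith
  refine ⟨(2 * P.L * (1 + P.M / νP P)) ^ 2 * (2 / (2 * e - 1)), by positivity, fun N hN => ?_⟩
  have hNo : 0 < N := by linarith
  have hk := k0N_bd P hN
  unfold T2c
  rw [(whi_int (by linarith) h0 _).2]
  have hJ := Jr_bd P hN
  have eo : k0N P N ^ (1 - 2 * e) = N ^ ((1 - P.r / 4) * (1 - 2 * e)) := by rw [k0N, ← rpow_mul hNo.le]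
  rw [eo]
  have hJo : 0 ≤ (1 / (JN P N:ℝ)) ^ P.r := by positivity
  have key : N ^ (2 * P.so) * (N ^ (-(P.r * (1 - P.r / 8)))) ^ 2 * N ^ ((1 - P.r / 4) * (1 - 2 * e)) ≤ N ^ (1 - P.r) := by
    rw [← rpow_natCast, ← rpow_mul hNo.le, ← rpow_add hNo, ← rpow_add hNo]
    refine rpow_le_rpow_of_exponent_le hN ?_
    push_cast
    have hs := P.hso; have hsz := P.hsz
    have hs01 : P.so ≤ P.sz := (P.hs 0 (by simp)).1.trans (P.hs 0 (by simp)).2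
    have hrr : P.r * P.r ≤ P.r := by nlinarith
    rw [he]
    nlinarith [mul_pos hr hν, mul_pos hr (by linarith : 0 < 3/2 - P.so)]
  calc _ ≤ N ^ (2 * P.so) * ((2 * P.L * N ^ (-(P.r * (1 - P.r / 8))) * (1 + P.M / νP P)) ^ 2 * (2 * N ^ ((1 - P.r / 4) * (1 - 2 * e)) / (2 * e - 1))) := by gcongr
    _ = (2 * P.L * (1 + P.M / νP P)) ^ 2 * (2 / (2 * e - 1)) * (N ^ (2 * P.so) * (N ^ (-(P.r * (1 - P.r / 8)))) ^ 2 * N ^ ((1 - P.r / 4) * (1 - 2 * e))) := by ring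
    _ ≤ _ := by gcongr

lemma L_ev (P : Stg) : ∀ᶠ N : ℝ in atTop, P.L * (1 / (JN P N : ℝ)) ^ P.r ≤ νP P / 2 := by
  have hν := (νP_spec P).1
  have hL := P.hL; have hr := P.hr; have hro := P.hro
  have ho : Tendsto (fun N : ℝ => P.L * N ^ (-(P.r * (1 - P.r / 8)))) atTop (nhds (P.L * 0)) :=
    (tendsto_rpow_neg_atTop (by nlinarith)).const_mul _
  rw [mul_zero] at ho
  filter_upwards [ho.eventually (ge_mem_nhds (by linarith : 0 < νP P / 2)), eventually_ge_atTop 1] with N h hN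
  exact le_trans (by gcongr; exact Jr_bd P hN) h
end u2

section u3

lemma sum_blk (J : ℕ) (hJ : 0 < J) (f : ℝ → ℝ) (hf : IntegrableOn f (Ioc 0 1)) :
    ∑ j ∈ Finset.range J, ∫ x in blk J j, f x = ∫ x in Ioc (0:ℝ) 1, f x := by
  have hJ' : (0:ℝ) < J := mod_cast hJ
  have h := intervalIntegral.sum_integral_adjacent_intervals (f := f) (μ := volume) (a := fun j => (j:ℝ) / J) (n := J) (fun k hk => by
    have hle : ((k:ℕ):ℝ) / J ≤ ((k + 1 : ℕ):ℝ) / J := by gcongr; simp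
    rw [intervalIntegrable_iff_integrableOn_Ioc_of_le hle]
    refine hf.mono_set ?_
    have := blk_sub hk
    rwa [blk, ← Nat.cast_add_one] at this)
  simp only [Nat.cast_zero, zero_div, div_self hJ'.ne'] at h
  rw [← intervalIntegral.integral_of_le zero_le_one, ← h]
  refine sum_congr rfl fun k _ => ?_
  rw [blk, ← Nat.cast_add_one, intervalIntegral.integral_of_le (by gcongr; simp)]

lemma avg_blk (J j : ℕ) (hj : j < J) (f : ℝ → ℝ) (hf : IntegrableOn f (Ioc 0 1)) :
    (∃ x ∈ blk J j, f x / J ≤ ∫ x in blk J j, f x) ∧ (∃ x ∈ blk J j, ∫ x in blk J j, f x ≤ f x / J) := by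
  have hJ' : (0:ℝ) < J := mod_cast (Nat.zero_le j).trans_lt hj
  have ho : volume.real (blk J j) = 1 / J := blk_volr J j
  have hO : volume (blk J j) ≠ 0 := fun h => by
    rw [Measure.real, h] at ho; simp at ho; linarith
  have e : ⨍ a in blk J j, f a = J * ∫ x in blk J j, f x := by
    rw [setAverage_eq, ho]; simp
  constructor
  · obtain ⟨x, hx, h⟩ := exists_le_setAverage hO (blk_vol J j).ne (hf.mono_set (blk_sub hj))
    refine ⟨x, hx, ?_⟩
    rw [e] at h; rw [div_le_iff₀ hJ']; linarith
  · obtain ⟨x, hx, h⟩ := exists_setAverage_le hO (blk_vol J j).ne (hf.mono_set (blk_sub hj))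
    refine ⟨x, hx, ?_⟩
    rw [e] at h; rw [le_div_iff₀ hJ']; linarith

lemma hold_cont {f : ℝ → ℝ} {L r : ℝ} (hr : 0 < r)
    (h : ∀ x ∈ I₁, ∀ y ∈ I₁, |f x - f y| ≤ L * |x - y| ^ r) : ContinuousOn f (Icc 0 1) := by
  intro x hx
  rw [ContinuousWithinAt, tendsto_iff_dist_tendsto_zero]
  have ho : Tendsto (fun y => L * |y - x| ^ r) (nhdsWithin x (Icc 0 1)) (nhds 0) := by
    have : ContinuousAt (fun y => L * |y - x| ^ r) x := by
      refine continuousAt_const.mul (ContinuousAt.rpow_const (by fun_prop) (Or.inr hr.le))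
    have hO := this.tendsto.mono_left (nhdsWithin_le_nhds (s := I₁))
    simpa [zero_rpow hr.ne'] using hO
  refine squeeze_zero' (Eventually.of_forall fun _ => dist_nonneg) ?_ ho
  filter_upwards [self_mem_nhdsWithin] with y hy
  rw [dist_eq]; exact h y hy x hx

lemma sin_pos_of (s : ℝ) (h0 : 1/2 < s) : 0 < sin (π / (2 * s)) :=
  sin_pos_of_pos_of_lt_pi ps (by
    rw [div_lt_iff₀ (by linarith)]; nlinarith [pi_pos])

def Phi (P : Stg) (G x : ℝ) : ℝ := (G * P.c x ^ 2) ^ (1 / (2 * P.s x)) / sin (π / (2 * P.s x))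

lemma Phi_cont (P : Stg) (G : ℝ) : ContinuousOn (Phi P G) (Icc 0 1) := by
  have hs := hold_cont P.hr P.hsH
  have hc := hold_cont P.hr P.hcH
  have h0 : ∀ x ∈ I₁, 1/2 < P.s x := fun x hx => P.hso.trans_le (P.hs x hx).1
  have hO : ∀ x ∈ I₁, 2 * P.s x ≠ 0 := fun x hx => by linarith [h0 x hx]
  unfold Phi
  refine ContinuousOn.div ?_ ?_ fun x hx => (sin_pos_of _ (h0 x hx)).ne'
  · refine ContinuousOn.rpow (by fun_prop) (continuousOn_const.div (by fun_prop) hO) fun x hx => Or.inr ?_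
    have := h0 x hx; positivity
  · exact continuous_sin.comp_continuousOn (continuousOn_const.div (by fun_prop) hO)

lemma Phi_int (P : Stg) (G : ℝ) : IntegrableOn (Phi P G) (Ioc 0 1) :=
  ((Phi_cont P G).integrableOn_Icc).mono_set Ioc_subset_Icc_self

theorem upper_asym (P : Stg) (hcp : ∀ x ∈ I₁, 0 < P.c x) {η : ℝ} (hη : 0 < η) :
    ∃ C, ∀ᶠ N : ℝ in atTop, ∃ J : ℕ, 0 < J ∧ ∀ K : ℕ,
      ld (N ^ (2 * P.so) • Matrix.gram ℝ (fun l : Fin J × Fin K => toF (AA J l.1 l.2 P.K))) ≤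
        C * N ^ (1 - P.r / 16) + ∫ x in Ioc (0:ℝ) 1, Phi P (N ^ (2 * P.so) * (1 + η) ^ 2 * (2 * π)) x := by
  have hr := P.hr; have hro := P.hro
  obtain ⟨Co, hC1, hT1⟩ := T1_bd P
  obtain ⟨Cz, hCz, hTo⟩ := T2_bd P
  obtain ⟨hν, hνr, hso, hsz⟩ := νP_spec P
  set W := ∫ ξ, Wf 1 P.sz ξ ^ 2 with hW
  have hWo : 0 ≤ W := integral_nonneg fun _ => sq_nonneg _
  have hTz : 0 ≤ T0c P := integral_nonneg fun _ => sq_nonneg _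
  obtain ⟨kz, hkz, hk1'⟩ : ∃ kz : ℕ, 1 ≤ kz ∧ (1 + √(2 * W / kz)) ^ 2 ≤ 1 + η := by
    have ho : Tendsto (fun k : ℕ => (1 + √(2 * W / k)) ^ 2) atTop (nhds ((1 + √0) ^ 2)) :=
      ((tendsto_const_div_atTop_nhds_zero_nat _).sqrt.const_add 1).pow 2
    rw [sqrt_zero, add_zero, one_pow] at ho
    obtain ⟨k, hk, hk'⟩ := ((ho.eventually (ge_mem_nhds (by linarith : 1 < 1 + η))).and (eventually_ge_atTop 1)).exists
    exact ⟨k, hk', hk⟩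
  set m := mP P
  set A := 2 * (1 + 1 / η) with hA
  have hAo : 0 < A := by positivity
  set B := 1 + A * (2 * T0c P + 2 * Co) with hB
  have hB1 : 1 ≤ B := by rw [hB]; have : 0 ≤ A * (2 * T0c P + 2 * Co) := by positivity
                         linarith
  set ε := P.r / 80 with hε
  have hε0 : 0 < ε := by positivity
  refine ⟨2 * (kz + m * m) * (B ^ ε / ε) + A * (2 * Co + 2 * Cz), ?_⟩
  filter_upwards [L_ev P, eventually_ge_atTop 1] with N hLN hN
  have hNo : 0 < N := by linarith
  obtain ⟨hJz, hJa, hJo⟩ := JN_bd P hN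
  obtain ⟨hko, hkN, hkJ⟩ := k0N_bd P hN
  have hJr : (0:ℝ) < JN P N := mod_cast hJo
  set J := JN P N with hJd
  refine ⟨J, hJo, fun K => ?_⟩
  set g := N ^ (2 * P.so) with hg
  have hg0 : 0 < g := by positivity
  set Go := g * (1 + η) ^ 2 * (2 * π) with hGo
  have hG00 : 0 < Go := by positivity
  have hx : ∀ j, ∃ x, j < J → x ∈ blk J j ∧ Phi P Go x / J ≤ ∫ x in blk J j, Phi P Go x := by
    intro j
    by_cases hj : j < J
    · obtain ⟨x, ho, hO⟩ := (avg_blk J j hj _ (Phi_int P Go)).1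
      exact ⟨x, fun _ => ⟨ho, hO⟩⟩
    · exact ⟨0, fun h => absurd h hj⟩
  choose x hx using hx
  have hkJ' : k0N P N ≤ J := by
    refine le_trans ?_ hJz
    exact rpow_le_rpow_of_exponent_le hN (by linarith)
  have main := upper_fin P (K := K) (m := m) (kz := kz) hJo (by simp [m, mP]) hkz hko hkJ' hν hLN hso hsz x (fun j hj => (hx j hj).1) hg0.le hη
  have hT1N := hT1 N hN
  have hT2N := hTo N hN
  have hT10 : 0 ≤ T1c P J m (νP P) (k0N P N) := integral_nonneg fun _ => sq_nonneg _
  have hgle : g ≤ N ^ (3:ℝ) := rpow_le_rpow_of_exponent_le hN (by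
    have := (P.hs 0 (by simp)).1.trans (P.hs 0 (by simp)).2; linarith [P.hsz])
  have hgT1 : g * T1c P J m (νP P) (k0N P N) ≤ Co * N ^ (-1:ℝ) := by
    calc _ ≤ N ^ (3:ℝ) * (Co * N ^ (-4:ℝ)) := by gcongr
      _ = Co * (N ^ (3:ℝ) * N ^ (-4:ℝ)) := by ring
      _ = _ := by rw [← rpow_add hNo]; norm_num
  have hpow : ∀ a : ℝ, a ≤ 1 - P.r / 16 → N ^ a ≤ N ^ (1 - P.r / 16) := fun a ha => rpow_le_rpow_of_exponent_le hN ha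
  refine main.trans (add_le_add ?_ ?_)
  · refine le_trans (add_le_add ?_ ?_) (le_of_eq (add_mul _ _ _).symm)
    · have ho : 1 + g * A * (2 * T0c P + 2 * T1c P J m (νP P) (k0N P N)) ≤ B * N ^ (3:ℝ) := by
        have h3 : 1 ≤ N ^ (3:ℝ) := one_le_rpow hN (by norm_num)
        have h4 : T1c P J m (νP P) (k0N P N) ≤ Co := hT1N.trans (by
          have : N ^ (-4:ℝ) ≤ 1 := rpow_le_one_of_one_le_of_nonpos hN (by norm_num)
          nlinarith)
        calc _ ≤ 1 * N ^ (3:ℝ) + N ^ (3:ℝ) * A * (2 * T0c P + 2 * Co) := by rw [one_mul]; gcongr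
          _ = _ := by rw [hB]; ring
      have hO : log (1 + g * A * (2 * T0c P + 2 * T1c P J m (νP P) (k0N P N))) ≤ B ^ ε / ε * N ^ (3 * ε) := by
        refine (log_le_log ps ho).trans ((log_le_rpow_div ps hε0).trans (le_of_eq ?_))
        rw [mul_rpow ps ps, ← rpow_mul hNo.le]; ring
      have h5 : N ^ (1 - P.r / 8) * N ^ (3 * ε) ≤ N ^ (1 - P.r / 16) := by
        rw [← rpow_add hNo]; apply hpow; rw [hε]; linarith
      have hBe : 0 ≤ B ^ ε / ε := by positivity
      calc _ = J * (kz + m * m) * log (1 + g * A * (2 * T0c P + 2 * T1c P J m (νP P) (k0N P N))) := by ring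
        _ ≤ (2 * N ^ (1 - P.r / 8)) * (kz + m * m) * (B ^ ε / ε * N ^ (3 * ε)) := by
            have : 0 ≤ log (1 + g * A * (2 * T0c P + 2 * T1c P J m (νP P) (k0N P N))) := log_nonneg (by
              have : 0 ≤ g * A * (2 * T0c P + 2 * T1c P J m (νP P) (k0N P N)) := by positivity
              linarith)
            gcongr
        _ = 2 * (kz + m * m) * (B ^ ε / ε) * (N ^ (1 - P.r / 8) * N ^ (3 * ε)) := by ring
        _ ≤ _ := by gcongr
    · calc _ = A * (2 * (g * T1c P J m (νP P) (k0N P N)) + 2 * (g * T2c P J (νP P) (k0N P N))) := by ring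
        _ ≤ A * (2 * (Co * N ^ (1 - P.r / 16)) + 2 * (Cz * N ^ (1 - P.r / 16))) := by
            have ho : Co * N ^ (-1:ℝ) ≤ Co * N ^ (1 - P.r / 16) := by gcongr ?_ * ?_; exact hpow _ (by linarith)
            have hO : Cz * N ^ (1 - P.r) ≤ Cz * N ^ (1 - P.r / 16) := by gcongr ?_ * ?_; exact hpow _ (by linarith)
            refine mul_le_mul_of_nonneg_left ?_ hAo.le
            linarith
        _ = _ := by ring
  · rw [Fintype.sum_prod_type, ← sum_blk J hJo _ (Phi_int P Go), ← Fin.sum_univ_eq_sum_range (fun j => ∫ x in blk J j, Phi P Go x)]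
    refine sum_le_sum fun j _ => ?_
    obtain ⟨hxb, hxa⟩ := hx j j.2
    have hxI := blk_Icc j.2 hxb
    refine le_trans ?_ hxa
    have hc := hcp _ hxI
    have hs := P.hso.trans_le (P.hs _ hxI).1
    have hsb := sum_block_le (G := Go * P.c (x j) ^ 2) (q := 2 * P.s (x j)) ps (by linarith) J K kz hJo hkz
    refine le_trans (sum_le_sum fun k _ => ?_) hsb
    split_ifs with hk
    swap
    · exact le_rfl
    have hk : kz ≤ (k:ℕ) := hk
    have hk' : (0:ℝ) < (k:ℕ) := mod_cast (by omega : 0 < (k:ℕ))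
    have hb : 0 < π * (k:ℕ) * J := by positivity
    have e : g * (1 + η) * (√(2 * π) * P.c (x j) * (π * (k:ℕ) * J) ^ (-P.s (x j)) * (1 + √(2 * W / kz))) ^ 2 =
        g * (1 + η) * (2 * π) * P.c (x j) ^ 2 * (π * (k:ℕ) * J) ^ (-(2 * P.s (x j))) * (1 + √(2 * W / kz)) ^ 2 := by
      rw [mul_pow, mul_pow, mul_pow, sq_sqrt ps, ← rpow_natCast (_ ^ (-P.s (x j))), ← rpow_mul hb.le,
        show -P.s (x j) * (2:ℕ) = -(2 * P.s (x j)) by push_cast; ring]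
      ring
    rw [e]
    have h3 : g * (1 + η) * (2 * π) * P.c (x j) ^ 2 * (π * (k:ℕ) * J) ^ (-(2 * P.s (x j))) * (1 + √(2 * W / kz)) ^ 2 ≤
       Go * P.c (x j) ^ 2 * (π * (k:ℕ) * J) ^ (-(2 * P.s (x j))) := by
      calc _ ≤ g * (1 + η) * (2 * π) * P.c (x j) ^ 2 * (π * (k:ℕ) * J) ^ (-(2 * P.s (x j))) * (1 + η) := by gcongr
        _ = _ := by rw [hGo]; ring
    gcongr
end u3

section v1

lemma phf_ddf {s : ℝ} (hs : 1/2 < s) {J j k : ℕ} {ko ξ : ℝ} (hJ : 0 < J) (hk : k ≠ 0) (hkk : ko ≤ π * k * J / 2) :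
    ‖phf J j k ξ - (if ko < |ξ| then phf J j k ξ + ddf s J j k ξ else 0)‖ ≤ 3 * ‖ddf s J j k ξ‖ := by
  have hJ' : (0:ℝ) < J := mod_cast hJ
  have hk' : (0:ℝ) < k := mod_cast Nat.pos_of_ne_zero hk
  have hω : 0 < π * k * J := by positivity
  split_ifs with h
  · rw [sub_add_cancel_left, norm_neg]; linarith [norm_nonneg (ddf s J j k ξ)]
  rw [sub_zero, ddf, norm_mul, Complex.norm_real, norm_eq_abs]
  have : 1 / 3 ≤ |(|ξ| / (π * k * J)) ^ (-s) - 1| := by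
    rcases eq_or_ne ξ 0 with rfl | hξ
    · rw [abs_zero, zero_div, zero_rpow (by linarith)]; norm_num
    have hx : 0 < |ξ| := abs_pos.2 hξ
    have ho : |ξ| / (π * k * J) ≤ 1 / 2 := by rw [div_le_iff₀ hω]; linarith
    have hO : (1/2:ℝ) ^ (-(1/2:ℝ)) ≤ (|ξ| / (π * k * J)) ^ (-s) :=
      (rpow_le_rpow_of_nonpos ps ho (by norm_num)).trans
        (rpow_le_rpow_of_exponent_ge ps (by linarith) (by linarith))
    have h3 : (4/3:ℝ) ≤ (1/2:ℝ) ^ (-(1/2:ℝ)) := by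
      have e : (1/2:ℝ) ^ (-(1/2:ℝ)) = √2 := by
        rw [rpow_neg (by norm_num), sqrt_eq_rpow, ← inv_rpow (by norm_num)]; norm_num
      rw [e]
      exact le_sqrt_of_sq_le (by norm_num)
    rw [abs_of_nonneg (by linarith)]; linarith
  nlinarith [norm_nonneg (phf J j k ξ)]

lemma key_abs {F : Type*} [NormedAddCommGroup F] [InnerProductSpace ℝ F] {φ a p E : F} {κ q D θ B : ℝ} (hφ : ‖φ‖ = 1)
    (ea : a = κ • p + E) (hD : ‖φ - p‖ ≤ D) (hqo : 0 ≤ q) (hκ0 : 0 ≤ κ) (hθ : 0 < θ) (hB : 1 + (q * κ) ^ 2 ≤ B) :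
    log (1 + (q * κ) ^ 2) - B * (θ + (1 + 1 / θ) * (2 * D ^ 2 + 2 * (q ^ 2 * ‖E‖ ^ 2))) ≤
      -log (‖φ - ((q * κ) / (1 + (q * κ) ^ 2)) • (q • a)‖ ^ 2 + ((q * κ) / (1 + (q * κ) ^ 2)) ^ 2) := by
  subst ea
  have hD0 : 0 ≤ D := (norm_nonneg _).trans hD
  obtain ⟨b, hb⟩ : ∃ b, b = q * κ := ⟨_, rfl⟩
  rw [← hb] at hB ⊢
  have hbo : 0 ≤ b := hb ▸ mul_nonneg hqo hκ0
  obtain ⟨y, hy⟩ : ∃ y, y = 1 / (1 + b ^ 2) := ⟨_, rfl⟩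
  have hyo : 0 < y := by rw [hy]; positivity
  rw [show b / (1 + b ^ 2) = b * y by rw [hy]; ring]
  obtain ⟨e, he⟩ : ∃ e, e = D + q * ‖E‖ := ⟨_, rfl⟩
  have he0 : 0 ≤ e := by rw [he]; positivity
  have hby : b * y * b = 1 - y := by rw [hy]; field_simp; ring
  have hby1 : b * y ≤ 1 := by rw [hy, mul_one_div, div_le_one ps]; nlinarith
  have hby0 : 0 ≤ b * y := by positivity
  have ho : ‖φ - (b * y) • (q • (κ • p + E))‖ ≤ y + e := by
    have : φ - (b * y) • (q • (κ • p + E)) = y • φ + ((b * y * b) • (φ - p) - (b * y * q) • E) := by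
      have hy1 : y = 1 - b * y * (q * κ) := by rw [← hb]; linarith
      nth_rw 2 [hy1]; rw [hb]; module
    rw [this, he]
    refine (norm_add_le _ _).trans (add_le_add ?_ ((norm_sub_le _ _).trans (add_le_add ?_ ?_)))
    · rw [norm_smul, hφ, mul_one, norm_eq_abs, abs_of_pos hyo]
    · rw [norm_smul, norm_eq_abs, abs_of_nonneg ps]
      exact (mul_le_of_le_one_left (norm_nonneg _) (by rw [hby]; linarith)).trans hD
    · rw [norm_smul, norm_eq_abs, abs_of_nonneg ps]
      exact mul_le_mul_of_nonneg_right (mul_le_of_le_one_left hqo hby1) (norm_nonneg _)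
  obtain ⟨z, hz⟩ : ∃ z, z = φ - (b * y) • (q • (κ • p + E)) := ⟨_, rfl⟩
  have hz0 : 0 < ‖z‖ ^ 2 + (b * y) ^ 2 := by
    rcases hby0.eq_or_lt with h | h
    · rw [hz, ← h, zero_smul, sub_zero, hφ]; norm_num
    · positivity
  rw [← hz] at ho ⊢
  have hO : ‖z‖ ^ 2 + (b * y) ^ 2 ≤ y + (2 * e + e ^ 2) := by
    have h3 : ‖z‖ ^ 2 ≤ (y + e) ^ 2 := by gcongr
    have h4 : y ^ 2 + (b * y) ^ 2 = y := by rw [hy]; field_simp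
    have h5 : y ≤ 1 := by rw [hy, div_le_one ps]; nlinarith
    nlinarith
  have h6 : 2 * e + e ^ 2 ≤ θ + (1 + 1 / θ) * (2 * D ^ 2 + 2 * (q ^ 2 * ‖E‖ ^ 2)) := by
    have h7 : 2 * e ≤ θ + 1 / θ * e ^ 2 := by
      have : 0 ≤ (θ - e) ^ 2 / θ := by positivity
      have e7 : (θ - e) ^ 2 / θ = θ - 2 * e + 1 / θ * e ^ 2 := by field_simp; ring
      linarith
    have h8 : e ^ 2 ≤ 2 * D ^ 2 + 2 * (q ^ 2 * ‖E‖ ^ 2) := by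
      rw [he]; nlinarith [sq_nonneg (D - q * ‖E‖)]
    have : (1 + 1 / θ) * e ^ 2 ≤ (1 + 1 / θ) * (2 * D ^ 2 + 2 * (q ^ 2 * ‖E‖ ^ 2)) := by gcongr
    linarith
  have h11 := log_le_log hz0 hO
  have h12 : log (y + (2 * e + e ^ 2)) ≤ log y + (1 + b ^ 2) * (2 * e + e ^ 2) := by
    have : y + (2 * e + e ^ 2) = y * (1 + (1 + b ^ 2) * (2 * e + e ^ 2)) := by rw [hy]; field_simp
    rw [this, log_mul hyo.ne' ps]
    have := log_le_sub_one_of_pos (by positivity : 0 < 1 + (1 + b ^ 2) * (2 * e + e ^ 2))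
    linarith
  have h13 : log y = -log (1 + b ^ 2) := by rw [hy, one_div, log_inv]
  have h14 := mul_le_mul hB h6 ps (by nlinarith : 0 ≤ B)
  linarith

theorem lower_fin (P : Stg) {ι : Type*} [Fintype ι] [DecidableEq ι] {J ka : ℕ} (hJ : 0 < J) (p : ι → ℕ × ℕ)
    (hp : Function.Injective p) (hpJ : ∀ l, (p l).1 < J) (hka : ∀ l, ka ≤ (p l).2) (hka1 : 1 ≤ ka) {ko ν : ℝ} (hk : 1 ≤ ko)
    (hν : 0 < ν) (hso : 1/2 < P.so - ν) (hkk : ko ≤ π * ka * J / 2)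
    (x : ℕ → ℝ) (hx : ∀ j < J, x j ∈ blk J j) {g θ B : ℝ} (hg : 0 ≤ g) (hθ : 0 < θ) (hBo : 0 ≤ B)
    (hB : ∀ l, 1 + g * (√(2 * π) * P.c (x (p l).1) * (π * (p l).2 * J) ^ (-P.s (x (p l).1))) ^ 2 ≤ B) :
    ∑ l, log (1 + g * (√(2 * π) * P.c (x (p l).1) * (π * (p l).2 * J) ^ (-P.s (x (p l).1))) ^ 2) -
      B * (Fintype.card ι * (θ + (1 + 1 / θ) * (36 * (∫ ξ, Wf 1 P.sz ξ ^ 2) / ka)) + (1 + 1 / θ) * (2 * (g * T2c P J ν ko))) ≤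
    ld (g • Matrix.gram ℝ (fun l => toF (AA J (p l).1 (p l).2 P.K))) := by
  have hJ' : (0:ℝ) < J := mod_cast hJ
  have hka' : (0:ℝ) < ka := mod_cast hka1
  set W := ∫ ξ, Wf 1 P.sz ξ ^ 2 with hW
  have hWo : 0 ≤ W := integral_nonneg fun _ => sq_nonneg _
  have ib := Wc_int P.hso P.hsz (2 * P.M)
  have io := (whi_int (lt_of_lt_of_le one_pos hk) hso (2 * P.L * (1 / (J:ℝ)) ^ P.r * (1 + P.M / ν))).1
  have Bz := AA_bessel J hJ p hp hpJ (fun j => P.khi ko (x j)) _ (fun j hj => P.khi_gk hj hk hν (hx j hj)) io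
  have mo : ∀ l, MemLp (AA J (p l).1 (p l).2 P.K) 2 volume := fun l => (P.gk (hpJ l)).memLp hJ ib _
  have ma : ∀ l, MemLp (AA J (p l).1 (p l).2 (P.khi ko (x (p l).1))) 2 volume :=
    fun l => (P.khi_gk (hpJ l) hk hν (hx _ (hpJ l))).memLp hJ io _
  have hS : MeasurableSet {ξ : ℝ | ko < |ξ|} := measurableSet_lt measurable_const (by fun_prop)
  have mc : ∀ l, MemLp ({ξ : ℝ | ko < |ξ|}.indicator (AA J (p l).1 (p l).2 P.K)) 2 volume := fun l => (mo l).indicator hS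
  set a' : ι → FF := fun l => toF ({ξ : ℝ | ko < |ξ|}.indicator (AA J (p l).1 (p l).2 P.K)) with ha'
  refine le_trans ?_ (gram_mono a' _ (fun v => ?_) hg)
  swap
  · simp only [ha']
    have eo : ∀ l, v l • toF ({ξ : ℝ | ko < |ξ|}.indicator (AA J (p l).1 (p l).2 P.K)) = _ := fun l => (toF_smul (v l) (mc l)).symm
    have ez : ∀ l, v l • toF (AA J (p l).1 (p l).2 P.K) = _ := fun l => (toF_smul (v l) (mo l)).symm
    simp only [eo, ez]
    rw [← toF_sum _ _ fun l _ => (mc l).const_mul _, ← toF_sum _ _ fun l _ => (mo l).const_mul _]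
    refine toF_le (memLp_finsetSum _ fun l _ => (mc l).const_mul _) (memLp_finsetSum _ fun l _ => (mo l).const_mul _) (ae_of_all _ fun ξ => ?_)
    by_cases h : ξ ∈ {ξ : ℝ | ko < |ξ|}
    · simp only [indicator_of_mem h]; exact le_rfl
    · simp [indicator_of_notMem h]
  set κ : ι → ℝ := fun l => √(2 * π) * P.c (x (p l).1) * (π * (p l).2 * J) ^ (-P.s (x (p l).1)) with hκ
  have hxI : ∀ l, x (p l).1 ∈ I₁ := fun l => blk_Icc (hpJ l) (hx _ (hpJ l))
  have hκ0 : ∀ l, 0 ≤ κ l := fun l => by have := (P.hc _ (hxI l)).1; simp only [hκ]; positivity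
  have hko : ∀ l, (p l).2 ≠ 0 := fun l => by have := hka l; omega
  have hd := fun l => ddf_main (lt_of_lt_of_le P.hso (P.hs _ (hxI l)).1) (P.hs _ (hxI l)).2 P.hsz J (p l).1 (p l).2 hJ (hko l)
  set dd : ι → FF := fun l => toF (ddf (P.s (x (p l).1)) J (p l).1 (p l).2) with hdd
  set E : ι → FF := fun l => toF (AA J (p l).1 (p l).2 (P.khi ko (x (p l).1))) with hE
  set qs : ι → ℝ → ℂ := fun l ξ => if ko < |ξ| then phf J (p l).1 (p l).2 ξ + ddf (P.s (x (p l).1)) J (p l).1 (p l).2 ξ else 0 with hps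
  have mps : ∀ l, MemLp (qs l) 2 volume := fun l => by
    have := (memLp_add' (phf_memLp J (p l).1 (p l).2) (hd l).1).indicator hS
    exact this
  have ea : ∀ l, a' l = κ l • toF (qs l) + E l := fun l => by
    rw [← toF_smul _ (mps l), hE, ← toF_add ((mps l).const_mul _) (ma l)]
    simp only [ha']; congr 1; ext ξ
    by_cases h : ko < |ξ|
    · rw [indicator_of_mem (by exact h), AA_hi P (hpJ l) hk hν (hx _ (hpJ l)) _ _ h, Stg.cl, if_pos h, AA_Kb' J _ _ hJ (hko l)]
      simp only [hps, if_pos h, hκ]; ring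
    · rw [indicator_of_notMem (by exact h)]
      have : AA J (p l).1 (p l).2 (P.khi ko (x (p l).1)) ξ = 0 := by unfold AA; simp [Stg.khi, h]
      simp [hps, if_neg h, this]
  have hφ := phf_orthonormal J hJ p hp
  set φ : ι → FF := fun l => toF (phf J (p l).1 (p l).2) with hφd
  have hdif : ∀ l, ‖φ l - toF (qs l)‖ ≤ 3 * ‖dd l‖ := fun l => by
    rw [hφd, ← toF_sub (phf_memLp _ _ _) (mps l)]
    have h3 := toF_smul 3 (hd l).1
    have : 3 * ‖dd l‖ = ‖toF (fun ξ => ((3:ℝ):ℂ) * ddf (P.s (x (p l).1)) J (p l).1 (p l).2 ξ)‖ := by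
      rw [h3, norm_smul]; norm_num [hdd]
    rw [this]
    refine toF_le ((phf_memLp _ _ _).sub (mps l)) ((hd l).1.const_mul _) (ae_of_all _ fun ξ => ?_)
    refine (phf_ddf (lt_of_lt_of_le P.hso (P.hs _ (hxI l)).1) hJ (hko l) (hkk.trans ?_)).trans (le_of_eq ?_)
    · have : (ka:ℝ) ≤ (p l).2 := mod_cast hka l
      gcongr
    · rw [norm_mul]; norm_num
  set q := √g with hq
  have hqz : q ^ 2 = g := sq_sqrt hg
  have hqo : 0 ≤ q := sqrt_nonneg _
  have eg : g • Matrix.gram ℝ a' = Matrix.gram ℝ (fun l => q • a' l) := by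
    ext i j; simp only [Matrix.smul_apply, Matrix.gram_apply, smul_eq_mul, real_inner_smul_left, real_inner_smul_right]
    rw [← hqz]; ring
  rw [eg]
  set α : ι → ℝ := fun l => (q * κ l) / (1 + (q * κ l) ^ 2) with hα
  refine le_trans ?_ (gram_lower _ φ hφ α)
  have key : ∀ l, log (1 + g * κ l ^ 2) - B * (θ + (1 + 1 / θ) * (36 * W / ka) + (1 + 1 / θ) * (2 * (g * ‖E l‖ ^ 2))) ≤
      -log (‖φ l - α l • (q • a' l)‖ ^ 2 + α l ^ 2) := fun l => by
    have h := key_abs (hφ.1 l) (ea l) (hdif l) hqo (hκ0 l) hθ (B := B) (by rw [mul_pow, hqz]; exact hB l)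
    refine le_trans ?_ h
    rw [mul_pow q, hqz]
    have h9 : ‖dd l‖ ^ 2 ≤ 2 * W / ka := (hd l).2.trans (by
      have : (ka:ℝ) ≤ (p l).2 := mod_cast hka l
      gcongr)
    refine sub_le_sub_left (mul_le_mul_of_nonneg_left ?_ hBo) _
    rw [add_assoc, ← mul_add (1 + 1 / θ)]
    have : 2 * (3 * ‖dd l‖) ^ 2 ≤ 36 * W / ka := by
      have : 18 * (2 * W / ka) = 36 * W / ka := by ring
      linarith
    exact add_le_add le_rfl (mul_le_mul_of_nonneg_left (add_le_add this le_rfl) ps)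
  refine le_trans ?_ (sum_le_sum fun l _ => key l)
  rw [sum_sub_distrib, ← mul_sum, sum_add_distrib, ← mul_sum, ← mul_sum, ← mul_sum,
    sum_const, card_univ, nsmul_eq_mul]
  have : ∑ l, ‖E l‖ ^ 2 ≤ T2c P J ν ko := Bz
  refine sub_le_sub_left (mul_le_mul_of_nonneg_left ?_ hBo) _
  gcongr
end v1

section v2

lemma kap_eq {N so s w c : ℝ} (hN : 0 < N) (hw : 0 < w) :
    N ^ (2 * so) * (√(2 * π) * c * (N * w) ^ (-s)) ^ 2 = 2 * π * c ^ 2 * N ^ (-(2 * (s - so))) * w ^ (-(2 * s)) := by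
  rw [mul_pow, mul_pow, sq_sqrt ps, ← rpow_natCast (_ ^ (-s)), ← rpow_mul ps,
    show -s * (2:ℕ) = -(2 * s) by push_cast; ring, mul_rpow hN.le hw.le,
    show -(2 * (s - so)) = 2 * so + -(2 * s) by ring, rpow_add hN]
  ring

lemma sum_low {b q ρ : ℝ} (hb : 0 < b) (hq : 0 < q) (hρ : 0 < ρ) {ka kb : ℕ} (ho : 1 ≤ ka) (hab : ka ≤ kb) {lo hi : ℝ}
    (hlo : ρ * ka ≤ lo) (hhi : hi ≤ ρ * kb) (hlh : lo ≤ hi) :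
    ρ⁻¹ * ∫ w in lo..hi, log (1 + b * w ^ (-q)) ≤ ∑ k ∈ Finset.range (kb - ka), log (1 + b * (ρ * (ka + k : ℕ)) ^ (-q)) := by
  have hka : (0:ℝ) < ka := mod_cast ho
  have anti := log_anti hb.le hq
  have hab' : (ka:ℝ) ≤ kb := mod_cast hab
  have hO : AntitoneOn (fun y => log (1 + b * (ρ * y) ^ (-q))) (Icc (ka:ℝ) kb) := fun x hx y hy hxy => by
    have := hka.trans_le hx.1
    exact anti (mem_Ioi.2 ps) (mem_Ioi.2 (by have := this.trans_le hxy; positivity)) (by gcongr)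
  have h3 := AntitoneOn.integral_le_sum_Ico hab hO
  rw [Finset.sum_Ico_eq_sum_range] at h3
  refine le_trans ?_ h3
  rw [intervalIntegral.integral_comp_mul_left (fun w => log (1 + b * w ^ (-q))) hρ.ne', smul_eq_mul]
  refine mul_le_mul_of_nonneg_left ?_ ps
  refine intervalIntegral.integral_mono_interval hlo hlh hhi ?_ ?_
  · refine (ae_restrict_mem measurableSet_Ioc).mono fun w hw => log_nonneg ?_
    have h0 : 0 < w := lt_trans ps hw.1
    have : 0 ≤ b * w ^ (-q) := by positivity
    simpa using this
  · refine AntitoneOn.intervalIntegrable (anti.mono fun w hw => ?_)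
    rw [uIcc_of_le (by gcongr)] at hw
    exact lt_of_lt_of_le ps hw.1

lemma ft_int (P : Stg) (L T : ℝ) :
    IntegrableOn ({x | (P.s x - P.so) * L ≤ T}.indicator fun x => exp (-(L * (P.s x - P.so) / P.so))) (Ioc 0 1) := by
  have hsm := P.sm
  have hso := P.hso
  refine IntegrableOn.of_bound (C := exp (|L| * (P.sz + P.so) / P.so)) (by simp) ?_ ?_
  · exact ((by fun_prop : Measurable fun x => exp (-(L * (P.s x - P.so) / P.so))).indicator
      (measurableSet_le (by fun_prop) measurable_const)).aestronglyMeasurable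
  · refine (ae_restrict_mem measurableSet_Ioc).mono fun x hx => (norm_indicator_le_norm_self _ _).trans ?_
    rw [norm_eq_abs, abs_of_pos (exp_pos _)]
    have ho := P.hs x (Ioc_subset_Icc_self hx)
    have h0 : 0 < P.so := by linarith
    apply exp_le_exp.2
    rw [← neg_div]; gcongr
    calc -(L * (P.s x - P.so)) ≤ |L| * |P.s x - P.so| := by rw [← abs_mul]; exact neg_le_abs _
      _ ≤ _ := by
        gcongr; rw [abs_of_nonneg (by linarith)]; linarith

set_option maxHeartbeats 1000000 in
theorem lower_asym (P : Stg) {b b' A T : ℝ} (hb' : 0 < b') (hbb : b' < b) (hA : 1 ≤ A) (hT : 0 < T)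
    (hAT : 2 * exp (T / P.so) / A ≤ A) (hc : ∃ ε0 > 0, ∀ x ∈ I₁, P.s x - P.so ≤ ε0 → b ≤ 2 * π * P.c x ^ 2) :
    ∃ C, ∀ᶠ N : ℝ in atTop, ∃ J K ka : ℕ, 0 < J ∧
      N / π * (∫ w in (2 * exp (T / P.so) / A)..A, log (1 + b' * w ^ (-(2 * P.so)))) *
        (∫ x in Ioc (0:ℝ) 1, {x | (P.s x - P.so) * log N ≤ T}.indicator
          (fun x => exp (-(log N * (P.s x - P.so) / P.so))) x) - C * N ^ (1 - P.r / 16) ≤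
      ld (N ^ (2 * P.so) • Matrix.gram ℝ (fun l : Fin J × Fin K => toF (AA J l.1 (ka + l.2) P.K))) := by
  have hr := P.hr; have hro := P.hro; have hs0' := P.hso
  obtain ⟨Cz, hCz, hTo⟩ := T2_bd P
  obtain ⟨hν, hνr, hso, hsz⟩ := νP_spec P
  set W := ∫ ξ, Wf 1 P.sz ξ ^ 2 with hW
  have hWo : 0 ≤ W := integral_nonneg fun _ => sq_nonneg _
  obtain ⟨ε0, hε0, hc⟩ := hc
  have hAo : 0 < A := by linarith
  have hsp : 0 < P.so := by linarith
  have hM := P.hM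
  set B := 1 + 2 * π * P.M ^ 2 * A ^ (2 * P.sz) with hB
  have hBo : 0 ≤ B := by positivity
  have hε1 : ∀ᶠ N : ℝ in atTop, b' ≤ b * A ^ (-(2 * (T / log N))) := by
    have ho : Tendsto (fun N => b * A ^ (-(2 * (T / log N)))) atTop (nhds (b * A ^ (-(2 * (0:ℝ))))) :=
      (tendsto_const_nhds.rpow ((tendsto_const_nhds.div_atTop tendsto_log_atTop).const_mul 2).neg (Or.inl hAo.ne')).const_mul b
    rw [mul_zero, neg_zero, rpow_zero, mul_one] at ho
    exact (ho.eventually (lt_mem_nhds hbb)).mono fun _ h => h.le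
  have hlog : ∀ᶠ N : ℝ in atTop, 1 ≤ log N ∧ T / ε0 ≤ log N :=
    (tendsto_log_atTop.eventually (eventually_ge_atTop 1)).and (tendsto_log_atTop.eventually (eventually_ge_atTop _))
  have hpa := (tendsto_rpow_atTop (by linarith : 0 < P.r / 4)).eventually (eventually_ge_atTop (2 * A))
  have hpb := (tendsto_rpow_atTop (by linarith : 0 < P.r / 8)).eventually (eventually_ge_atTop (2 * π * A))
  refine ⟨B * ((A + 2) * (1 + 144 * π * A * W) + 4 * Cz), ?_⟩
  filter_upwards [hε1, hlog, hpa, hpb, eventually_ge_atTop 1] with N hε1 hlog hpa hpb hN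
  have hNo : 0 < N := by linarith
  obtain ⟨hJz, hJa, hJo⟩ := JN_bd P hN
  obtain ⟨hko, hkN, hkJ⟩ := k0N_bd P hN
  have hTo := hTo N hN
  have hJr : (0:ℝ) < JN P N := mod_cast hJo
  set J := JN P N with hJd
  set L := log N with hL
  set g := N ^ (2 * P.so) with hg
  have hπJ : π * J * A ≤ N := by
    calc π * J * A ≤ π * (2 * N ^ (1 - P.r / 8)) * A := by gcongr
      _ = 2 * π * A * N ^ (1 - P.r / 8) := by ring
      _ ≤ N ^ (P.r / 8) * N ^ (1 - P.r / 8) := by gcongr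
      _ = N := by rw [← rpow_add hNo]; norm_num
  set ka := ⌈N / (A * π * J)⌉₊ with hka
  set kb := ⌊N * A / (π * J)⌋₊ + 1 with hkb
  have hka1 : 1 ≤ ka := Nat.ceil_pos.2 ps
  have hka2 : N / (A * π * J) ≤ ka := Nat.le_ceil _
  have hka3 : (ka:ℝ) ≤ 2 * N / (A * π * J) := by
    have := (Nat.ceil_lt_add_one (by positivity : 0 ≤ N / (A * π * J))).le
    have hO : 1 ≤ N / (A * π * J) := by rw [one_le_div ps]; linarith
    rw [mul_div_assoc]; linarith
  have hkb1 : N * A / (π * J) ≤ kb := by rw [hkb]; push_cast; exact (Nat.lt_floor_add_one _).le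
  have hkb2 : (kb:ℝ) ≤ N * A / (π * J) + 1 := by
    rw [hkb]; push_cast; linarith [Nat.floor_le (by positivity : 0 ≤ N * A / (π * J))]
  have hAA : 2 / A ≤ A := le_trans (by
    gcongr; have := one_le_exp (by positivity : 0 ≤ T / P.so); linarith) hAT
  have hab : ka ≤ kb := by
    have : (ka:ℝ) ≤ kb := hka3.trans (le_trans (by
      calc 2 * N / (A * π * J) = N * (2 / A) / (π * J) := by field_simp
        _ ≤ _ := by gcongr) hkb1)
    exact_mod_cast this
  set f := {x | (P.s x - P.so) * L ≤ T}.indicator (fun x => exp (-(L * (P.s x - P.so) / P.so))) with hf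
  have hfi : IntegrableOn f (Ioc 0 1) := ft_int P L T
  have hx : ∀ j, ∃ x, j < J → x ∈ blk J j ∧ ∫ x in blk J j, f x ≤ f x / J := by
    intro j
    by_cases hj : j < J
    · obtain ⟨x, ho, hO⟩ := (avg_blk J j hj _ hfi).2
      exact ⟨x, fun _ => ⟨ho, hO⟩⟩
    · exact ⟨0, fun h => absurd h hj⟩
  choose x hx using hx
  refine ⟨J, kb - ka, ka, hJo, ?_⟩
  have hw : ∀ k : ℕ, k < kb - ka → ∃ w, π * ((ka + k : ℕ):ℝ) * J = N * w ∧ 1 / A ≤ w ∧ w ≤ A := fun k hk => by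
    refine ⟨π * ((ka + k : ℕ):ℝ) * J / N, by field_simp, ?_, ?_⟩
    · rw [le_div_iff₀ hNo, div_mul_eq_mul_div, one_mul]
      calc N / A = π * (N / (A * π * J)) * J := by field_simp
        _ ≤ _ := by push_cast; gcongr; have : (0:ℝ) ≤ k := by positivity
                    linarith
    · rw [div_le_iff₀ hNo]
      have hO : ka + k ≤ ⌊N * A / (π * J)⌋₊ := by omega
      have h3 : ((ka + k : ℕ):ℝ) ≤ N * A / (π * J) := (Nat.le_floor_iff ps).1 hO
      calc _ ≤ π * (N * A / (π * J)) * J := by gcongr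
        _ = _ := by field_simp
  have hterm : ∀ j < J, ∀ k < kb - ka, ∃ w, π * ((ka + k : ℕ):ℝ) * J = N * w ∧ 1 / A ≤ w ∧ w ≤ A ∧
      g * (√(2 * π) * P.c (x j) * (π * ((ka + k : ℕ):ℝ) * J) ^ (-P.s (x j))) ^ 2 =
      2 * π * P.c (x j) ^ 2 * N ^ (-(2 * (P.s (x j) - P.so))) * w ^ (-(2 * P.s (x j))) := fun j hj k hk => by
    obtain ⟨w, ho, hO, h3⟩ := hw k hk
    exact ⟨w, ho, hO, h3, by rw [ho]; exact kap_eq hNo (lt_of_lt_of_le ps hO)⟩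
  have main := lower_fin P (ι := Fin J × Fin (kb - ka)) (ka := ka) hJo (fun l => ((l.1:ℕ), ka + (l.2:ℕ)))
    (by rintro ⟨a, b⟩ ⟨c, d⟩ h
        simp only [Prod.mk.injEq, Nat.add_left_cancel_iff] at h
        ext <;> simp [h.1, h.2])
    (fun l => l.1.2) (fun l => Nat.le_add_right _ _) hka1 hko hν hso (by
      have : N / (2 * A) ≤ π * ka * J / 2 := by
        calc N / (2 * A) = π * (N / (A * π * J)) * J / 2 := by field_simp
          _ ≤ _ := by gcongr
      refine le_trans ?_ this
      rw [le_div_iff₀ ps]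
      calc k0N P N * (2 * A) ≤ N ^ (1 - P.r / 4) * N ^ (P.r / 4) := by unfold k0N; gcongr
        _ = N := by rw [← rpow_add hNo]; norm_num)
    x (fun j hj => (hx j hj).1) (g := g) (θ := N ^ (-(P.r / 16))) (B := B) ps ps hBo (by
      intro l
      obtain ⟨w, -, hO, h3, e⟩ := hterm l.1 l.1.2 l.2 l.2.2
      have hxI := blk_Icc l.1.2 (hx l.1 l.1.2).1
      have hs := P.hs _ hxI; have hcx := P.hc _ hxI
      have hwo : 0 < w := lt_of_lt_of_le ps hO
      rw [e, hB]
      have h5 : N ^ (-(2 * (P.s (x l.1) - P.so))) ≤ 1 := rpow_le_one_of_one_le_of_nonpos hN (by linarith)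
      have h6 : w ^ (-(2 * P.s (x l.1))) ≤ A ^ (2 * P.sz) := by
        calc _ ≤ (1 / A) ^ (-(2 * P.s (x l.1))) := rpow_le_rpow_of_nonpos ps hO (by linarith)
          _ = A ^ (2 * P.s (x l.1)) := by rw [one_div, inv_rpow hAo.le, rpow_neg hAo.le, inv_inv]
          _ ≤ _ := rpow_le_rpow_of_exponent_le hA (by linarith)
      have h7 : P.c (x l.1) ^ 2 ≤ P.M ^ 2 := by have := hcx.1; gcongr; exact hcx.2
      calc _ ≤ 1 + 2 * π * P.M ^ 2 * 1 * A ^ (2 * P.sz) := by gcongr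
        _ = _ := by ring)
  refine le_trans (sub_le_sub ?_ ?_) main
  · -- main part
    set I := ∫ w in (2 * exp (T / P.so) / A)..A, log (1 + b' * w ^ (-(2 * P.so))) with hI
    have hI0 : 0 ≤ I := intervalIntegral.integral_nonneg hAT fun w hw => log_nonneg (by
      have h0 : 0 < w := lt_of_lt_of_le ps hw.1
      have : 0 ≤ b' * w ^ (-(2 * P.so)) := by positivity
      simpa using this)
    rw [Fintype.sum_prod_type, ← sum_blk J hJo _ hfi, ← Fin.sum_univ_eq_sum_range (fun j => ∫ x in blk J j, f x), mul_sum]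
    refine sum_le_sum fun j _ => ?_
    obtain ⟨hxb, hxa⟩ := hx j j.2
    have hxI := blk_Icc j.2 hxb
    have hs := P.hs _ hxI; have hcx := P.hc _ hxI
    refine (mul_le_mul_of_nonneg_left hxa ps).trans ?_
    dsimp only
    by_cases ht : (P.s (x j) - P.so) * L ≤ T
    swap
    · rw [hf, indicator_of_notMem (by exact ht), zero_div, mul_zero]
      exact sum_nonneg fun k _ => log_nonneg (by
        have : 0 ≤ g * (√(2 * π) * P.c (x j) * (π * ((ka + k : ℕ):ℝ) * J) ^ (-P.s (x j))) ^ 2 := by positivity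
        simpa using this)
    rw [hf, indicator_of_mem (by exact ht)]
    set t := L * (P.s (x j) - P.so) with htd
    have hto : 0 ≤ t := mul_nonneg (by linarith [hlog.1]) (by linarith)
    have htT : t ≤ T := by rw [htd, mul_comm]; exact ht
    set ρ := exp (t / P.so) * (π * J) / N with hρ
    have hρ0 : 0 < ρ := by positivity
    have hsl := sum_low hb' (by linarith : 0 < 2 * P.so) hρ0 hka1 hab (lo := 2 * exp (T / P.so) / A) (hi := A) (by
      calc ρ * ka ≤ (exp (T / P.so) * (π * J) / N) * (2 * N / (A * π * J)) := by rw [hρ]; gcongr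
        _ = _ := by field_simp) (by
      calc A = 1 * (π * J) / N * (N * A / (π * J)) := by field_simp
        _ ≤ _ := by rw [hρ]; gcongr; exact one_le_exp ps) hAT
    calc _ = ρ⁻¹ * I := by rw [hρ, exp_neg]; field_simp
      _ ≤ _ := hsl
      _ ≤ _ := by
        rw [← Fin.sum_univ_eq_sum_range (fun k => log (1 + b' * (ρ * (ka + k : ℕ)) ^ (-(2 * P.so))))]
        refine sum_le_sum fun k _ => ?_
        obtain ⟨w, ho, hO, h3, e⟩ := hterm j j.2 k k.2
        have hwo : 0 < w := lt_of_lt_of_le ps hO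
        rw [e]
        have eo : ρ * (ka + (k:ℕ) : ℕ) = exp (t / P.so) * w := by
          have : w = π * ((ka + k : ℕ):ℝ) * J / N := by rw [ho]; field_simp
          rw [this, hρ]; ring
        have ez : (exp (t / P.so) * w) ^ (-(2 * P.so)) = N ^ (-(2 * (P.s (x j) - P.so))) * w ^ (-(2 * P.so)) := by
          rw [mul_rpow (exp_pos _).le hwo.le, ← exp_mul, rpow_def_of_pos hNo]
          congr 2; rw [htd, hL]; field_simp
        have ee : w ^ (-(2 * P.s (x j))) = w ^ (-(2 * P.so)) * w ^ (-(2 * (P.s (x j) - P.so))) := by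
          rw [← rpow_add hwo]; congr 1; ring
        have hLo : 0 < L := by linarith [hlog.1]
        have hh : P.s (x j) - P.so ≤ T / L := by rw [le_div_iff₀ hLo]; exact ht
        have h4 : A ^ (-(2 * (T / L))) ≤ w ^ (-(2 * (P.s (x j) - P.so))) :=
          (rpow_le_rpow_of_exponent_le hA (by linarith)).trans (rpow_le_rpow_of_nonpos hwo h3 (by linarith))
        have h5 : b ≤ 2 * π * P.c (x j) ^ 2 := hc _ hxI (hh.trans (by
          rw [div_le_iff₀ hLo]; have := hlog.2; rw [div_le_iff₀ hε0] at this; linarith))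
        rw [eo, ez, ee]
        refine log_le_log ps (add_le_add le_rfl ?_)
        calc _ ≤ (2 * π * P.c (x j) ^ 2 * w ^ (-(2 * (P.s (x j) - P.so)))) * (N ^ (-(2 * (P.s (x j) - P.so))) * w ^ (-(2 * P.so))) := by
              have hbp : 0 < b := by linarith
              refine mul_le_mul_of_nonneg_right (hε1.trans ?_) ps
              gcongr
          _ = _ := by ring
  · rw [mul_assoc B]
    refine mul_le_mul_of_nonneg_left ?_ hBo
    have hT20 : 0 ≤ T2c P J (νP P) (k0N P N) := integral_nonneg fun _ => sq_nonneg _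
    have hθ : 1 + 1 / N ^ (-(P.r / 16)) ≤ 2 * N ^ (P.r / 16) := by
      rw [rpow_neg hNo.le, one_div, inv_inv]
      have := one_le_rpow hN (by linarith : 0 ≤ P.r / 16); linarith
    have hcard : (Fintype.card (Fin J × Fin (kb - ka)) : ℝ) ≤ (A + 2) * N := by
      rw [Fintype.card_prod, Fintype.card_fin, Fintype.card_fin, Nat.cast_mul]
      have ho : ((kb - ka : ℕ):ℝ) ≤ kb := mod_cast Nat.sub_le _ _
      have hO : (J:ℝ) ≤ 2 * N := hJa.trans (by
        have := rpow_le_rpow_of_exponent_le hN (by linarith : 1 - P.r / 8 ≤ 1)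
        rw [rpow_one] at this; linarith)
      have h3 : N * A / π ≤ N * A := div_le_self ps (by linarith [pi_gt_three])
      calc (J:ℝ) * ((kb - ka : ℕ):ℝ) ≤ J * (N * A / (π * J) + 1) := by gcongr; linarith
        _ = N * A / π + J := by field_simp
        _ ≤ _ := by linarith
    have hWk : 36 * W / ka ≤ 72 * π * A * W * N ^ (-(P.r / 8)) := by
      have ho : 1 / (ka:ℝ) ≤ 2 * π * A * N ^ (-(P.r / 8)) := by
        calc 1 / (ka:ℝ) ≤ 1 / (N / (A * π * J)) := by gcongr
          _ = A * π * J * N⁻¹ := by rw [one_div_div]; rfl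
          _ ≤ A * π * (2 * N ^ (1 - P.r / 8)) * N⁻¹ := by gcongr
          _ = 2 * π * A * (N ^ (1 - P.r / 8) * N ^ (-1:ℝ)) := by rw [rpow_neg_one]; ring
          _ = _ := by rw [← rpow_add hNo]; ring_nf
      calc 36 * W / ka = 36 * W * (1 / ka) := by ring
        _ ≤ 36 * W * (2 * π * A * N ^ (-(P.r / 8))) := by gcongr
        _ = _ := by ring
    calc _ ≤ (A + 2) * N * (N ^ (-(P.r / 16)) + 2 * N ^ (P.r / 16) * (72 * π * A * W * N ^ (-(P.r / 8)))) +
          2 * N ^ (P.r / 16) * (2 * (Cz * N ^ (1 - P.r))) := by gcongr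
      _ = (A + 2) * (N * N ^ (-(P.r / 16)) + 144 * π * A * W * (N * (N ^ (P.r / 16) * N ^ (-(P.r / 8))))) +
          4 * Cz * (N ^ (P.r / 16) * N ^ (1 - P.r)) := by ring
      _ ≤ (A + 2) * (N ^ (1 - P.r / 16) + 144 * π * A * W * N ^ (1 - P.r / 16)) + 4 * Cz * N ^ (1 - P.r / 16) := by
        have ef : ∀ a : ℝ, N * N ^ a = N ^ (1 + a) := fun a => by rw [rpow_add hNo, rpow_one]
        rw [← rpow_add hNo, ← rpow_add hNo, ef, ef]
        gcongr <;> linarith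
      _ = _ := by ring
end v2

lemma exists_small_s_up (t p c : ℝ) (ht : 0 < t) (hc : p * t ^ (p - 1) < c) :
    ∃ s, 0 < s ∧ s < t ∧ t ^ p - (t - s) ^ p - s * c < 0 := by
  have hd : HasDerivAt (fun s : ℝ => t ^ p - (t - s) ^ p - s * c) (p * t ^ (p - 1) - c) 0 := by
    have ho : HasDerivAt (fun s : ℝ => t - s) (-1) 0 := by
      simpa using (hasDerivAt_id (0:ℝ)).const_sub t
    have hO := ho.rpow_const (p := p) (Or.inl (by simpa using ht.ne'))
    have h3 := ((hO.const_sub (t ^ p)).sub ((hasDerivAt_id (0:ℝ)).mul_const c))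
    refine HasDerivAt.congr_deriv h3 ?_
    simp
  have hneg : p * t ^ (p - 1) - c < 0 := by linarith
  have h4 := (hasDerivAt_iff_tendsto_slope.1 hd)
  have h5 := h4.eventually (gt_mem_nhds hneg)
  have h6 : ∀ᶠ s in nhdsWithin (0:ℝ) (Ioi 0), slope (fun s : ℝ => t ^ p - (t - s) ^ p - s * c) 0 s < 0 :=
    h5.filter_mono (nhdsWithin_mono _ (fun x hx => ne_of_gt hx))
  have h7 : ∀ᶠ s in nhdsWithin (0:ℝ) (Ioi 0), s ∈ Ioo 0 t := Ioo_mem_nhdsGT ht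
  obtain ⟨s, hsz, hsa⟩ := (h6.and h7).exists
  refine ⟨s, hsa.1, hsa.2, ?_⟩
  rw [slope_def_field] at hsz
  simp only [sub_zero, zero_mul, sub_self] at hsz
  have := (div_neg_iff.1 hsz)
  rcases this with h | h
  · linarith [h.2, hsa.1]
  · exact h.1

lemma exists_small_s_down (t p c : ℝ) (ht : 0 < t) (hc : c < p * t ^ (p - 1)) :
    ∃ s, 0 < s ∧ t ^ p - (t + s) ^ p + s * c < 0 := by
  have hd : HasDerivAt (fun s : ℝ => t ^ p - (t + s) ^ p + s * c) (-(p * t ^ (p - 1)) + c) 0 := by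
    have ho : HasDerivAt (fun s : ℝ => t + s) (1) 0 := by
      simpa using (hasDerivAt_id (0:ℝ)).const_add t
    have hO := ho.rpow_const (p := p) (Or.inl (by simpa using ht.ne'))
    have h3 := ((hO.const_sub (t ^ p)).add ((hasDerivAt_id (0:ℝ)).mul_const c))
    refine HasDerivAt.congr_deriv h3 ?_
    simp
  have hneg : -(p * t ^ (p - 1)) + c < 0 := by linarith
  have h4 := (hasDerivAt_iff_tendsto_slope.1 hd)
  have h5 := h4.eventually (gt_mem_nhds hneg)
  have h6 : ∀ᶠ s in nhdsWithin (0:ℝ) (Ioi 0), slope (fun s : ℝ => t ^ p - (t + s) ^ p + s * c) 0 s < 0 :=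
    h5.filter_mono (nhdsWithin_mono _ (fun x hx => ne_of_gt hx))
  have h7 : ∀ᶠ s in nhdsWithin (0:ℝ) (Ioi 0), s ∈ Ioi 0 := self_mem_nhdsWithin
  obtain ⟨s, hsz, hsa⟩ := (h6.and h7).exists
  refine ⟨s, hsa, ?_⟩
  rw [slope_def_field] at hsz
  simp only [sub_zero, zero_mul, sub_self, add_zero] at hsz
  have := (div_neg_iff.1 hsz)
  rcases this with h | h
  · have := h.2; have h9 : (0:ℝ) < s := hsa; linarith
  · exact h.1

section
variable {Ω : Type*} [MeasurableSpace Ω] {μ : Measure Ω} [IsProbabilityMeasure μ]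
  {Y : Ω → ℝ}

lemma integrable_exp_negY (hYm : Measurable Y) (hY : ∀ ω, 0 ≤ Y ω) {γ : ℝ} (hγ : 0 ≤ γ) :
    Integrable (fun ω => exp (-γ * Y ω)) μ := by
  refine Integrable.of_bound (C := 1) (by fun_prop) (Eventually.of_forall fun ω => ?_)
  rw [norm_eq_abs, abs_of_pos (exp_pos _), exp_le_one_iff]
  have := mul_nonneg hγ (hY ω); linarith

lemma chernoff_upper (hYm : Measurable Y) (hY : ∀ ω, 0 ≤ Y ω) {γ : ℝ} (hγ : 0 ≤ γ) (r : ℝ) :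
    μ.real {ω | Y ω ≤ r} ≤ exp (γ * r) * ∫ ω, exp (-γ * Y ω) ∂μ := by
  have hm : MeasurableSet {ω | Y ω ≤ r} := hYm measurableSet_Iic
  rw [← integral_const_mul, ← integral_indicator_one hm]
  refine integral_mono ((integrable_const 1).indicator hm)
    ((integrable_exp_negY hYm hY hγ).const_mul _) fun ω => ?_
  simp only [indicator_apply, mem_ofPred_eq]
  split_ifs with h
  · rw [← exp_add]
    simp only [Pi.one_apply]
    rw [one_le_exp_iff]; nlinarith
  · positivity

lemma tilt_lower (hYm : Measurable Y) (hY : ∀ ω, 0 ≤ Y ω) {γ s s' a r : ℝ} (hs : 0 < s)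
    (hsγ : s < γ) (hs' : 0 < s') :
    exp (γ * a) * ((∫ ω, exp (-γ * Y ω) ∂μ)
      - exp (-s * r) * (∫ ω, exp (-(γ - s) * Y ω) ∂μ)
      - exp (s' * a) * (∫ ω, exp (-(γ + s') * Y ω) ∂μ)) ≤ μ.real {ω | Y ω ≤ r} := by
  have hm : MeasurableSet {ω | Y ω ≤ r} := hYm measurableSet_Iic
  have iz := integrable_exp_negY (μ := μ) hYm hY (γ := γ) (by linarith)
  have io := integrable_exp_negY (μ := μ) hYm hY (γ := γ - s) (by linarith)
  have ia := integrable_exp_negY (μ := μ) hYm hY (γ := γ + s') (by linarith)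
  have i12 : Integrable (fun ω => exp (-γ * Y ω) - exp (-s * r) *
      exp (-(γ - s) * Y ω)) μ := iz.sub (io.const_mul _)
  rw [← integral_const_mul, ← integral_const_mul, ← integral_sub iz (io.const_mul _),
    ← integral_sub i12 (ia.const_mul _), ← integral_const_mul,
    ← integral_indicator_one hm]
  refine integral_mono (((iz.sub (io.const_mul _)).sub (ia.const_mul _)).const_mul _)
    ((integrable_const 1).indicator hm) fun ω => ?_
  simp only [indicator_apply, mem_ofPred_eq, Pi.one_apply, ← exp_add]
  have ez : 0 < exp (-s * r + -(γ - s) * Y ω) := exp_pos _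
  have ee : 0 < exp (s' * a + -(γ + s') * Y ω) := exp_pos _
  have ef : 0 < exp (γ * a) := exp_pos _
  split_ifs with h
  · by_cases ha : a ≤ Y ω
    · have ho : exp (γ * a) * exp (-γ * Y ω) ≤ 1 := by
        rw [← exp_add, exp_le_one_iff]; nlinarith
      nlinarith
    · have : exp (-γ * Y ω) ≤ exp (s' * a + -(γ + s') * Y ω) := by
        apply exp_le_exp.2; push Not at ha; nlinarith
      have : exp (γ * a) * (exp (-γ * Y ω) - exp (-s * r + -(γ - s) * Y ω) -
        exp (s' * a + -(γ + s') * Y ω)) ≤ 0 := mul_nonpos_of_nonneg_of_nonpos ef.le (by linarith)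
      linarith
  · have : exp (-γ * Y ω) ≤ exp (-s * r + -(γ - s) * Y ω) := by
      apply exp_le_exp.2; push Not at h; nlinarith
    exact mul_nonpos_of_nonneg_of_nonpos ef.le (by linarith)

theorem tauber (hYm : Measurable Y) (hY : ∀ ω, 0 ≤ Y ω) (Λ : ℝ → ℝ)
    (hΛ : ∀ γ, 0 < γ → ∫ ω, exp (-γ * Y ω) ∂μ = exp (-Λ γ))
    (p : ℝ) (hpo : 0 < p) (hpa : p < 1)
    (hreg : ∀ c, 0 < c → Tendsto (fun γ => Λ (c * γ) / Λ γ) atTop (nhds (c ^ p)))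
    (htop : Tendsto Λ atTop atTop) {ι : Type*} {l : Filter ι} (γ r : ι → ℝ)
    (hγ : Tendsto γ l atTop) (hr : Tendsto (fun i => γ i * r i / Λ (γ i)) l (nhds p)) :
    Tendsto (fun i => log (μ.real {ω | Y ω ≤ r i}) / Λ (γ i)) l (nhds (-(1 - p))) := by
  have hΛtop : Tendsto (fun i => Λ (γ i)) l atTop := htop.comp hγ
  have hLpos : ∀ᶠ i in l, 0 < Λ (γ i) := hΛtop.eventually_gt_atTop 0
  have hγpos : ∀ᶠ i in l, 0 < γ i := hγ.eventually_gt_atTop 0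
  have hreg' : ∀ c, 0 < c → Tendsto (fun i => Λ (c * γ i) / Λ (γ i)) l (nhds (c ^ p)) :=
    fun c hc => (hreg c hc).comp hγ
  have key : ∀ t, 1 < t → ∀ c₂, c₂ < p * t ^ (p - 1) → p * t ^ (p - 1) < p →
      ∀ᶠ i in l, 0 < μ.real {ω | Y ω ≤ r i} ∧
        t * c₂ - Λ (t * γ i) / Λ (γ i) - log 2 / Λ (γ i) ≤
          log (μ.real {ω | Y ω ≤ r i}) / Λ (γ i) := by
    intro t ht c₂ hc₂ hc
    have hto : 0 < t := by linarith
    obtain ⟨c₁, hc₁, hc₁'⟩ := exists_between hc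
    obtain ⟨s, hso, hst, hs⟩ := exists_small_s_up t p c₁ hto hc₁
    obtain ⟨s', hs'0, hs'⟩ := exists_small_s_down t p c₂ hto hc₂
    have T1 : Tendsto (fun i => Λ (t * γ i) / Λ (γ i) - Λ ((t - s) * γ i) / Λ (γ i)
        - s * (γ i * r i / Λ (γ i))) l (nhds (t ^ p - (t - s) ^ p - s * p)) :=
      ((hreg' t hto).sub (hreg' _ (by linarith))).sub (hr.const_mul s)
    have n1 : t ^ p - (t - s) ^ p - s * p < 0 := by nlinarith
    have T2 : Tendsto (fun i => Λ (t * γ i) / Λ (γ i) - Λ ((t + s') * γ i) / Λ (γ i)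
        + s' * c₂) l (nhds (t ^ p - (t + s') ^ p + s' * c₂)) :=
      ((hreg' t hto).sub (hreg' _ (by linarith))).add_const _
    have T1' := (T1.neg_mul_atTop n1 hΛtop).eventually_le_atBot (-log 4)
    have T2' := (T2.neg_mul_atTop hs' hΛtop).eventually_le_atBot (-log 4)
    filter_upwards [T1', T2', hLpos, hγpos] with i ho hO hL hg
    have b := tilt_lower (μ := μ) hYm hY (γ := t * γ i) (s := s * γ i) (s' := s' * γ i)
      (a := c₂ * Λ (γ i) / γ i) (r := r i) ps (by nlinarith) ps
    have ea : t * γ i - s * γ i = (t - s) * γ i := by ring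
    have eb : t * γ i + s' * γ i = (t + s') * γ i := by ring
    rw [ea, eb, hΛ _ ps, hΛ _ (mul_pos (by linarith) hg), hΛ _ ps,
      ← exp_add, ← exp_add] at b
    have ec : t * γ i * (c₂ * Λ (γ i) / γ i) = t * c₂ * Λ (γ i) := by field_simp
    have ed : s' * γ i * (c₂ * Λ (γ i) / γ i) = s' * c₂ * Λ (γ i) := by field_simp
    rw [ec, ed] at b
    have h4 : exp (-log 4) = 1 / 4 := by
      rw [exp_neg, exp_log (by norm_num)]; norm_num
    have fo : exp (-(s * γ i) * r i + -Λ ((t - s) * γ i)) ≤ 1 / 4 * exp (-Λ (t * γ i)) := by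
      rw [← h4, ← exp_add]
      apply exp_le_exp.2
      have : (Λ (t * γ i) / Λ (γ i) - Λ ((t - s) * γ i) / Λ (γ i)
        - s * (γ i * r i / Λ (γ i))) * Λ (γ i) = Λ (t * γ i) - Λ ((t - s) * γ i) - s * γ i * r i := by
        field_simp
      linarith
    have fz : exp (s' * c₂ * Λ (γ i) + -Λ ((t + s') * γ i)) ≤ 1 / 4 * exp (-Λ (t * γ i)) := by
      rw [← h4, ← exp_add]
      apply exp_le_exp.2
      have : (Λ (t * γ i) / Λ (γ i) - Λ ((t + s') * γ i) / Λ (γ i)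
        + s' * c₂) * Λ (γ i) = Λ (t * γ i) - Λ ((t + s') * γ i) + s' * c₂ * Λ (γ i) := by
        field_simp
      linarith
    have ef : 0 < exp (t * c₂ * Λ (γ i)) := exp_pos _
    have eo : 0 < exp (-Λ (t * γ i)) := exp_pos _
    have fa : exp (t * c₂ * Λ (γ i)) * (1 / 2 * exp (-Λ (t * γ i))) ≤
        μ.real {ω | Y ω ≤ r i} := le_trans (mul_le_mul_of_nonneg_left (by linarith) ef.le) b
    have hpos : 0 < μ.real {ω | Y ω ≤ r i} := lt_of_lt_of_le ps fa
    refine ⟨hpos, ?_⟩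
    have f4 := log_le_log ps fa
    rw [log_mul ps ps, log_mul ps ps,
      log_exp, log_exp, one_div, log_inv] at f4
    rw [le_div_iff₀ hL]
    have : (t * c₂ - Λ (t * γ i) / Λ (γ i) - log 2 / Λ (γ i)) * Λ (γ i) =
      t * c₂ * Λ (γ i) - Λ (t * γ i) - log 2 := by field_simp
    linarith
  have hlt : ∀ t : ℝ, 1 < t → p * t ^ (p - 1) < p := by
    intro t ht
    have : t ^ (p - 1) < 1 := rpow_lt_one_of_one_lt_of_neg ht (by linarith)
    nlinarith
  have hL2 : Tendsto (fun i => log 2 / Λ (γ i)) l (nhds 0) := hΛtop.const_div_atTop _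
  refine tendsto_order.2 ⟨fun b hb => ?_, fun b hb => ?_⟩
  · -- lower
    have hcont : Tendsto (fun t : ℝ => t * (p * t ^ (p - 1) - (t - 1)) - t ^ p) (nhdsWithin 1 (Ioi 1))
        (nhds (-(1 - p))) := by
      have : ContinuousAt (fun t : ℝ => t * (p * t ^ (p - 1) - (t - 1)) - t ^ p) 1 := by
        have ho : ContinuousAt (fun t : ℝ => t ^ (p - 1)) 1 :=
          continuousAt_rpow_const _ _ (Or.inl one_ne_zero)
        have hO : ContinuousAt (fun t : ℝ => t ^ p) 1 :=
          continuousAt_rpow_const _ _ (Or.inl one_ne_zero)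
        fun_prop
      have h3 := this.tendsto
      simp only [one_rpow] at h3
      refine Tendsto.mono_left ?_ nhdsWithin_le_nhds
      convert h3 using 2; ring
    obtain ⟨t, ht, ht1⟩ := ((hcont.eventually (lt_mem_nhds hb)).and self_mem_nhdsWithin).exists
    have ht1' : (1:ℝ) < t := ht1
    have k := key t ht1' (p * t ^ (p - 1) - (t - 1)) (by linarith) (hlt t ht1')
    have lim : Tendsto (fun i => t * (p * t ^ (p - 1) - (t - 1)) - Λ (t * γ i) / Λ (γ i) -
        log 2 / Λ (γ i)) l (nhds (t * (p * t ^ (p - 1) - (t - 1)) - t ^ p - 0)) :=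
      ((hreg' t (by linarith)).const_sub _).sub hL2
    rw [sub_zero] at lim
    filter_upwards [lim.eventually (lt_mem_nhds ht), k] with i ho hO
    exact lt_of_lt_of_le ho hO.2
  · have lim : Tendsto (fun i => γ i * r i / Λ (γ i) - 1) l (nhds (p - 1)) := hr.sub_const 1
    have hb' : p - 1 < b := by linarith
    filter_upwards [lim.eventually (gt_mem_nhds hb'), hLpos, hγpos,
      key 2 one_lt_two (p * 2 ^ (p - 1) - 1) (by linarith) (hlt 2 one_lt_two)] with i ho hL hg hpos
    refine lt_of_le_of_lt ?_ ho
    have c := chernoff_upper (μ := μ) hYm hY hg.le (r i)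
    rw [hΛ _ hg, ← exp_add] at c
    have := log_le_log hpos.1 c
    rw [log_exp] at this
    rw [div_le_iff₀ hL]
    have e : (γ i * r i / Λ (γ i) - 1) * Λ (γ i) = γ i * r i - Λ (γ i) := by field_simp
    linarith
end

section fo

structure Dst (ν : Measure ℝ) (h : ℝ → ℝ) (σ : ℝ) : Prop where
  fin : ν univ ≤ 1
  hm : Measurable h
  h0 : ∀ᵐ x ∂ν, 0 ≤ h x
  hσ : 0 < σ
  pos : ∀ s > 0, 0 < ν.real {x | h x < s}
  lim : ∀ v > 0, Tendsto (fun s => ν.real {x | h x < v * s} / ν.real {x | h x < s}) (nhdsWithin 0 (Ioi 0)) (nhds (v ^ σ))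

variable {ν : Measure ℝ} {h : ℝ → ℝ} {σ : ℝ}

lemma Dst.isFin (H : Dst ν h σ) : IsFiniteMeasure ν := ⟨H.fin.trans_lt ENNReal.one_lt_top⟩

lemma Dst.mono (H : Dst ν h σ) : Monotone fun s => ν.real {x | h x < s} := by
  have := H.isFin
  intro s t hst
  exact measureReal_mono fun x hx => lt_of_lt_of_le hx hst

lemma Dst.le_one (H : Dst ν h σ) (s : ℝ) : ν.real {x | h x < s} ≤ 1 := by
  have := H.isFin
  refine ENNReal.toReal_le_of_le_ofReal zero_le_one ?_
  rw [ENNReal.ofReal_one]; exact (measure_mono (subset_univ _)).trans H.fin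

lemma Dst.doub (H : Dst ν h σ) : ∃ m : ℕ, ∀ s > 0, ∀ v ≥ 1, ν.real {x | h x < v * s} ≤ (2 * v) ^ m * ν.real {x | h x < s} := by
  set F := fun s => ν.real {x | h x < s} with hF
  have ho : ∃ sz > 0, ∀ s, 0 < s → s < sz → F (2 * s) ≤ (2 ^ σ + 1) * F s := by
    have := (H.lim 2 two_pos).eventually (ge_mem_nhds (lt_add_one _))
    obtain ⟨sz, hsz, h⟩ := mem_nhdsGT_iff_exists_Ioo_subset.1 this
    refine ⟨sz, hsz, fun s h0 hs => ?_⟩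
    have := h ⟨h0, hs⟩
    rwa [mem_ofPred_eq, div_le_iff₀ (H.pos s h0)] at this
  obtain ⟨sz, hsz, ho⟩ := ho
  obtain ⟨m, hm⟩ : ∃ m : ℕ, 2 ^ σ + 1 + 1 / F sz ≤ (2:ℝ) ^ m := (pow_unbounded_of_one_lt _ one_lt_two).imp fun _ h => h.le
  have hp := H.pos sz hsz
  have hd : ∀ s > 0, F (2 * s) ≤ 2 ^ m * F s := fun s hs => by
    have hps := H.pos s hs
    have h2s : (0:ℝ) < 2 ^ σ := by positivity
    have hi : 0 < 1 / F sz := by positivity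
    rcases lt_or_ge s sz with h | h
    · refine (ho s hs h).trans (mul_le_mul_of_nonneg_right ?_ hps.le); linarith
    · have : F sz ≤ F s := H.mono h
      calc F (2 * s) ≤ 1 := H.le_one _
        _ = 1 / F sz * F sz := (one_div_mul_cancel (ne_of_gt hp)).symm
        _ ≤ 2 ^ m * F s := by gcongr; linarith
  have hn : ∀ n : ℕ, ∀ s > 0, F (2 ^ n * s) ≤ (2 ^ n) ^ m * F s := by
    intro n
    induction n with
    | zero => intro s _; simp
    | succ n ih =>
      intro s hs
      rw [pow_succ', mul_assoc]
      refine (hd _ ps).trans ?_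
      rw [mul_pow, mul_assoc]
      exact mul_le_mul_of_nonneg_left (ih s hs) ps
  refine ⟨m, fun s hs v hv => ?_⟩
  obtain ⟨n, hn1, hn2⟩ := exists_nat_pow_near hv one_lt_two
  have hps := H.pos s hs
  calc F (v * s) ≤ F (2 ^ (n + 1) * s) := H.mono (by gcongr)
    _ ≤ (2 ^ (n + 1)) ^ m * F s := hn _ s hs
    _ ≤ _ := by
      gcongr; rw [pow_succ']; gcongr

lemma Dst.int_exp (H : Dst ν h σ) {L : ℝ} (hL : 0 ≤ L) : Integrable (fun x => exp (-(L * h x))) ν := by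
  have := H.isFin; have := H.hm
  refine Integrable.of_bound (C := 1) (by fun_prop) (H.h0.mono fun x hx => ?_)
  rw [norm_eq_abs, abs_of_pos (exp_pos _), exp_le_one_iff]
  have := mul_nonneg hL hx; linarith

lemma Dst.layer (H : Dst ν h σ) {L : ℝ} (hL : 0 < L) :
    ∫ x, exp (-(L * h x)) ∂ν = ∫ t in Ioi (0:ℝ), exp (-t) * ν.real {x | h x < t * (1 / L)} := by
  have := H.isFin; have hm := H.hm
  set G : ℝ → ℝ → ℝ := fun x t => {z : ℝ × ℝ | h z.1 < z.2 * (1 / L)}.indicator (fun z => exp (-z.2)) (x, t) with hG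
  have hS : MeasurableSet {z : ℝ × ℝ | h z.1 < z.2 * (1 / L)} := measurableSet_lt (by fun_prop) (by fun_prop)
  have hint : Integrable (Function.uncurry G) (ν.prod (volume.restrict (Ioi 0))) := by
    have ho : Integrable (fun z : ℝ × ℝ => (1:ℝ) * exp (-z.2)) (ν.prod (volume.restrict (Ioi 0))) :=
      (integrable_const (1:ℝ)).mul_prod (integrableOn_exp_neg_Ioi 0)
    refine ho.mono' ?_ (ae_of_all _ fun z => ?_)
    · exact ((by fun_prop : Measurable fun z : ℝ × ℝ => exp (-z.2)).indicator hS).aestronglyMeasurable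
    · refine (norm_indicator_le_norm_self (s := {z : ℝ × ℝ | h z.1 < z.2 * (1 / L)}) (fun z : ℝ × ℝ => exp (-z.2)) z).trans ?_
      simp [abs_of_pos (exp_pos _)]
  have eo : ∀ᵐ x ∂ν, exp (-(L * h x)) = ∫ t in Ioi (0:ℝ), G x t := H.h0.mono fun x hx => by
    have : ∀ t, G x t = (Ioi (L * h x)).indicator (fun t => exp (-t)) t := fun t => by
      simp only [hG, indicator, mem_ofPred_eq, mem_Ioi]
      congr 1; rw [mul_one_div, lt_div_iff₀ hL, mul_comm]
    simp only [this]
    rw [setIntegral_indicator measurableSet_Ioi, inter_eq_right.2 (Ioi_subset_Ioi ps), integral_exp_neg_Ioi]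
  rw [integral_congr_ae eo, integral_integral_swap hint]
  refine integral_congr_ae (ae_of_all _ fun t => ?_)
  have : ∀ x, G x t = {x | h x < t * (1 / L)}.indicator (fun _ => exp (-t)) x := fun x => rfl
  simp only [this]
  rw [integral_indicator_const _ (measurableSet_lt hm measurable_const), smul_eq_mul, mul_comm]

lemma inv_nhds : Tendsto (fun L : ℝ => 1 / L) atTop (nhdsWithin 0 (Ioi 0)) := by
  simp only [one_div]; exact tendsto_inv_atTop_nhdsGT_zero

theorem Dst.lap1 (H : Dst ν h σ) :
    Tendsto (fun L => (∫ x, exp (-(L * h x)) ∂ν) / ν.real {x | h x < 1 / L}) atTop (nhds (Gamma (σ + 1))) := by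
  have := H.isFin
  obtain ⟨m, hd⟩ := H.doub
  have hσ := H.hσ
  have e : Gamma (σ + 1) = ∫ t in Ioi (0:ℝ), exp (-t) * t ^ σ := by
    rw [Gamma_eq_integral (by linarith), add_sub_cancel_right]
  rw [e]
  have key : Tendsto (fun L => ∫ t in Ioi (0:ℝ), exp (-t) * (ν.real {x | h x < t * (1 / L)} / ν.real {x | h x < 1 / L}))
      atTop (nhds (∫ t in Ioi (0:ℝ), exp (-t) * t ^ σ)) := by
    refine tendsto_integral_filter_of_dominated_convergence
      (fun t => 4 ^ m * m.factorial * exp (1/2) * exp (-(1/2) * t)) ?_ ?_ ?_ ?_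
    · refine Eventually.of_forall fun L => ?_
      have : Measurable fun t : ℝ => ν.real {x | h x < t * (1 / L)} :=
        H.mono.measurable.comp (measurable_id.mul_const _)
      exact (((by fun_prop : Measurable fun t : ℝ => exp (-t))).mul (this.div_const _)).aestronglyMeasurable
    · filter_upwards [eventually_gt_atTop 0] with L hL
      refine (ae_restrict_mem measurableSet_Ioi).mono fun t ht => ?_
      have ht : 0 < t := ht
      have hp := H.pos (1 / L) ps
      rw [norm_eq_abs, abs_of_nonneg ps]
      have ho : ν.real {x | h x < t * (1 / L)} / ν.real {x | h x < 1 / L} ≤ (2 * (1 + t)) ^ m := by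
        rw [div_le_iff₀ hp]
        exact (H.mono (by gcongr; linarith : t * (1 / L) ≤ (1 + t) * (1 / L))).trans (hd _ ps _ (by linarith))
      have hO := pow_div_factorial_le_exp ((1 + t) / 2) ps m
      rw [div_le_iff₀ ps] at hO
      calc _ ≤ exp (-t) * (2 * (1 + t)) ^ m := by gcongr
        _ = exp (-t) * (4 ^ m * ((1 + t) / 2) ^ m) := by rw [← mul_pow]; ring_nf
        _ ≤ exp (-t) * (4 ^ m * (exp ((1 + t) / 2) * m.factorial)) := by gcongr
        _ = 4 ^ m * m.factorial * (exp (-t) * exp ((1 + t) / 2)) := by ring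
        _ = 4 ^ m * m.factorial * (exp (1/2) * exp (-(1/2) * t)) := by
          rw [← exp_add, ← exp_add]; ring_nf
        _ = _ := by ring
    · exact (integrableOn_exp_mul_Ioi (by norm_num) 0).const_mul _
    · refine (ae_restrict_mem measurableSet_Ioi).mono fun t ht => ?_
      exact ((H.lim t ht).comp inv_nhds).const_mul _
  refine key.congr' ?_
  filter_upwards [eventually_gt_atTop 0] with L hL
  rw [H.layer hL, ← integral_div]
  congr 1; ext t; ring

theorem Dst.lap (H : Dst ν h σ) {a : ℝ} (ha : 0 < a) :
    Tendsto (fun L => (∫ x, exp (-(L * h x / a)) ∂ν) / ν.real {x | h x < 1 / L}) atTop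
      (nhds (Gamma (σ + 1) * a ^ σ)) := by
  have ho : Tendsto (fun L : ℝ => L / a) atTop atTop := tendsto_id.atTop_div_const ha
  refine ((H.lap1.comp ho).mul ((H.lim a ha).comp inv_nhds)).congr' ?_
  filter_upwards [eventually_gt_atTop 0] with L hL
  have hp := H.pos (a * (1 / L)) ps
  simp only [Function.comp]
  rw [show 1 / (L / a) = a * (1 / L) by field_simp, div_mul_div_cancel₀ hp.ne']
  congr 3; ext x; ring_nf

lemma Dst.exp_small (H : Dst ν h σ) {δ : ℝ} (hδ : 0 < δ) :
    Tendsto (fun L => exp (-(δ * L)) / ν.real {x | h x < 1 / L}) atTop (nhds 0) := by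
  obtain ⟨m, hd⟩ := H.doub
  have hpa := H.pos 1 one_pos
  have ho : Tendsto (fun L : ℝ => 2 ^ m / (ν.real {x | h x < 1}) * (L ^ m * exp (-δ * L))) atTop (nhds 0) := by
    have := (tendsto_rpow_mul_exp_neg_mul_atTop_nhds_zero m δ hδ).const_mul (2 ^ m / (ν.real {x | h x < 1}))
    simpa only [rpow_natCast, mul_zero] using this
  refine squeeze_zero' (Eventually.of_forall fun L => div_nonneg (exp_pos _).le measureReal_nonneg) ?_ ho
  filter_upwards [eventually_ge_atTop 1] with L hL
  have hp := H.pos (1 / L) ps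
  have := hd (1 / L) ps L hL
  rw [mul_one_div_cancel ps, mul_pow] at this
  rw [div_le_iff₀ hp, div_mul_eq_mul_div, div_mul_eq_mul_div, le_div_iff₀ hpa]
  calc _ ≤ exp (-(δ * L)) * (2 ^ m * L ^ m * ν.real {x | h x < 1 / L}) := by gcongr
    _ = _ := by rw [neg_mul]; ring
end fo

section fz

lemma Imid {b q E : ℝ} (hb : 0 < b) (hq : 1 < q) (hEo : 0 < E) :
    Tendsto (fun A : ℝ => ∫ w in (E / A)..A, log (1 + b * w ^ (-q))) atTop
      (nhds (b ^ (1 / q) * (π / sin (π / q)))) := by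
  obtain ⟨hi, he⟩ := log_int hb hq
  have hE : Tendsto (fun A : ℝ => E / A) atTop (nhds 0) := tendsto_const_nhds.div_atTop tendsto_id
  have ho := ((aecover_Ioi_of_Ioi (μ := (volume : Measure ℝ)) hE).inter ((aecover_Iic (μ := (volume : Measure ℝ)) (tendsto_id (α := ℝ))).restrict (s := Ioi 0))).integral_tendsto_of_countably_generated hi
  rw [he] at ho
  refine ho.congr' ?_
  filter_upwards [eventually_ge_atTop (max 1 E)] with A hA
  have h1A := (le_max_left _ _).trans hA
  have hEA : E / A ≤ A := (div_le_self hEo.le h1A).trans ((le_max_right _ _).trans hA)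
  have hs : Ioi (E / A) ∩ Iic (id A) ⊆ Ioi 0 := fun x hx => lt_trans (div_pos hEo (by linarith)) hx.1
  rw [intervalIntegral.integral_of_le hEA, Measure.restrict_restrict_of_subset hs]
  rfl

lemma Phi_scale (P : Stg) {N G x : ℝ} (hN : 1 < N) (hG : 0 ≤ G) (hx : x ∈ I₁) :
    Phi P (N ^ (2 * P.so) * G) x = N * exp (-(log N * (P.s x - P.so) / P.s x)) * Phi P G x := by
  have hs := P.hso.trans_le (P.hs x hx).1
  have h0 : 0 < N := by linarith
  unfold Phi
  rw [mul_assoc, mul_rpow ps ps, ← rpow_mul h0.le, mul_div_assoc]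
  congr 1
  rw [rpow_def_of_pos h0]
  nth_rw 2 [← exp_log h0]
  rw [← exp_add]
  congr 1; field_simp; ring

variable (P : Stg) {σ : ℝ} {Cf : ℝ → ℝ} {Dd : ℝ → ℝ}

lemma pow_err (HD : Dst (volume.restrict (Ioc 0 1)) (fun x => P.s x - P.so) σ) (C : ℝ) :
    Tendsto (fun N : ℝ => C * N ^ (1 - P.r / 16) / (N * (volume.restrict (Ioc 0 1)).real {x | P.s x - P.so < 1 / log N})) atTop (nhds 0) := by
  have hr := P.hr
  have h := ((HD.exp_small (δ := P.r / 16) ps).comp tendsto_log_atTop).const_mul C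
  rw [mul_zero] at h
  refine h.congr' ?_
  filter_upwards [eventually_gt_atTop 1] with N hN
  have h0 : 0 < N := by linarith
  simp only [Function.comp]
  rw [rpow_sub h0, rpow_one, show exp (-(P.r / 16 * log N)) = (N ^ (P.r / 16))⁻¹ by
    rw [← rpow_neg h0.le, rpow_def_of_pos h0]; ring_nf]
  field_simp

theorem D_upper (hCf : ContinuousAt Cf P.so) (hCo : 0 < Cf P.so) (hcs : ∀ x ∈ I₁, P.c x = Cf (P.s x))
    (HD : Dst (volume.restrict (Ioc 0 1)) (fun x => P.s x - P.so) σ)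
    (hU : ∀ η > 0, ∃ C, ∀ᶠ N : ℝ in atTop, Dd N ≤ C * N ^ (1 - P.r / 16) + ∫ x in Ioc (0:ℝ) 1, Phi P (N ^ (2 * P.so) * (1 + η) ^ 2 * (2 * π)) x)
    {z : ℝ} (hz : (2 * π * Cf P.so ^ 2) ^ (1 / (2 * P.so)) / sin (π / (2 * P.so)) * (Gamma (σ + 1) * P.so ^ σ) < z) :
    ∀ᶠ N in atTop, Dd N / (N * (volume.restrict (Ioc 0 1)).real {x | P.s x - P.so < 1 / log N}) < z := by
  have hso := P.hso
  have hsin := sin_pos_of _ hso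
  set Ψ : ℝ × ℝ → ℝ := fun v => ((1 + v.1) ^ 2 * (2 * π) * Cf v.2 ^ 2) ^ (1 / (2 * v.2)) / sin (π / (2 * v.2)) with hΨ
  have hΨ0 : Ψ (0, P.so) = (2 * π * Cf P.so ^ 2) ^ (1 / (2 * P.so)) / sin (π / (2 * P.so)) := by simp [hΨ]
  rw [← hΨ0] at hz
  obtain ⟨t, hto, ht⟩ : ∃ t > 0, (Ψ (0, P.so) + t) * (Gamma (σ + 1) * (P.so + t) ^ σ) < z := by
    have hc : ContinuousAt (fun t : ℝ => (Ψ (0, P.so) + t) * (Gamma (σ + 1) * (P.so + t) ^ σ)) 0 := by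
      refine ContinuousAt.mul (by fun_prop) (continuousAt_const.mul ?_)
      exact ContinuousAt.rpow_const (by fun_prop) (Or.inl (by simp; linarith))
    have := (hc.eventually (gt_mem_nhds (by simpa using hz))).filter_mono (nhdsWithin_le_nhds (s := Ioi 0))
    obtain ⟨t, ho, hO⟩ := (this.and self_mem_nhdsWithin).exists
    exact ⟨t, hO, ho⟩
  have hcont : ContinuousAt Ψ (0, P.so) := by
    have hCz : ContinuousAt (fun v : ℝ × ℝ => Cf v.2) (0, P.so) := ContinuousAt.comp (g := Cf) hCf continuousAt_snd
    have hO : ContinuousAt (fun v : ℝ × ℝ => 2 * v.2) (0, P.so) := by fun_prop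
    refine ContinuousAt.div ?_ ?_ hsin.ne'
    · refine ContinuousAt.rpow ?_ (continuousAt_const.div hO (by simp; linarith)) (Or.inl ?_)
      · exact (by fun_prop : ContinuousAt (fun v : ℝ × ℝ => (1 + v.1) ^ 2 * (2 * π)) _).mul (hCz.pow 2)
      · simp only; positivity
    · exact continuous_sin.continuousAt.comp (continuousAt_const.div hO (by simp; linarith))
  obtain ⟨ρ, hρ, hball⟩ := Metric.eventually_nhds_iff.1 (hcont.eventually (gt_mem_nhds (by linarith : Ψ (0, P.so) < Ψ (0, P.so) + t)))
  set ε0 := min t (ρ / 2)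
  have hε0 : 0 < ε0 := by positivity
  set X := Ψ (0, P.so) + t
  have hX0 : 0 ≤ X := by
    have : 0 ≤ Ψ (0, P.so) := by rw [hΨ0]; positivity
    positivity
  obtain ⟨C, hC⟩ := hU (ρ / 2) ps
  set G := (1 + ρ / 2) ^ 2 * (2 * π) with hG
  have hGo : 0 ≤ G := by positivity
  obtain ⟨Bo, hBo⟩ := (isCompact_Icc.bddAbove_image (Phi_cont P G))
  set B := max Bo 0
  have hB : ∀ x ∈ I₁, Phi P G x ≤ B := fun x hx => (hBo (mem_image_of_mem _ hx)).trans (le_max_left _ _)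
  have hBn : 0 ≤ B := le_max_right _ _
  have hsz : 0 < P.sz := by have := (P.hs 0 (by simp)); linarith
  set δ := ε0 / P.sz
  have hδ : 0 < δ := by positivity
  set ν := volume.restrict (Ioc (0:ℝ) 1) with hν
  have hlim : Tendsto (fun N => C * N ^ (1 - P.r / 16) / (N * ν.real {x | P.s x - P.so < 1 / log N}) +
      (X * ((∫ x, exp (-(log N * (P.s x - P.so) / (P.so + t))) ∂ν) / ν.real {x | P.s x - P.so < 1 / log N}) +
        B * (exp (-(δ * log N)) / ν.real {x | P.s x - P.so < 1 / log N}))) atTop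
      (nhds (0 + (X * (Gamma (σ + 1) * (P.so + t) ^ σ) + B * 0))) :=
    (pow_err P HD C).add ((((HD.lap ps).comp tendsto_log_atTop).const_mul X).add
      (((HD.exp_small hδ).comp tendsto_log_atTop).const_mul B))
  rw [zero_add, mul_zero, add_zero] at hlim
  filter_upwards [hlim.eventually (gt_mem_nhds ht), hC, eventually_gt_atTop 1] with N ho hO hN
  refine lt_of_le_of_lt ?_ ho
  have hL := log_pos hN
  have hNo : 0 < N := by linarith
  have hF := HD.pos (1 / log N) ps
  rw [div_le_iff₀ ps]
  refine hO.trans (le_of_le_of_eq (add_le_add le_rfl (?_ : _ ≤ N * (X * (∫ x, exp (-(log N * (P.s x - P.so) / (P.so + t))) ∂ν) + B * exp (-(δ * log N))))) ?_)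
  · have hi : Integrable (fun x => exp (-(log N * (P.s x - P.so) / (P.so + t)))) ν := by
      refine (HD.int_exp (L := log N / (P.so + t)) ps).congr (ae_of_all _ fun x => ?_)
      simp only; congr 2; ring
    have hmass : ν.real univ = 1 := by simp [hν]
    rw [← integral_const_mul, show B * exp (-(δ * log N)) = ∫ x, B * exp (-(δ * log N)) ∂ν by
      rw [integral_const, hmass, one_smul], ← integral_add (hi.const_mul _) (integrable_const _), ← integral_const_mul]
    refine setIntegral_mono_on (Phi_int P _) (((hi.const_mul _).add (integrable_const _)).const_mul _) measurableSet_Ioc fun x hx => ?_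
    have hx' := Ioc_subset_Icc_self hx
    have hsx := P.hs x hx'
    have hspos : 0 < P.s x := by linarith
    rw [mul_assoc, Phi_scale P hN hGo hx', mul_assoc]
    refine mul_le_mul_of_nonneg_left ?_ hNo.le
    have hPhi0 : 0 ≤ Phi P G x := div_nonneg ps (sin_pos_of _ (by linarith)).le
    rcases le_or_gt (P.s x - P.so) ε0 with h | h
    · have eo : Phi P G x ≤ X := by
        have hd : dist (ρ / 2, P.s x) ((0:ℝ), P.so) < ρ := by
          rw [Prod.dist_eq, dist_eq, dist_eq, sub_zero, abs_of_pos ps, abs_of_nonneg (by linarith)]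
          have := min_le_right t (ρ / 2)
          exact max_lt (by linarith) (by linarith)
        have := hball hd
        simp only [hΨ] at this
        unfold Phi; rw [hcs x hx', hG]; exact this.le
      have ez : exp (-(log N * (P.s x - P.so) / P.s x)) ≤ exp (-(log N * (P.s x - P.so) / (P.so + t))) := by
        have h3 : 0 ≤ P.s x - P.so := by linarith
        have h4 : P.s x ≤ P.so + t := by linarith [min_le_left t (ρ / 2)]
        gcongr
      have ee : 0 ≤ B * exp (-(δ * log N)) := by positivity
      calc _ ≤ exp (-(log N * (P.s x - P.so) / (P.so + t))) * X := mul_le_mul ez eo hPhi0 (exp_pos _).le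
        _ ≤ _ := by linarith
    · have ez : exp (-(log N * (P.s x - P.so) / P.s x)) ≤ exp (-(δ * log N)) := by
        rw [exp_le_exp, neg_le_neg_iff, mul_div_assoc, mul_comm]
        refine mul_le_mul_of_nonneg_left ?_ hL.le
        exact div_le_div₀ (by linarith) h.le hspos hsx.2
      have ee : 0 ≤ X * exp (-(log N * (P.s x - P.so) / (P.so + t))) := by positivity
      calc _ ≤ exp (-(δ * log N)) * B := mul_le_mul ez (hB x hx') hPhi0 (exp_pos _).le
        _ ≤ _ := by linarith
  · generalize ν.real {x | P.s x - P.so < 1 / log N} = F at hF ⊢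
    field_simp

theorem D_lower (hCf : ContinuousAt Cf P.so) (hCo : 0 < Cf P.so) (hcs : ∀ x ∈ I₁, P.c x = Cf (P.s x))
    (HD : Dst (volume.restrict (Ioc 0 1)) (fun x => P.s x - P.so) σ)
    (hL : ∀ b b' A T : ℝ, 0 < b' → b' < b → 1 ≤ A → 0 < T → 2 * exp (T / P.so) / A ≤ A →
      (∃ ε0 > 0, ∀ x ∈ I₁, P.s x - P.so ≤ ε0 → b ≤ 2 * π * P.c x ^ 2) → ∃ C, ∀ᶠ N : ℝ in atTop,
      N / π * (∫ w in (2 * exp (T / P.so) / A)..A, log (1 + b' * w ^ (-(2 * P.so)))) *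
        (∫ x in Ioc (0:ℝ) 1, {x | (P.s x - P.so) * log N ≤ T}.indicator (fun x => exp (-(log N * (P.s x - P.so) / P.so))) x)
        - C * N ^ (1 - P.r / 16) ≤ Dd N)
    {z : ℝ} (hz : z < (2 * π * Cf P.so ^ 2) ^ (1 / (2 * P.so)) / sin (π / (2 * P.so)) * (Gamma (σ + 1) * P.so ^ σ)) :
    ∀ᶠ N in atTop, z < Dd N / (N * (volume.restrict (Ioc 0 1)).real {x | P.s x - P.so < 1 / log N}) := by
  have hso := P.hso
  have hsin := sin_pos_of _ hso
  set bm := 2 * π * Cf P.so ^ 2 with hbm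
  have hbm0 : 0 < bm := by positivity
  obtain ⟨b', ⟨hb'm, hb'0⟩, hb'z⟩ : ∃ b', (b' < bm ∧ 0 < b') ∧ z < b' ^ (1 / (2 * P.so)) / sin (π / (2 * P.so)) * (Gamma (σ + 1) * P.so ^ σ) := by
    have hc : ContinuousAt (fun b : ℝ => b ^ (1 / (2 * P.so)) / sin (π / (2 * P.so)) * (Gamma (σ + 1) * P.so ^ σ)) bm :=
      ((ContinuousAt.rpow_const continuousAt_id (Or.inl hbm0.ne')).div_const _).mul_const _
    have := ((hc.eventually (lt_mem_nhds hz)).and (lt_mem_nhds hbm0)).filter_mono (nhdsWithin_le_nhds (s := Iio bm))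
    obtain ⟨b, ho, hO⟩ := (this.and self_mem_nhdsWithin).exists
    exact ⟨b, ⟨hO, ho.2⟩, ho.1⟩
  obtain ⟨b, hbb, hbm'⟩ := exists_between hb'm
  obtain ⟨T, hT, hTz⟩ : ∃ T, z < b' ^ (1 / (2 * P.so)) / sin (π / (2 * P.so)) * (Gamma (σ + 1) * P.so ^ σ -
      exp (-(T / (2 * P.so))) * (Gamma (σ + 1) * (2 * P.so) ^ σ)) ∧ 0 < T := by
    have ho : Tendsto (fun T : ℝ => exp (-(T / (2 * P.so)))) atTop (nhds 0) :=
      tendsto_exp_neg_atTop_nhds_zero.comp (tendsto_id.atTop_div_const ps)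
    have hO := ((ho.mul_const (Gamma (σ + 1) * (2 * P.so) ^ σ)).const_sub (Gamma (σ + 1) * P.so ^ σ)).const_mul (b' ^ (1 / (2 * P.so)) / sin (π / (2 * P.so)))
    rw [zero_mul, sub_zero] at hO
    exact ((hO.eventually (lt_mem_nhds hb'z)).and (eventually_gt_atTop 0)).exists
  set E := 2 * exp (T / P.so) with hE
  have hEo : 0 < E := by positivity
  set R := Gamma (σ + 1) * P.so ^ σ - exp (-(T / (2 * P.so))) * (Gamma (σ + 1) * (2 * P.so) ^ σ) with hR
  obtain ⟨A, ⟨hA, hAz⟩, hAE⟩ : ∃ A, (z < (∫ w in (E / A)..A, log (1 + b' * w ^ (-(2 * P.so)))) / π * R ∧ 1 ≤ A) ∧ E ≤ A := by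
    have ho := ((Imid (E := E) hb'0 (by linarith : 1 < 2 * P.so) hEo).div_const π).mul_const R
    rw [show b' ^ (1 / (2 * P.so)) * (π / sin (π / (2 * P.so))) / π = b' ^ (1 / (2 * P.so)) / sin (π / (2 * P.so)) by field_simp] at ho
    exact (((ho.eventually (lt_mem_nhds hT)).and (eventually_ge_atTop 1)).and (eventually_ge_atTop E)).exists
  have hEA : E / A ≤ A := by
    have : E / A ≤ E := div_le_self hEo.le hAz
    linarith
  obtain ⟨C, hC⟩ := hL b b' A T hb'0 hbb hAz hTz hEA (by
    have hc : ContinuousAt (fun s => 2 * π * Cf s ^ 2) P.so := (hCf.pow 2).const_mul _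
    obtain ⟨ρ, hρ, hball⟩ := Metric.eventually_nhds_iff.1 (hc.eventually (lt_mem_nhds hbm'))
    refine ⟨ρ / 2, by positivity, fun x hx h => ?_⟩
    rw [hcs x hx]
    refine (hball ?_).le
    rw [dist_eq, abs_of_nonneg (by linarith [(P.hs x hx).1])]; linarith)
  set I := ∫ w in (E / A)..A, log (1 + b' * w ^ (-(2 * P.so))) with hI
  have hI0 : 0 ≤ I := intervalIntegral.integral_nonneg hEA fun w hw => log_nonneg (by
    have : 0 ≤ w := le_trans ps hw.1
    have : 0 ≤ b' * w ^ (-(2 * P.so)) := by positivity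
    linarith)
  set ν := volume.restrict (Ioc (0:ℝ) 1) with hν
  have hlim : Tendsto (fun N => I / π * ((∫ x, exp (-(log N * (P.s x - P.so) / P.so)) ∂ν) / ν.real {x | P.s x - P.so < 1 / log N} -
      exp (-(T / (2 * P.so))) * ((∫ x, exp (-(log N * (P.s x - P.so) / (2 * P.so))) ∂ν) / ν.real {x | P.s x - P.so < 1 / log N}))
      - C * N ^ (1 - P.r / 16) / (N * ν.real {x | P.s x - P.so < 1 / log N})) atTop (nhds (I / π * R - 0)) :=
    ((((HD.lap ps).comp tendsto_log_atTop).sub (((HD.lap ps).comp tendsto_log_atTop).const_mul _)).const_mul _).sub (pow_err P HD C)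
  rw [sub_zero] at hlim
  filter_upwards [hlim.eventually (lt_mem_nhds hA), hC, eventually_gt_atTop 1] with N ho hO hN
  refine lt_of_lt_of_le ho ?_
  have hLN := log_pos hN
  have hNo : 0 < N := by linarith
  have hF := HD.pos (1 / log N) ps
  rw [le_div_iff₀ ps]
  have hi : ∀ a > 0, Integrable (fun x => exp (-(log N * (P.s x - P.so) / a))) ν := fun a ha => by
    refine (HD.int_exp (L := log N / a) ps).congr (ae_of_all _ fun x => ?_)
    simp only; congr 2; ring
  have hmS : MeasurableSet {x | (P.s x - P.so) * log N ≤ T} := by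
    have := P.sm
    exact measurableSet_le (by fun_prop) measurable_const
  have key : (∫ x, exp (-(log N * (P.s x - P.so) / P.so)) ∂ν) - exp (-(T / (2 * P.so))) * (∫ x, exp (-(log N * (P.s x - P.so) / (2 * P.so))) ∂ν) ≤
      ∫ x in Ioc (0:ℝ) 1, {x | (P.s x - P.so) * log N ≤ T}.indicator (fun x => exp (-(log N * (P.s x - P.so) / P.so))) x := by
    rw [← integral_const_mul, ← integral_sub (hi _ ps) ((hi _ ps).const_mul _)]
    refine integral_mono ((hi _ ps).sub ((hi _ ps).const_mul _)) ((hi _ ps).indicator hmS) fun x => ?_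
    simp only [indicator, mem_ofPred_eq]
    split_ifs with h
    · have : 0 ≤ exp (-(T / (2 * P.so))) * exp (-(log N * (P.s x - P.so) / (2 * P.so))) := by positivity
      linarith
    · push Not at h
      rw [sub_nonpos, ← exp_add, exp_le_exp]
      have : T / (2 * P.so) ≤ log N * (P.s x - P.so) / (2 * P.so) := by gcongr; linarith
      have e : log N * (P.s x - P.so) / P.so = 2 * (log N * (P.s x - P.so) / (2 * P.so)) := by field_simp
      linarith
  refine le_trans (le_of_eq_of_le ?_ (sub_le_sub_right (mul_le_mul_of_nonneg_left key (by positivity : 0 ≤ N / π * I)) _)) hO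
  generalize ν.real {x | P.s x - P.so < 1 / log N} = F at hF ⊢
  field_simp

end fz

section g1
abbrev EE := Lp ℝ 2 (volume.restrict (Ioo (0:ℝ) 1))

def ce (J j k : ℕ) : EE := ((cb_memLp J j k 2).restrict (Ioo 0 1)).toLp _

lemma ce_coe (J j k : ℕ) : (ce J j k : ℝ → ℝ) =ᵐ[volume.restrict (Ioo (0:ℝ) 1)] cb J j k := MemLp.coeFn_toLp _

lemma ce_inner {J j k : ℕ} (hj : j < J) (f : EE) : ip (ce J j k) f = ∫ x, cb J j k x * f x := by
  rw [L2.inner_def, ← setIntegral_eq_integral_of_forall_compl_eq_zero (s := Ioc 0 1) (f := fun x => cb J j k x * f x), ← restrict_Ioo_eq_restrict_Ioc]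
  · refine integral_congr_ae ?_
    filter_upwards [ce_coe J j k] with x h
    rw [h]; simp [mul_comm]
  · intro x hx
    have : x ∉ blk J j := fun h => hx (blk_sub hj h)
    simp [cb, this]

lemma ce_orth (J : ℕ) (hJ : 0 < J) : Orthonormal ℝ (fun l : Fin J × ℕ => ce J l.1 l.2) := by
  rw [orthonormal_iff_ite]
  intro a b
  rw [ce_inner a.1.2]
  have e : ∫ x, cb J a.1 a.2 x * (ce J b.1 b.2 : ℝ → ℝ) x = ∫ x, cb J a.1 a.2 x * cb J b.1 b.2 x := by
    refine integral_congr_ae ?_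
    have := ae_imp_of_ae_restrict (ce_coe J b.1 b.2)
    filter_upwards [this, (measure_eq_zero_iff_ae_notMem.1 (volume_singleton (a := 1)))] with x h ho
    by_cases hx : x ∈ blk J a.1
    · have := blk_sub a.1.2 hx
      rw [h ⟨this.1, lt_of_le_of_ne this.2 ho⟩]
    · simp [cb, hx]
  rw [e, cb_orth _ _ _ _ _ hJ]
  simp [Prod.ext_iff, Fin.ext_iff]

lemma ce_complete (J : ℕ) (hJ : 0 < J) (f : EE) (h : ∀ (j : Fin J) (k : ℕ), ip (ce J j k) f = 0) : f = 0 := by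
  have hJ' : (0:ℝ) < J := mod_cast hJ
  have hf : IntegrableOn f (Ioc 0 1) := by
    rw [IntegrableOn, ← restrict_Ioo_eq_restrict_Ioc]
    exact memLp_one_iff_integrable.1 ((Lp.memLp f).mono_exponent (by norm_num))
  have hb : ∀ j < J, ∀ g : ℝ → ℝ, Continuous g → ∫ x in blk J j, g x * f x = 0 := fun j hj g hg => by
    refine cb_complete_blk J j hJ f (hf.mono_set (blk_sub hj)) (fun k => ?_) g hg
    have ho := h ⟨j, hj⟩ k
    rw [ce_inner hj] at ho
    have e : ∀ x, cb J j k x * f x = (blk J j).indicator (fun x => cco J k * (f x * cos (π * k * (J * x - j)))) x := fun x => by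
      simp only [cb, indicator]; split_ifs <;> ring
    simp only [e] at ho
    rw [integral_indicator (blk_meas J j), integral_const_mul] at ho
    refine (mul_eq_zero.1 ho).resolve_left ?_
    unfold cco; split_ifs <;> positivity
  have hall : ∀ g : ℝ → ℝ, Continuous g → (∃ C, ∀ x, ‖g x‖ ≤ C) → ∫ x in Ioc (0:ℝ) 1, g x * f x = 0 := fun g hg ⟨C, hC⟩ => by
    rw [← sum_blk J hJ _ (hf.bdd_mul hg.aestronglyMeasurable (ae_of_all _ hC))]
    exact Finset.sum_eq_zero fun j hj => hb j (Finset.mem_range.1 hj) g hg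
  have h0 : ∀ᵐ x, (Ioc (0:ℝ) 1).indicator f x = 0 := by
    refine ae_eq_zero_of_integral_contDiff_smul_eq_zero (hf.integrable_indicator measurableSet_Ioc).locallyIntegrable fun g hg hgc => ?_
    obtain ⟨C, hC⟩ := hgc.exists_bound_of_continuous hg.continuous
    refine Eq.trans ?_ (hall g hg.continuous ⟨C, hC⟩)
    rw [← integral_indicator measurableSet_Ioc]
    congr 1; ext x; simp only [indicator, smul_eq_mul]; split_ifs <;> simp
  refine (Lp.eq_zero_iff_ae_eq_zero).2 ?_
  rw [EventuallyEq, ae_restrict_iff' measurableSet_Ioo]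
  filter_upwards [h0] with x hx hx'
  rwa [indicator_of_mem (Ioo_subset_Ioc_self hx')] at hx
end g1

section g2
open scoped ComplexConjugate

lemma cbK_bd (P : Stg) {J j : ℕ} (hj : j < J) (k : ℕ) (y ξ : ℝ) :
    ‖(cb J j k y : ℂ) * P.K y ξ‖ ≤ |cco J k| * (2 * P.M * Wf P.so P.sz ξ) := by
  have hw := (P.gk hj).nonneg (by omega) ξ
  by_cases h : y ∈ blk J j
  · rw [norm_mul, Complex.norm_real]
    exact mul_le_mul (cb_bound J j k y) ((P.gk hj).bd y h ξ) (norm_nonneg _) (abs_nonneg _)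
  · simp only [cb, indicator_of_notMem h, Complex.ofReal_zero, zero_mul, norm_zero]; positivity

lemma GmBM_eq (P : Stg) {H : ℝ → ℝ} (hs : ∀ x ∈ I₁, P.s x = H x + 1/2) (hc : ∀ x ∈ I₁, P.c x = Cstar (H x))
    {x y : ℝ} (hx : x ∈ I₁) (hy : y ∈ I₁) :
    GmBM H x y = ∫ ξ, (P.K y ξ * conj (P.K x ξ)).re := by
  unfold GmBM
  rw [← integral_const_mul]
  refine integral_congr_ae ?_
  filter_upwards [measure_eq_zero_iff_ae_notMem.1 (volume_singleton (a := 0))] with ξ h0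
  have hξ : 0 < |ξ| := abs_pos.2 h0
  have eo : |ξ| ^ (-(H x + H y + 1)) = |ξ| ^ (-(H y + 1/2)) * |ξ| ^ (-(H x + 1/2)) := by
    rw [← rpow_add hξ]; congr 1; ring
  have ez : conj (Complex.exp (Complex.I * y * ξ)) = Complex.exp (-Complex.I * y * ξ) := by
    rw [← Complex.exp_conj]; simp
  unfold Stg.K Kb
  rw [hs x hx, hs y hy, hc x hx, hc y hy, ← Complex.conj_re (_ * conj _), eo]
  simp only [map_mul, map_sub, Complex.conj_conj, Complex.conj_ofReal, map_one, ez]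
  rw [show ((Cstar (H y) : ℂ) * (Complex.exp (-Complex.I * y * ξ) - 1) * ((|ξ| ^ (-(H y + 1/2)) : ℝ) : ℂ) *
    ((Cstar (H x) : ℂ) * (Complex.exp (Complex.I * x * ξ) - 1) * ((|ξ| ^ (-(H x + 1/2)) : ℝ) : ℂ))) =
    ((Cstar (H x) * Cstar (H y) * (|ξ| ^ (-(H y + 1/2)) * |ξ| ^ (-(H x + 1/2))) : ℝ) : ℂ) *
      ((Complex.exp (Complex.I * x * ξ) - 1) * (Complex.exp (-Complex.I * y * ξ) - 1)) by push_cast; ring, Complex.re_ofReal_mul]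
  ring

lemma cov_eq (P : Stg) {H : ℝ → ℝ} (hs : ∀ x ∈ I₁, P.s x = H x + 1/2) (hc : ∀ x ∈ I₁, P.c x = Cstar (H x))
    {J j j' : ℕ} (hj : j < J) (hj' : j' < J) (k k' : ℕ) :
    ∫ x in Ioo (0:ℝ) 1, ∫ y in Ioo (0:ℝ) 1, GmBM H x y * ce J j k x * ce J j' k' y =
      ip (toF (AA J j k P.K)) (toF (AA J j' k' P.K)) := by
  have hJ : 0 < J := by omega
  set ν := volume.restrict (Ioo (0:ℝ) 1) with hν
  set w := fun ξ => 2 * P.M * Wf P.so P.sz ξ with hw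
  have hwi : Integrable fun ξ => w ξ ^ 2 := Wc_int P.hso P.hsz _
  have hKm : Measurable (Function.uncurry P.K) := Kb_meas P.cm P.sm
  have hAA : ∀ j < J, ∀ k ξ, AA J j k P.K ξ = ∫ y, (cb J j k y : ℂ) * P.K y ξ ∂ν := fun j hj k ξ => by
    rw [hν, restrict_Ioo_eq_restrict_Ioc, setIntegral_eq_integral_of_forall_compl_eq_zero]
    · rfl
    · intro x hx
      have : x ∉ blk J j := fun h => hx (blk_sub hj h)
      simp [cb, this]
  set F : ℝ × ℝ → ℝ → ℝ := fun z ξ => (((cb J j' k' z.2 : ℂ) * P.K z.2 ξ) * conj ((cb J j k z.1 : ℂ) * P.K z.1 ξ)).re with hF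
  have hFm : Measurable (Function.uncurry F) := by
    have ho := cb_meas J j k; have hO := cb_meas J j' k'
    have mz : Measurable fun v : (ℝ × ℝ) × ℝ => P.K v.1.2 v.2 := hKm.comp (by fun_prop : Measurable fun v : (ℝ × ℝ) × ℝ => (v.1.2, v.2))
    have ma : Measurable fun v : (ℝ × ℝ) × ℝ => P.K v.1.1 v.2 := hKm.comp (by fun_prop : Measurable fun v : (ℝ × ℝ) × ℝ => (v.1.1, v.2))
    have mb : Measurable fun v : (ℝ × ℝ) × ℝ => conj ((cb J j k v.1.1 : ℂ) * P.K v.1.1 v.2) :=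
      Complex.continuous_conj.measurable.comp (Measurable.mul (by fun_prop) ma)
    exact Complex.measurable_re.comp ((Measurable.mul (by fun_prop) mz).mul mb)
  have hint : Integrable (Function.uncurry F) ((ν.prod ν).prod volume) := by
    refine ((integrable_const (|cco J k'| * |cco J k|) (μ := ν.prod ν)).mul_prod hwi).mono' hFm.aestronglyMeasurable (ae_of_all _ fun v => ?_)
    refine (Complex.abs_re_le_norm _).trans ?_
    rw [norm_mul, RCLike.norm_conj]
    refine (mul_le_mul (cbK_bd P hj' k' _ _) (cbK_bd P hj k _ _) (norm_nonneg _) ((norm_nonneg _).trans (cbK_bd P hj' k' v.1.2 v.2))).trans (le_of_eq ?_)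
    simp only [hw]; ring
  rw [toF_inner ((P.gk hj).memLp hJ hwi k) ((P.gk hj').memLp hJ hwi k')]
  have eo : ∀ ξ, (AA J j' k' P.K ξ * conj (AA J j k P.K ξ)).re = ∫ z, F z ξ ∂(ν.prod ν) := fun ξ => by
    have iz : Integrable (fun x => conj ((cb J j k x : ℂ) * P.K x ξ)) ν :=
      Complex.conjCLE.toContinuousLinearMap.integrable_comp ((P.gk hj).int k ξ).restrict
    have io := ((P.gk hj').int k' ξ).restrict (s := Ioo 0 1)
    have hO := iz.mul_prod io
    rw [hAA j' hj', hAA j hj, ← integral_conj, mul_comm, ← integral_prod_mul]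
    refine ((Complex.reCLM.integral_comp_comm hO).symm).trans ?_
    congr 1; ext z; simp only [hF, Complex.reCLM_apply]; rw [mul_comm]
  simp only [eo]
  rw [← integral_integral_swap hint, integral_prod (fun z => ∫ ξ, F z ξ) hint.integral_prod_left]
  refine integral_congr_ae ?_
  filter_upwards [ce_coe J j k, ae_restrict_mem measurableSet_Ioo] with x hx hxI
  refine integral_congr_ae ?_
  filter_upwards [ce_coe J j' k', ae_restrict_mem measurableSet_Ioo] with y hy hyI
  rw [hx, hy, GmBM_eq P hs hc (Ioo_subset_Icc_self hxI) (Ioo_subset_Icc_self hyI), mul_assoc, ← integral_mul_const]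
  congr 1; ext ξ
  simp only [hF, map_mul, Complex.conj_ofReal]
  rw [show (cb J j' k' y : ℂ) * P.K y ξ * ((cb J j k x : ℂ) * conj (P.K x ξ)) = ((cb J j k x * cb J j' k' y : ℝ) : ℂ) * (P.K y ξ * conj (P.K x ξ)) by push_cast; ring,
    Complex.re_ofReal_mul, mul_comm]
end g2

section g3

theorem Lam_lim (P : Stg) {H Cf : ℝ → ℝ} {σ : ℝ} (hs : ∀ x ∈ I₁, P.s x = H x + 1/2) (hc : ∀ x ∈ I₁, P.c x = Cstar (H x))
    (hcp : ∀ x ∈ I₁, 0 < P.c x)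
    (hCf : ContinuousAt Cf P.so) (hCo : 0 < Cf P.so) (hcs : ∀ x ∈ I₁, P.c x = Cf (P.s x))
    (HD : Dst (volume.restrict (Ioc 0 1)) (fun x => P.s x - P.so) σ)
    [MeasurableSpace EE] [BorelSpace EE] (μ : Measure EE) [IsProbabilityMeasure μ]
    (hG : ∀ L : EE →L[ℝ] ℝ, ∃ v : ℝ≥0, μ.map L = ProbabilityTheory.gaussianReal 0 v)
    (hCov : ∀ u v : EE, ∫ f, (ip u f) * (ip v f) ∂μ =
        ∫ x in Ioo (0:ℝ) 1, ∫ y in Ioo (0:ℝ) 1, GmBM H x y * u x * v y) :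
    Tendsto (fun N : ℝ => (2 * -log (∫ f, exp (-(N ^ (2 * P.so) / 2 * ‖f‖ ^ 2)) ∂μ)) /
      (N * (volume.restrict (Ioc 0 1)).real {x | P.s x - P.so < 1 / log N})) atTop
      (nhds ((2 * π * Cf P.so ^ 2) ^ (1 / (2 * P.so)) / sin (π / (2 * P.so)) * (Gamma (σ + 1) * P.so ^ σ))) := by
  have hM : ∀ J : ℕ, ∀ a b : Fin J, ∀ k l : ℕ, ∫ f, (ip (ce J a k) f) * (ip (ce J b l) f) ∂μ =
      ip (toF (AA J a k P.K)) (toF (AA J b l P.K)) := fun J a b k l => by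
    rw [hCov, cov_eq P hs hc a.2 b.2]
  rw [tendsto_order]
  refine ⟨fun z hz => D_lower P hCf hCo hcs HD ?_ hz, fun z hz => D_upper P hCf hCo hcs HD ?_ hz⟩
  · intro b b' A T ho hO h3 h4 h5 h6
    obtain ⟨C, hC⟩ := lower_asym P ho hO h3 h4 h5 h6
    refine ⟨C, ?_⟩
    filter_upwards [hC, eventually_gt_atTop 0] with N ⟨J, K, ka, hJ, h⟩ hN
    refine h.trans ?_
    have := lap_lower μ hG (fun l : Fin J × Fin K => ce J l.1 (ka + l.2))
      ((ce_orth J hJ).comp (fun l : Fin J × Fin K => (l.1, ka + (l.2:ℕ))) (fun a b hab => by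
        simp only [Prod.mk.injEq, Nat.add_left_cancel_iff] at hab
        exact Prod.ext hab.1 (Fin.ext hab.2)))
      (by positivity : 0 < N ^ (2 * P.so) / 2) (Matrix.gram ℝ (fun l : Fin J × Fin K => toF (AA J l.1 (ka + l.2) P.K)))
      (Matrix.posSemidef_gram ℝ _) (fun k l => hM J _ _ _ _)
    rw [mul_div_cancel₀ _ two_ne_zero] at this
    linarith
  · intro η hη
    obtain ⟨C, hC⟩ := upper_asym P hcp hη
    refine ⟨C, ?_⟩
    filter_upwards [hC, eventually_gt_atTop 0] with N ⟨J, hJ, h⟩ hN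
    have := lap_upper μ hG (fun (j : Fin J) k => ce J j k) (ce_orth J hJ) (fun f hf => ce_complete J hJ f hf)
      (by positivity : 0 < N ^ (2 * P.so) / 2) (fun K => Matrix.gram ℝ (fun l : Fin J × Fin K => toF (AA J l.1 l.2 P.K)))
      (fun K => Matrix.posSemidef_gram ℝ _) (fun K k l => hM J _ _ _ _) _ (fun K => by
        rw [mul_div_cancel₀ _ two_ne_zero]; exact h K)
    linarith
end g3

section r1
variable {ν : Measure ℝ} {h : ℝ → ℝ} {σ : ℝ}

lemma Dst.ratio (HD : Dst ν h σ) {ι : Type*} {l : Filter ι} {a b : ι → ℝ} {v : ℝ} (hv : 0 < v)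
    (hb : Tendsto b l (nhdsWithin 0 (Ioi 0))) (hab : Tendsto (fun i => a i / b i) l (nhds v)) :
    Tendsto (fun i => ν.real {x | h x < a i} / ν.real {x | h x < b i}) l (nhds (v ^ σ)) := by
  have hbp : ∀ᶠ i in l, 0 < b i := hb.eventually self_mem_nhdsWithin
  have hcont : ContinuousAt (fun v : ℝ => v ^ σ) v := continuousAt_rpow_const _ _ (Or.inl hv.ne')
  rw [tendsto_order]
  constructor
  · intro z hz
    have ho : ∀ᶠ w in nhdsWithin v (Iio v), z < w ^ σ ∧ 0 < w ∧ w < v :=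
      (((hcont.eventually (lt_mem_nhds hz)).filter_mono nhdsWithin_le_nhds).and
        (((lt_mem_nhds hv)).filter_mono nhdsWithin_le_nhds)).mp (eventually_mem_nhdsWithin.mono fun w ho hO => ⟨hO.1, hO.2, ho⟩)
    obtain ⟨w, hw, hwo, hwv⟩ := ho.exists
    filter_upwards [hbp, hab.eventually (lt_mem_nhds hwv), ((HD.lim w hwo).comp hb).eventually (lt_mem_nhds hw)] with i h0 ho hO
    rw [lt_div_iff₀ h0] at ho
    exact hO.trans_le (div_le_div_of_nonneg_right (HD.mono ho.le) (HD.pos _ h0).le)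
  · intro z hz
    have ho : ∀ᶠ w in nhdsWithin v (Ioi v), w ^ σ < z ∧ v < w :=
      (((hcont.eventually (gt_mem_nhds hz)).filter_mono nhdsWithin_le_nhds)).mp
        (eventually_mem_nhdsWithin.mono fun w ho hO => ⟨hO, ho⟩)
    obtain ⟨w, hw, hwv⟩ := ho.exists
    filter_upwards [hbp, hab.eventually (gt_mem_nhds hwv), ((HD.lim w (hv.trans hwv)).comp hb).eventually (gt_mem_nhds hw)] with i h0 ho hO
    rw [div_lt_iff₀ h0] at ho
    exact (div_le_div_of_nonneg_right (HD.mono ho.le) (HD.pos _ h0).le).trans_lt hO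

lemma odd_div (a b : ℝ) : 1 / a / (1 / b) = b / a := by rw [one_div, one_div, inv_div_inv]

lemma Dst.log_small (HD : Dst ν h σ) :
    Tendsto (fun L => log (ν.real {x | h x < 1 / L}) / L) atTop (nhds 0) := by
  rw [tendsto_order]
  constructor
  · intro z hz
    filter_upwards [(HD.exp_small (neg_pos.2 hz)).eventually (gt_mem_nhds one_pos), eventually_gt_atTop 0] with L ho hO
    have hp := HD.pos (1 / L) ps
    rw [div_lt_one hp, ← lt_log_iff_exp_lt hp] at ho
    rw [lt_div_iff₀ hO]; linarith
  · intro z hz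
    filter_upwards [eventually_gt_atTop 0] with L hO
    have hp := HD.pos (1 / L) ps
    exact (div_nonpos_of_nonpos_of_nonneg (log_nonpos hp.le (HD.le_one _)) hO.le).trans_lt hz

theorem final_asym {Ω : Type*} [MeasurableSpace Ω] (μ : Measure Ω) [IsProbabilityMeasure μ] {Y : Ω → ℝ} (hYm : Measurable Y)
    (hY : ∀ ω, 0 ≤ Y ω) (HD : Dst ν h σ) {Hm K : ℝ} (hHm : 0 < Hm) (hK : 0 < K)
    (hL : Tendsto (fun N : ℝ => (2 * -log (∫ f, exp (-(N ^ (2 * (Hm + 1/2)) / 2 * Y f)) ∂μ)) /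
      (N * ν.real {x | h x < 1 / log N})) atTop (nhds K))
    {s₀ : ℝ} (hs₀ : 0 < s₀) {φ : ℝ → ℝ} (hφ : ∀ s, 0 < s → s < s₀ → ν.real {x | h x < s} = s ^ σ * φ (1 / s)) :
    Tendsto (fun ε : ℝ => ε ^ (1 / Hm) * ((log (1/ε)) ^ σ / φ (log (1/ε))) ^ ((2 * Hm + 1) / (2 * Hm)) *
      log (μ.real {f | Y f ≤ ε ^ 2})) (nhdsWithin 0 (Ioi 0))
      (nhds (-(Hm * (K * Hm ^ σ / (2 * Hm + 1)) ^ ((2 * Hm + 1) / (2 * Hm))))) := by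
  set Λ : ℝ → ℝ := fun γ => -log (∫ f, exp (-γ * Y f) ∂μ) with hΛd
  set F : ℝ → ℝ := fun s => ν.real {x | h x < s} with hF
  set p := 1 / (2 * Hm + 1) with hp
  have hpo : 0 < p := by positivity
  have hpa : p < 1 := by rw [hp, div_lt_one ps]; linarith
  have hΛ : ∀ γ, 0 < γ → ∫ ω, exp (-γ * Y ω) ∂μ = exp (-Λ γ) := fun γ hγ => by
    rw [hΛd]; simp only [neg_neg]
    rw [exp_log]
    refine integral_exp_pos (Integrable.of_bound (C := 1) (by fun_prop) (Eventually.of_forall fun x => ?_))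
    rw [norm_eq_abs, abs_of_pos (exp_pos _), exp_le_one_iff]
    have := mul_nonneg hγ.le (hY x); linarith
  have hL' : Tendsto (fun N : ℝ => Λ (N ^ (2 * Hm + 1) / 2) / (N * F (1 / log N))) atTop (nhds (K / 2)) := by
    refine (hL.div_const 2).congr fun N => ?_
    simp only [hΛd]
    rw [show 2 * (Hm + 1/2) = 2 * Hm + 1 by ring]
    simp only [neg_mul]
    ring
  have hlog := tendsto_log_atTop
  have hGtop : Tendsto (fun N : ℝ => N * F (1 / log N)) atTop atTop := by
    have ho := (HD.exp_small one_pos).comp hlog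
    have hO : Tendsto (fun N : ℝ => (exp (-(1 * log N)) / F (1 / log N))⁻¹) atTop atTop := by
      refine Tendsto.inv_tendsto_nhdsGT_zero (tendsto_nhdsWithin_iff.2 ⟨ho, ?_⟩)
      filter_upwards [hlog.eventually_gt_atTop 0] with N hN
      exact div_pos (exp_pos _) (HD.pos _ ps)
    refine hO.congr' ?_
    filter_upwards [eventually_gt_atTop 0] with N hN
    rw [one_mul, exp_neg, exp_log hN, inv_div, div_inv_eq_mul, mul_comm]
  set Nf : ℝ → ℝ := fun γ => (2 * γ) ^ p with hNf
  have hNtop : Tendsto Nf atTop atTop :=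
    (tendsto_rpow_atTop hpo).comp (tendsto_id.const_mul_atTop two_pos)
  have hNinv : ∀ γ, 0 < γ → Nf γ ^ (2 * Hm + 1) / 2 = γ := fun γ hγ => by
    simp only [hNf]
    rw [← rpow_mul ps, hp, one_div_mul_cancel ps, rpow_one]; ring
  have hΛN : Tendsto (fun γ => Λ γ / (Nf γ * F (1 / log (Nf γ)))) atTop (nhds (K / 2)) := by
    refine (hL'.comp hNtop).congr' ?_
    filter_upwards [eventually_gt_atTop 0] with γ hγ
    simp only [Function.comp, hNinv γ hγ]
  have hGN := hGtop.comp hNtop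
  have htop : Tendsto Λ atTop atTop := by
    refine (hGN.atTop_mul_pos (half_pos hK) hΛN).congr' ?_
    filter_upwards [hGN.eventually_gt_atTop 0] with γ hγ
    exact mul_div_cancel₀ _ (ne_of_gt hγ)
  have hreg : ∀ c, 0 < c → Tendsto (fun γ => Λ (c * γ) / Λ γ) atTop (nhds (c ^ p)) := by
    intro c hc
    have hcg : Tendsto (fun γ : ℝ => c * γ) atTop atTop := tendsto_id.const_mul_atTop hc
    have hNc : ∀ᶠ γ in atTop, Nf (c * γ) = c ^ p * Nf γ := by
      filter_upwards [eventually_gt_atTop 0] with γ hγ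
      simp only [hNf]
      rw [← mul_rpow hc.le ps]; congr 1; ring
    have hlr : Tendsto (fun γ => (1 / log (Nf (c * γ))) / (1 / log (Nf γ))) atTop (nhds 1) := by
      have ho : Tendsto (fun γ => log (c ^ p) / log (Nf γ) + 1) atTop (nhds (0 + 1)) :=
        ((hlog.comp hNtop).const_div_atTop _).add_const 1
      have hO := ho.inv₀ (by norm_num)
      rw [zero_add, inv_one] at hO
      refine hO.congr' ?_
      filter_upwards [hNc, hNtop.eventually_gt_atTop 0, (hlog.comp hNtop).eventually_gt_atTop 0] with γ e h0 h3
      rw [e, log_mul ps h0.ne']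
      simp only [Function.comp] at h3
      rw [div_add_one h3.ne', inv_div, odd_div]
    have hFr := HD.ratio one_pos (inv_nhds.comp (hlog.comp hNtop)) hlr
    rw [one_rpow] at hFr
    have h3 := (((hΛN.comp hcg).div hΛN (half_pos hK).ne').mul hFr).const_mul (c ^ p)
    rw [div_self (half_pos hK).ne', mul_one, mul_one] at h3
    refine h3.congr' ?_
    filter_upwards [hNc, hNtop.eventually_gt_atTop 0, hGN.eventually_gt_atTop 0, (hGN.comp hcg).eventually_gt_atTop 0] with γ e h0 h4 h5
    change 0 < _ * _ at h4 h5
    have h6 := pos_of_mul_pos_right h4 h0.le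
    have h7 := pos_of_mul_pos_right h5 (by rw [e]; positivity)
    have hcp : 0 < c ^ p := by positivity
    change c ^ p * (Λ (c * γ) / (Nf (c * γ) * F (1 / log (Nf (c * γ)))) / (Λ γ / (Nf γ * F (1 / log (Nf γ)))) *
      (F (1 / log (Nf (c * γ))) / F (1 / log (Nf γ)))) = _
    generalize F (1 / log (Nf (c * γ))) = x at *
    generalize F (1 / log (Nf γ)) = y at *
    rw [e]
    generalize Nf γ = n at *
    generalize Λ (c * γ) = a at *
    generalize Λ γ = b at *
    rcases eq_or_ne b 0 with hb | hb
    · simp [hb]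
    field_simp
  set l := nhdsWithin (0:ℝ) (Ioi 0) with hl
  have hℓ : Tendsto (fun ε : ℝ => log (1 / ε)) l atTop := 
    hlog.comp ((tendsto_inv_nhdsGT_zero (𝕜 := ℝ)).congr fun x => (one_div x).symm)
  have hε : ∀ᶠ ε : ℝ in l, 0 < ε := eventually_mem_nhdsWithin
  set B := K * Hm ^ σ / (2 * Hm + 1) with hB
  have hBp : 0 < B := by positivity
  set A : ℝ → ℝ := fun ε => F (1 / log (1 / ε)) with hA
  have hAp : ∀ᶠ ε in l, 0 < A ε := by
    filter_upwards [hℓ.eventually_gt_atTop 0] with ε ho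
    exact HD.pos _ ps
  set N : ℝ → ℝ := fun ε => (B * A ε * (1 / ε) ^ 2) ^ (1 / (2 * Hm)) with hN
  have hlogN : Tendsto (fun ε => log (N ε) / log (1 / ε)) l (nhds (1 / Hm)) := by
    have ho := HD.log_small.comp hℓ
    have hO : Tendsto (fun ε => 1 / (2 * Hm) * (log B / log (1 / ε) + log (A ε) / log (1 / ε) + 2)) l
        (nhds (1 / (2 * Hm) * (0 + 0 + 2))) := (((hℓ.const_div_atTop _).add ho).add_const 2).const_mul _
    rw [show 1 / (2 * Hm) * (0 + 0 + 2) = 1 / Hm by field_simp; norm_num] at hO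
    refine hO.congr' ?_
    filter_upwards [hε, hAp, hℓ.eventually_gt_atTop 0] with ε h0 ho h3
    simp only [hN]
    rw [log_rpow ps, log_mul ps ps, log_mul ps ps, log_pow]
    push_cast
    field_simp
  have hlNtop : Tendsto (fun ε => log (N ε)) l atTop := by
    refine (hℓ.atTop_mul_pos ps hlogN).congr' ?_
    filter_upwards [hℓ.eventually_gt_atTop 0] with ε h3
    exact mul_div_cancel₀ _ h3.ne'
  have hNp : ∀ᶠ ε in l, 0 < N ε := by
    filter_upwards [hε, hAp] with ε h0 ho
    positivity
  have hNt : Tendsto N l atTop := by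
    refine (tendsto_exp_atTop.comp hlNtop).congr' ?_
    filter_upwards [hNp] with ε h0
    exact exp_log h0
  have hFA : Tendsto (fun ε => F (1 / log (N ε)) / A ε) l (nhds (Hm ^ σ)) := by
    refine HD.ratio hHm (inv_nhds.comp hℓ) ?_
    have := hlogN.inv₀ ps
    rw [one_div, inv_inv] at this
    refine this.congr fun ε => ?_
    rw [inv_div, odd_div]
  have hN2 : ∀ᶠ ε in l, N ε ^ (2 * Hm) = B * A ε * (1 / ε) ^ 2 := by
    filter_upwards [hε, hAp] with ε h0 ho
    simp only [hN]
    rw [← rpow_mul ps, one_div_mul_cancel ps, rpow_one]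
  have hγt : Tendsto (fun ε => N ε ^ (2 * Hm + 1) / 2) l atTop :=
    ((tendsto_rpow_atTop ps).comp hNt).atTop_div_const two_pos
  have hr : Tendsto (fun ε => N ε ^ (2 * Hm + 1) / 2 * ε ^ 2 / Λ (N ε ^ (2 * Hm + 1) / 2)) l (nhds p) := by
    have ho := (((hL'.comp hNt).mul hFA).inv₀ ps).const_mul (B / 2)
    rw [show B / 2 * (K / 2 * Hm ^ σ)⁻¹ = p by rw [hB, hp]; field_simp] at ho
    refine ho.congr' ?_
    filter_upwards [hε, hAp, hNp, hN2, hlNtop.eventually_gt_atTop 0] with ε h0 ho hO h3 h4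
    have h5 : 0 < F (1 / log (N ε)) := HD.pos _ ps
    simp only [Function.comp]
    have h6 : N ε ^ (2 * Hm + 1) = B * A ε * (1 / ε) ^ 2 * N ε := by rw [rpow_add hO, rpow_one, h3]
    generalize Λ (N ε ^ (2 * Hm + 1) / 2) = lam
    rw [h6]
    generalize F (1 / log (N ε)) = x at *
    generalize A ε = y at *
    generalize N ε = n at *
    rcases eq_or_ne lam 0 with hb | hb
    · simp [hb]
    field_simp
  have hT := tauber (μ := μ) hYm hY Λ hΛ p hpo hpa hreg htop _ (fun ε => ε ^ 2) hγt hr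
  have ho := (hT.mul (hr.inv₀ hpo.ne')).mul_const (B ^ ((2 * Hm + 1) / (2 * Hm)) / 2)
  rw [show -(1 - p) * p⁻¹ * (B ^ ((2 * Hm + 1) / (2 * Hm)) / 2) = -(Hm * B ^ ((2 * Hm + 1) / (2 * Hm))) by
    rw [hp]; generalize B ^ ((2 * Hm + 1) / (2 * Hm)) = z; field_simp; ring] at ho
  refine ho.congr' ?_
  filter_upwards [hε, hAp, hNp, hℓ.eventually_gt_atTop 0, hℓ.eventually_gt_atTop (1 / s₀),
    (htop.comp hγt).eventually_gt_atTop 0] with ε h0 ho hO h3 h4 h5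
  have h6 : A ε = (log (1 / ε) ^ σ / φ (log (1 / ε)))⁻¹ := by
    simp only [hA, hF]
    rw [hφ _ ps (by rw [div_lt_comm₀ hs₀ h3] at h4; exact h4), one_div_one_div, inv_div]
    generalize log (1 / ε) = q at *
    rw [one_div, inv_rpow h3.le, div_eq_inv_mul]
  have h7 : N ε ^ (2 * Hm + 1) * ε ^ 2 = B ^ ((2 * Hm + 1) / (2 * Hm)) * A ε ^ ((2 * Hm + 1) / (2 * Hm)) * (ε ^ (1 / Hm))⁻¹ := by
    simp only [hN]
    rw [← rpow_mul ps, show 1 / (2 * Hm) * (2 * Hm + 1) = (2 * Hm + 1) / (2 * Hm) by ring,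
      mul_rpow ps ps, mul_rpow ps ps, mul_assoc]
    congr 1
    rw [one_div, ← rpow_natCast, ← rpow_natCast, inv_rpow h0.le, inv_rpow ps, ← rpow_mul h0.le, ← rpow_neg h0.le,
      ← rpow_neg h0.le, ← rpow_add h0]
    congr 1
    push_cast
    field_simp
    ring
  have h8 : log (1 / ε) ^ σ / φ (log (1 / ε)) = (A ε)⁻¹ := by rw [h6, inv_inv]
  rw [h8, inv_rpow ho.le]
  have eo : 0 < A ε ^ ((2 * Hm + 1) / (2 * Hm)) := by positivity
  have ez : 0 < ε ^ (1 / Hm) := by positivity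
  have ee : 0 < B ^ ((2 * Hm + 1) / (2 * Hm)) := by positivity
  have ek : 0 < N ε ^ (2 * Hm + 1) := by positivity
  have h9 : N ε ^ (2 * Hm + 1) / 2 * ε ^ 2 = B ^ ((2 * Hm + 1) / (2 * Hm)) * A ε ^ ((2 * Hm + 1) / (2 * Hm)) * (ε ^ (1 / Hm))⁻¹ / 2 := by rw [← h7]; ring
  simp only [Function.comp] at h5
  generalize hlam : Λ (N ε ^ (2 * Hm + 1) / 2) = lam at *
  generalize log (μ.real {f | Y f ≤ ε ^ 2}) = w
  rw [h9]
  generalize A ε ^ ((2 * Hm + 1) / (2 * Hm)) = x at *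
  generalize ε ^ (1 / Hm) = y at *
  generalize B ^ ((2 * Hm + 1) / (2 * Hm)) = z at *
  field_simp
end r1

section sz

lemma Cs_arg_pos {x : ℝ} (h0 : 0 < x) (ho : x < 1) : 0 < Gamma (2 * x + 1) * sin (π * x) / (2 * π) :=
  div_pos (mul_pos (Gamma_pos_of_pos (by linarith)) (sin_pos_of_pos_of_lt_pi ps (by nlinarith [pi_pos])))
    ps

lemma Cstar_pos {x : ℝ} (h0 : 0 < x) (ho : x < 1) : 0 < Cstar x := sqrt_pos.2 (Cs_arg_pos h0 ho)

lemma Cstar_lip {a b : ℝ} (ha : 0 < a) (hb : b < 1) :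
    ∃ L, 0 ≤ L ∧ ∀ x ∈ Icc a b, ∀ y ∈ Icc a b, |Cstar x - Cstar y| ≤ L * |x - y| := by
  rcases lt_or_ge b a with hab | hab
  · exact ⟨0, le_rfl, fun x hx => absurd (hx.1.trans hx.2) (not_le.2 hab)⟩
  obtain ⟨K, hK⟩ := LocallyLipschitzOn.exists_lipschitzOnWith_of_compact (isCompact_Icc (a := 2 * a + 1) (b := 2 * b + 1))
    ((convexOn_Gamma.locallyLipschitzOn isOpen_Ioi).mono fun x hx => by
      have := hx.1; simp only [mem_Ioi]; linarith)
  obtain ⟨M, hM⟩ := isCompact_Icc.exists_bound_of_continuousOn hK.continuousOn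
  have hG : ∀ x ∈ Icc a b, 2 * x + 1 ∈ Icc (2 * a + 1) (2 * b + 1) := fun x hx => ⟨by linarith [hx.1], by linarith [hx.2]⟩
  set g : ℝ → ℝ := fun x => Gamma (2 * x + 1) * sin (π * x) / (2 * π) with hg
  have hM0 : 0 ≤ M := (norm_nonneg _).trans (hM _ (hG a ⟨le_rfl, hab⟩))
  have hgl : ∀ x ∈ Icc a b, ∀ y ∈ Icc a b, |g x - g y| ≤ (2 * K + M * π) * |x - y| := fun x hx y hy => by
    have ho := hK.dist_le_mul _ (hG x hx) _ (hG y hy)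
    have hO := lipschitzWith_sin.dist_le_mul (π * x) (π * y)
    rw [dist_eq, dist_eq] at ho hO
    rw [show 2 * x + 1 - (2 * y + 1) = 2 * (x - y) by ring, abs_mul, abs_two] at ho
    rw [← mul_sub, abs_mul, abs_of_pos pi_pos, NNReal.coe_one, one_mul] at hO
    have h3 := hM _ (hG y hy)
    rw [norm_eq_abs] at h3
    have h4 := abs_sin_le_one (π * x)
    have e : g x - g y = ((Gamma (2 * x + 1) - Gamma (2 * y + 1)) * sin (π * x) +
        Gamma (2 * y + 1) * (sin (π * x) - sin (π * y))) / (2 * π) := by simp only [hg]; ring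
    rw [e, abs_div, abs_of_pos (by positivity : 0 < 2 * π)]
    refine (div_le_self (abs_nonneg _) (by linarith [pi_gt_three])).trans ((abs_add_le _ _).trans ?_)
    rw [abs_mul, abs_mul]
    have h5 := mul_le_mul ho h4 (abs_nonneg _) ps
    have h6 := mul_le_mul h3 hO (abs_nonneg _) hM0
    linarith
  have hgc : ContinuousOn g (Icc a b) := by
    intro x hx
    rw [ContinuousWithinAt, tendsto_iff_dist_tendsto_zero]
    have ho : Tendsto (fun y => (2 * K + M * π) * |y - x|) (nhdsWithin x (Icc a b)) (nhds 0) := by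
      have : Continuous fun y => (2 * K + M * π) * |y - x| := by fun_prop
      simpa using this.continuousWithinAt (s := Icc a b) (x := x) |>.tendsto
    refine squeeze_zero' (Eventually.of_forall fun _ => dist_nonneg) ?_ ho
    filter_upwards [self_mem_nhdsWithin] with y hy
    exact hgl y hy x hx
  obtain ⟨z, hz, hzm⟩ := isCompact_Icc.exists_isMinOn ⟨a, le_rfl, hab⟩ hgc
  have hgz : 0 < g z := Cs_arg_pos (ha.trans_le hz.1) (hz.2.trans_lt hb)
  refine ⟨(2 * K + M * π) / √(g z), by positivity, fun x hx y hy => ?_⟩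
  have ho : g z ≤ g x := hzm hx
  have hO : g z ≤ g y := hzm hy
  have hz' := sqrt_pos.2 hgz
  have h3 : Cstar x = √(g x) := rfl
  have h4 : Cstar y = √(g y) := rfl
  rw [h3, h4, div_mul_eq_mul_div, le_div_iff₀ hz']
  refine le_trans ?_ (hgl x hx y hy)
  have h5 : g x - g y = (√(g x) - √(g y)) * (√(g x) + √(g y)) := by
    have := mul_self_sqrt (hgz.le.trans ho); have := mul_self_sqrt (hgz.le.trans hO); linarith
  rw [h5, abs_mul]
  refine mul_le_mul_of_nonneg_left ?_ (abs_nonneg _)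
  have := sqrt_le_sqrt ho
  exact (this.trans (le_add_of_nonneg_right (sqrt_nonneg _))).trans (le_abs_self _)

lemma Cstar_cont {x : ℝ} (h0 : 0 < x) (ho : x < 1) : ContinuousAt Cstar x := by
  obtain ⟨L, hL, h⟩ := Cstar_lip (a := x / 2) (b := (x + 1) / 2) (by linarith) (by linarith)
  have hn : Icc (x / 2) ((x + 1) / 2) ∈ nhds x := Icc_mem_nhds (by linarith) (by linarith)
  have : LipschitzOnWith ⟨L, hL⟩ Cstar (Icc (x / 2) ((x + 1) / 2)) := LipschitzOnWith.of_dist_le_mul fun x hx y hy => h x hx y hy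
  exact this.continuousOn.continuousAt hn

lemma exists_Stg {H : ℝ → ℝ} {r : ℝ} (hr : 0 < r) (hHol : HolderOn H r (Icc 0 1))
    (hrange : ∀ x ∈ I₁, 0 < H x ∧ H x < 1) {Hmin : ℝ} (hHmin : IsLeast (H '' Icc 0 1) Hmin) :
    ∃ P : Stg, P.so = Hmin + 1/2 ∧ (∀ x ∈ I₁, P.s x = H x + 1/2) ∧ (∀ x ∈ I₁, P.c x = Cstar (H x)) := by
  obtain ⟨C, hC⟩ := hHol
  have hcont := hold_cont hr hC
  obtain ⟨z, hz, hzm⟩ := isCompact_Icc.exists_isMaxOn ⟨0, by simp⟩ hcont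
  have hm : ∀ x ∈ I₁, Hmin ≤ H x := fun x hx => hHmin.2 ⟨x, hx, rfl⟩
  have hmo : 0 < Hmin := by obtain ⟨x, hx, e⟩ := hHmin.1; rw [← e]; exact (hrange x hx).1
  obtain ⟨L, hLo, hL⟩ := Cstar_lip hmo (hrange z hz).2
  have hIc : ∀ x ∈ I₁, H x ∈ Icc Hmin (H z) := fun x hx => ⟨hm x hx, hzm hx⟩
  set cl : ℝ → ℝ := fun x => max 0 (min x 1) with hcl
  have hclm : ∀ x, cl x ∈ I₁ := fun x => ⟨le_max_left _ _, max_le zero_le_one (min_le_right _ _)⟩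
  have hcle : ∀ x ∈ I₁, cl x = x := fun x hx => by simp only [hcl]; rw [min_eq_left hx.2, max_eq_right hx.1]
  have hHc : Continuous fun x => H (cl x) := hcont.comp_continuous (by fun_prop) hclm
  have hCc : Continuous fun x => Cstar (H (cl x)) := continuous_iff_continuousAt.2 fun x =>
    ContinuousAt.comp (f := fun x => H (cl x)) (Cstar_cont (hrange _ (hclm x)).1 (hrange _ (hclm x)).2) hHc.continuousAt
  have hHo : ∀ x ∈ I₁, ∀ y ∈ I₁, |H x - H y| ≤ |C| * |x - y| ^ min r 1 := fun x hx y hy => by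
    refine (hC x hx y hy).trans (mul_le_mul (le_abs_self _) ?_ ps (abs_nonneg _))
    rcases eq_or_ne x y with e | e
    · rw [e, sub_self, abs_zero, zero_rpow hr.ne', zero_rpow ps]
    · exact rpow_le_rpow_of_exponent_ge (abs_pos.2 (sub_ne_zero.2 e))
        (abs_le.2 ⟨by linarith [hx.1, hy.2], by linarith [hx.2, hy.1]⟩) (min_le_left _ _)
  obtain ⟨M, hM⟩ := (isCompact_Icc (a := (0:ℝ)) (b := 1)).exists_bound_of_continuousOn hCc.continuousOn
  let P : Stg := by
    refine ⟨fun x => H (cl x) + 1/2, fun x => Cstar (H (cl x)), Hmin + 1/2, H z + 1/2, max M 1, 1 + |C| + L * |C|, min r 1,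
      by linarith, by linarith [(hrange z hz).2], le_max_right _ _,
      by have := mul_nonneg hLo (abs_nonneg C); linarith [abs_nonneg C],
      by positivity, min_le_right _ _, (hHc.add_const _).measurable, hCc.measurable,
      fun y hy => ⟨by linarith [hm _ (hclm y)], by have := (hIc _ (hclm y)).2; linarith⟩,
      fun y hy => ⟨sqrt_nonneg _, ((le_abs_self _).trans (hM y hy)).trans (le_max_left _ _)⟩,
      fun x hx y hy => ?_, fun x hx y hy => ?_⟩
    · rw [hcle x hx, hcle y hy, add_sub_add_right_eq_sub]
      refine (hHo x hx y hy).trans (mul_le_mul_of_nonneg_right ?_ ps)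
      have := mul_nonneg hLo (abs_nonneg C); linarith
    · rw [hcle x hx, hcle y hy]
      have ho := mul_le_mul_of_nonneg_left (hHo x hx y hy) hLo
      refine ((hL _ (hIc x hx) _ (hIc y hy)).trans ho).trans ?_
      rw [← mul_assoc]
      exact mul_le_mul_of_nonneg_right (by linarith [abs_nonneg C]) ps

  exact ⟨P, rfl, fun x hx => by simp only [P, hcle x hx], fun x hx => by simp only [P, hcle x hx]⟩

lemma Dst_of {H s : ℝ → ℝ} {Hmin so σ s₀ : ℝ} {φ : ℝ → ℝ} (hsm : Measurable s) (hs : ∀ x ∈ I₁, s x = H x + 1/2) (ef : so = Hmin + 1/2)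
    (hHmin : IsLeast (H '' Icc 0 1) Hmin) (hσ : 0 < σ) (hs₀ : 0 < s₀) (hφpos : ∀ u : ℝ, 0 < u → 0 < φ u)
    (hφslow : ∀ c : ℝ, 0 < c → Tendsto (fun u => φ (c * u) / φ u) atTop (nhds 1))
    (hmeas : ∀ s : ℝ, 0 < s → s < s₀ →
      (volume {x | x ∈ I₁ ∧ 0 < H x - Hmin ∧ H x - Hmin < s}).toReal = s ^ σ * φ (1 / s))
    (hD : volume {x | x ∈ I₁ ∧ H x = Hmin} = 0) :
    Dst (volume.restrict (Ioc 0 1)) (fun x => s x - so) σ ∧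
    ∀ t, 0 < t → t < s₀ → (volume.restrict (Ioc (0:ℝ) 1)).real {x | s x - so < t} = t ^ σ * φ (1 / t) := by
  have hm : ∀ x ∈ I₁, Hmin ≤ H x := fun x hx => hHmin.2 ⟨x, hx, rfl⟩
  have key : ∀ t, 0 < t → t < s₀ → (volume.restrict (Ioc (0:ℝ) 1)).real {x | s x - so < t} = t ^ σ * φ (1 / t) := by
    intro t ht ht'
    rw [← hmeas t ht ht', Measure.real, Measure.restrict_apply (measurableSet_lt (by fun_prop) measurable_const)]
    congr 1
    refine measure_congr ?_
    filter_upwards [measure_eq_zero_iff_ae_notMem.1 hD, measure_eq_zero_iff_ae_notMem.1 (volume_singleton (a := 0))] with x hx h0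
    refine propext ⟨fun h => ?_, fun h => ?_⟩
    · have hI : x ∈ I₁ := ⟨h.2.1.le, h.2.2⟩
      have ho : s x - so < t := h.1
      rw [hs x hI, ef] at ho
      refine ⟨hI, sub_pos.2 (lt_of_le_of_ne (hm x hI) fun e => hx ⟨hI, e.symm⟩), by linarith⟩
    · have hI : x ∈ I₁ := h.1
      refine ⟨?_, lt_of_le_of_ne hI.1 fun e => h0 e.symm, hI.2⟩
      have := h.2.2
      change s x - so < t
      rw [hs x hI, ef]; linarith
  refine ⟨⟨by simp, by fun_prop, ?_, hσ, ?_, ?_⟩, key⟩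
  · filter_upwards [ae_restrict_mem measurableSet_Ioc] with x hx
    have hI : x ∈ I₁ := ⟨hx.1.le, hx.2⟩
    rw [hs x hI, ef]; linarith [hm x hI]
  · intro t ht
    have ho : 0 < min t (s₀ / 2) := by positivity
    have hO := key _ ho ((min_le_right _ _).trans_lt (by linarith))
    refine lt_of_lt_of_le (b := (volume.restrict (Ioc (0:ℝ) 1)).real {x | s x - so < min t (s₀ / 2)}) ?_ (measureReal_mono (fun x (hx : s x - so < min t (s₀ / 2)) => hx.trans_le (min_le_left _ _)))
    rw [hO]; exact mul_pos ps (hφpos _ ps)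
  · intro v hv
    have ho : Tendsto (fun t : ℝ => 1 / t) (nhdsWithin 0 (Ioi 0)) atTop := (tendsto_inv_nhdsGT_zero (𝕜 := ℝ)).congr fun x => (one_div x).symm
    have hO := ((hφslow (1 / v) ps).comp ho).const_mul (v ^ σ)
    rw [mul_one] at hO
    refine hO.congr' ?_
    have h3 : ∀ᶠ t : ℝ in nhdsWithin 0 (Ioi 0), t < min s₀ (s₀ / v) := (gt_mem_nhds ps).filter_mono nhdsWithin_le_nhds
    filter_upwards [self_mem_nhdsWithin, h3] with t (ht : 0 < t) ht'
    have h4 : t < s₀ := ht'.trans_le (min_le_left _ _)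
    have h5 : v * t < s₀ := by have := ht'.trans_le (min_le_right _ _); rw [lt_div_iff₀ hv] at this; linarith
    rw [key _ ht h4, key _ ps h5, mul_rpow hv.le ht.le, Function.comp, one_div_mul_one_div]
    have : 0 < t ^ σ := by positivity
    have := hφpos (1 / t) ps
    generalize φ (1 / t) = q at *
    generalize φ (1 / (v * t)) = q' at *
    field_simp
end sz

end aux

/-- Small ball asymptotics for the multifractional Brownian motion, case `Leb(D) = 0`. -/
theorem mBM_small_ball_zeroD
    (H : ℝ → ℝ) (r : ℝ) (hr : 0 < r) (hHol : HolderOn H r (Icc 0 1))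
    (hrange : ∀ x ∈ Icc (0:ℝ) 1, 0 < H x ∧ H x < 1)
    (Hmin : ℝ) (hHmin : IsLeast (H '' Icc 0 1) Hmin)
    (D : Set ℝ) (hD : D = {x | x ∈ Icc (0:ℝ) 1 ∧ H x = Hmin})
    -- Assumption 1
    (d : ℝ → ℝ) (c₁ c₂ C₀ κ : ℝ) (hc₁ : 0 < c₁) (hc₂ : 0 < c₂) (hC₀ : 0 < C₀) (hκ : 0 < κ)
    (hd₁ : ∀ x ∈ Icc (0:ℝ) 1, c₁ * infDist x D ≤ d x ∧ d x ≤ c₂ * infDist x D)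
    (hd₂ : ContDiffOn ℝ (⊤ : ℕ∞) d (Icc 0 1 \ D))
    (hd₃ : ∀ n : ℕ, 1 ≤ n → ∃ Cn : ℝ, ∀ x ∈ Icc (0:ℝ) 1 \ D,
      |iteratedDerivWithin n d (Icc 0 1 \ D) x| ≤ Cn * d x ^ ((1:ℝ) - n))
    (hhd : ∀ x ∈ Icc (0:ℝ) 1, H x - Hmin ≤ C₀ * d x ^ κ)
    -- Assumption 2
    (h₀ h₁ : ℝ → ℝ) (β : ℝ) (hβ : 0 < β)
    (hsplit : ∀ x ∈ Icc (0:ℝ) 1, H x - Hmin = h₀ x + h₁ x)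
    (hh₀Hol : HolderOn h₀ β (Icc 0 1)) (hh₁Hol : HolderOn h₁ β (Icc 0 1))
    (hh₀sm : ContDiffOn ℝ (⊤ : ℕ∞) h₀ (Icc 0 1 \ D))
    (hh₀der : ∀ n : ℕ, 1 ≤ n → ∃ Cn : ℝ, ∀ x ∈ Icc (0:ℝ) 1 \ D,
      |iteratedDerivWithin n h₀ (Icc 0 1 \ D) x| ≤ Cn * h₀ x * d x ^ (-(n:ℝ)))
    (τ δ₀ C' : ℝ) (hτ : 0 < τ) (hδ₀ : 0 < δ₀) (hC' : 0 < C')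
    (hh₁sm : ∀ x ∈ Icc (0:ℝ) 1, h₀ x < δ₀ → |h₁ x| ≤ C' * h₀ x ^ (1 + τ))
    -- Assumption 3
    (σ s₀ : ℝ) (φ : ℝ → ℝ) (hσ : 0 < σ) (hs₀ : 0 < s₀)
    (hφm : Measurable φ) (hφpos : ∀ u : ℝ, 0 < u → 0 < φ u)
    (hφslow : ∀ c : ℝ, 0 < c → Tendsto (fun u => φ (c * u) / φ u) atTop (nhds 1))
    (hmeas : ∀ s : ℝ, 0 < s → s < s₀ →
      (volume {x | x ∈ Icc (0:ℝ) 1 ∧ 0 < H x - Hmin ∧ H x - Hmin < s}).toReal = s ^ σ * φ (1 / s))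
    -- τ-condition: Leb(D) = 0
    (hDzero : volume D = 0)
    (hτD : σ * (Hmin + 1/2) + (1 - σ) / 2 < τ)
    -- the Gaussian measure
    [MeasurableSpace (Lp ℝ 2 (volume.restrict (Ioo (0:ℝ) 1)))]
    [BorelSpace (Lp ℝ 2 (volume.restrict (Ioo (0:ℝ) 1)))]
    (μ : Measure (Lp ℝ 2 (volume.restrict (Ioo (0:ℝ) 1)))) [IsProbabilityMeasure μ]
    (hGauss : ∀ L : Lp ℝ 2 (volume.restrict (Ioo (0:ℝ) 1)) →L[ℝ] ℝ,
      ∃ v : ℝ≥0, μ.map L = ProbabilityTheory.gaussianReal 0 v)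
    (hCov : ∀ u v : Lp ℝ 2 (volume.restrict (Ioo (0:ℝ) 1)),
      ∫ f, (@inner ℝ _ _ u f) * (@inner ℝ _ _ v f) ∂μ =
        ∫ x in Ioo (0:ℝ) 1, ∫ y in Ioo (0:ℝ) 1, GmBM H x y * u x * v y) :
    Tendsto (fun ε : ℝ =>
        ε ^ (1 / Hmin) *
          ((Real.log (1/ε)) ^ σ / φ (Real.log (1/ε))) ^ ((2 * Hmin + 1) / (2 * Hmin)) *
          Real.log (μ {f | ‖f‖ ≤ ε}).toReal)
      (nhdsWithin 0 (Ioi 0))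
      (nhds (-(Hmin *
        ((Real.Gamma (2 * Hmin + 1) * Real.sin (Real.pi * Hmin)) ^ (1 / (2 * Hmin + 1)) *
            Real.Gamma (σ + 1) * (Hmin * (Hmin + 1/2)) ^ σ /
          ((2 * Hmin + 1) * Real.sin (Real.pi / (2 * Hmin + 1)))) ^
            ((2 * Hmin + 1) / (2 * Hmin))))) := by
  obtain ⟨P, ef, hs, hc⟩ := exists_Stg hr hHol hrange hHmin
  obtain ⟨xo, hxo, exo⟩ := hHmin.1
  have hmo : 0 < Hmin := exo ▸ (hrange xo hxo).1
  have hmz : Hmin < 1 := exo ▸ (hrange xo hxo).2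
  obtain ⟨HD, hF⟩ := Dst_of P.sm hs ef hHmin hσ hs₀ hφpos hφslow hmeas (hD ▸ hDzero)
  have hcf : P.so - 1/2 = Hmin := by rw [ef]; ring
  have hLam := Lam_lim P (Cf := fun s => Cstar (s - 1/2)) hs hc
    (fun x hx => by rw [hc x hx]; exact Cstar_pos (hrange x hx).1 (hrange x hx).2)
    (ContinuousAt.comp (g := Cstar) (f := fun s : ℝ => s - 1/2) (by rw [hcf]; exact Cstar_cont hmo hmz) (by fun_prop))
    (by simp only [hcf]; exact Cstar_pos hmo hmz)
    (fun x hx => by simp only [hc x hx, hs x hx, add_sub_cancel_right]) HD μ hGauss hCov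
  have hpos := Cs_arg_pos hmo hmz
  have ez : 2 * π * Cstar Hmin ^ 2 = Real.Gamma (2 * Hmin + 1) * Real.sin (π * Hmin) := by
    rw [Cstar, Real.sq_sqrt hpos.le]; field_simp
  simp only [hcf] at hLam
  rw [ez] at hLam
  have hg : 0 < Real.Gamma (2 * Hmin + 1) * Real.sin (π * Hmin) := by
    rw [← ez]; have := Cstar_pos hmo hmz; positivity
  have hsin : 0 < Real.sin (π / (2 * Hmin + 1)) :=
    Real.sin_pos_of_pos_of_lt_pi (by positivity) (div_lt_self Real.pi_pos (by linarith))
  have ee : 2 * P.so = 2 * Hmin + 1 := by rw [ef]; ring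
  have hG1 := Real.Gamma_pos_of_pos (show 0 < σ + 1 by linarith)
  have hKp : 0 < (Real.Gamma (2 * Hmin + 1) * Real.sin (π * Hmin)) ^ (1 / (2 * P.so)) / Real.sin (π / (2 * P.so)) *
      (Real.Gamma (σ + 1) * P.so ^ σ) := by
    rw [ee, ef]; positivity
  have hfin := final_asym μ (Y := fun f => ‖f‖ ^ 2) (by fun_prop) (fun f => by positivity) HD hmo hKp
    (by rw [← ef]; exact hLam) hs₀ hF
  have ek : (Real.Gamma (2 * Hmin + 1) * Real.sin (π * Hmin)) ^ (1 / (2 * P.so)) / Real.sin (π / (2 * P.so)) *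
      (Real.Gamma (σ + 1) * P.so ^ σ) * Hmin ^ σ / (2 * Hmin + 1) =
      (Real.Gamma (2 * Hmin + 1) * Real.sin (Real.pi * Hmin)) ^ (1 / (2 * Hmin + 1)) *
            Real.Gamma (σ + 1) * (Hmin * (Hmin + 1/2)) ^ σ /
          ((2 * Hmin + 1) * Real.sin (Real.pi / (2 * Hmin + 1))) := by
    rw [ee, ef, Real.mul_rpow hmo.le (by positivity)]
    generalize (Real.Gamma (2 * Hmin + 1) * Real.sin (π * Hmin)) ^ (1 / (2 * Hmin + 1)) = A
    generalize Real.sin (π / (2 * Hmin + 1)) = B at *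
    generalize (Hmin + 1/2) ^ σ = Cz
    field_simp
  rw [ek] at hfin
  refine hfin.congr' ?_
  filter_upwards [self_mem_nhdsWithin] with ε (hε : 0 < ε)
  have : {f : Lp ℝ 2 (volume.restrict (Ioo (0:ℝ) 1)) | ‖f‖ ^ 2 ≤ ε ^ 2} = {f | ‖f‖ ≤ ε} := by
    ext f; exact pow_le_pow_iff_left₀ (norm_nonneg f) hε.le two_ne_zero
  rw [this, Measure.real]
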